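/- arXiv:2207.01655 — 2 statements merged into one kernel-verified Lean document; each statement's English description precedes it below -/
import Mathlib

section
/- There exist ε₀ > 0, ρ > 0, a > 0 and d ≥ 1, depending only on N, Λ, α, β, such that the following holds: if u is a bounded Borel measurable function on ℝ^N satisfying L_ε^- u ≤ ρ in Q_{10√N} and u ≥ 0 in ℝ^N, for some 0 < ε ≤ ε₀, and inf_{Q_3} u ≤ 1, then |{u > t} ∩ Q_1| ≤ d · exp(−√((log t)/a)) for every t ≥ 1. -/
open MeasureTheory Metric

/-- The second-order difference `δu(x,y) = u(x+y) + u(x−y) − 2u(x)`. -/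
noncomputable def ddiff {N : ℕ} (u : EuclideanSpace ℝ (Fin N) → ℝ)
    (x y : EuclideanSpace ℝ (Fin N)) : ℝ :=
  u (x + y) + u (x - y) - 2 * u x

/-- The minimal Pucci-type operator
`L_ε^- u(x) = (1/(2ε²))(α·inf_{z ∈ B_Λ} δu(x,εz) + β·⨍_{B_1} δu(x,εy) dy)`. -/
noncomputable def Lminus {N : ℕ} (Λ α β ε : ℝ) (u : EuclideanSpace ℝ (Fin N) → ℝ)
    (x : EuclideanSpace ℝ (Fin N)) : ℝ :=
  (1 / (2 * ε ^ 2)) *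
    (α * sInf ((fun z => ddiff u x (ε • z)) '' ball (0 : EuclideanSpace ℝ (Fin N)) Λ)
      + β * ⨍ y in ball (0 : EuclideanSpace ℝ (Fin N)) 1, ddiff u x (ε • y))

/-- The open axis-parallel cube with center having coordinates `c : Fin N → ℝ` and side
length `r`. -/
def cube {N : ℕ} (c : Fin N → ℝ) (r : ℝ) : Set (EuclideanSpace ℝ (Fin N)) :=
  {y | ∀ i, |y i - c i| < r / 2}
lemma volume_real_ball_eq {N : ℕ} (x : EuclideanSpace ℝ (Fin N)) {r : ℝ} (hr : 0 < r) :
    volume.real (ball x r) = r ^ N * volume.real (ball (0 : EuclideanSpace ℝ (Fin N)) 1) := by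
  rw [measureReal_def, Measure.addHaar_ball_of_pos volume x hr, ENNReal.toReal_mul,
    ENNReal.toReal_ofReal (by positivity), finrank_euclideanSpace_fin, measureReal_def]

lemma volume_real_unit_ball_pos {N : ℕ} :
    0 < volume.real (ball (0 : EuclideanSpace ℝ (Fin N)) 1) :=
  ENNReal.toReal_pos (measure_ball_pos _ _ one_pos).ne' measure_ball_lt_top.ne

lemma add_smul_mem_ball {N : ℕ} {x y : EuclideanSpace ℝ (Fin N)} {ε : ℝ} (hε : 0 < ε)
    (hy : y ∈ ball (0 : EuclideanSpace ℝ (Fin N)) 1) : x + ε • y ∈ ball x ε := by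
  rw [mem_ball_zero_iff] at hy
  rw [mem_ball, dist_eq_norm, add_sub_cancel_left, norm_smul, Real.norm_of_nonneg hε.le]
  nlinarith

lemma sub_smul_mem_ball {N : ℕ} {x y : EuclideanSpace ℝ (Fin N)} {ε : ℝ} (hε : 0 < ε)
    (hy : y ∈ ball (0 : EuclideanSpace ℝ (Fin N)) 1) : x - ε • y ∈ ball x ε := by
  have := add_smul_mem_ball (x := x) (y := -y) hε (by simpa using hy)
  simpa [sub_eq_add_neg] using this

lemma integrableOn_unit_ball_comp {N : ℕ} {w : EuclideanSpace ℝ (Fin N) → ℝ} (hw : Measurable w)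
    {x : EuclideanSpace ℝ (Fin N)} {ε : ℝ} (hε : 0 < ε) {B : ℝ}
    (hB : ∀ y ∈ ball x ε, |w y| ≤ B) :
    IntegrableOn (fun y => w (x + ε • y)) (ball 0 1) :=
  Measure.integrableOn_of_bounded measure_ball_lt_top.ne
    (hw.comp (by fun_prop)).aestronglyMeasurable
    ((ae_restrict_mem measurableSet_ball).mono fun y hy => hB _ (add_smul_mem_ball hε hy))

lemma integrableOn_unit_ball_comp_neg {N : ℕ} {w : EuclideanSpace ℝ (Fin N) → ℝ}
    (hw : Measurable w) {x : EuclideanSpace ℝ (Fin N)} {ε : ℝ} (hε : 0 < ε) {B : ℝ}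
    (hB : ∀ y ∈ ball x ε, |w y| ≤ B) :
    IntegrableOn (fun y => w (x - ε • y)) (ball 0 1) :=
  Measure.integrableOn_of_bounded measure_ball_lt_top.ne
    (hw.comp (by fun_prop)).aestronglyMeasurable
    ((ae_restrict_mem measurableSet_ball).mono fun y hy => hB _ (sub_smul_mem_ball hε hy))

lemma integrableOn_unit_ball_ddiff {N : ℕ} {w : EuclideanSpace ℝ (Fin N) → ℝ} (hw : Measurable w)
    {x : EuclideanSpace ℝ (Fin N)} {ε : ℝ} (hε : 0 < ε) {B : ℝ}
    (hB : ∀ y ∈ ball x ε, |w y| ≤ B) :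
    IntegrableOn (fun y => ddiff w x (ε • y)) (ball 0 1) :=
  ((integrableOn_unit_ball_comp hw hε hB).add (integrableOn_unit_ball_comp_neg hw hε hB)).sub
    (integrableOn_const measure_ball_lt_top.ne)

/-- The symmetry of the ball turns the average of second differences into a plain average. -/
lemma setIntegral_ddiff {N : ℕ} {w : EuclideanSpace ℝ (Fin N) → ℝ} (hw : Measurable w)
    {x : EuclideanSpace ℝ (Fin N)} {ε : ℝ} (hε : 0 < ε) {B : ℝ}
    (hB : ∀ y ∈ ball x ε, |w y| ≤ B) :
    ∫ y in ball (0 : EuclideanSpace ℝ (Fin N)) 1, ddiff w x (ε • y) =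
      2 * (∫ y in ball (0 : EuclideanSpace ℝ (Fin N)) 1, w (x + ε • y)) -
        2 * w x * volume.real (ball (0 : EuclideanSpace ℝ (Fin N)) 1) := by
  have hneg : ∫ y in ball (0 : EuclideanSpace ℝ (Fin N)) 1, w (x - ε • y) =
      ∫ y in ball (0 : EuclideanSpace ℝ (Fin N)) 1, w (x + ε • y) := by
    have := (Measure.measurePreserving_neg
      (volume : Measure (EuclideanSpace ℝ (Fin N)))).setIntegral_preimage_emb
      (MeasurableEquiv.neg _).measurableEmbedding (fun y => w (x + ε • y)) (ball 0 1)
    rw [← this]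
    have hpre : (Neg.neg ⁻¹' ball (0 : EuclideanSpace ℝ (Fin N)) 1) = ball 0 1 := by
      ext y; simp
    rw [hpre]
    simp [sub_eq_add_neg]
  have h1 := integrableOn_unit_ball_comp hw hε hB
  have h2 := integrableOn_unit_ball_comp_neg hw hε hB
  have hsub := integral_sub (h1.add h2)
    (integrableOn_const (C := 2 * w x) (measure_ball_lt_top (μ := volume)).ne)
  simp only [Pi.add_apply] at hsub
  unfold ddiff
  rw [hsub, integral_add h1 h2, hneg, setIntegral_const, smul_eq_mul]
  ring

open scoped Pointwise in
/-- A Chebyshev inequality on `ball x ε` in terms of the averaged second difference. -/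
lemma mul_volume_lt_le_of_average_ddiff_le {N : ℕ} {w : EuclideanSpace ℝ (Fin N) → ℝ}
    (hw : Measurable w) {x : EuclideanSpace ℝ (Fin N)} {ε : ℝ} (hε : 0 < ε) {B : ℝ}
    (hB : ∀ y ∈ ball x ε, |w y| ≤ B) (h0 : ∀ y ∈ ball x ε, 0 ≤ w y) {K : ℝ}
    (hK : ⨍ y in ball (0 : EuclideanSpace ℝ (Fin N)) 1, ddiff w x (ε • y) ≤ K) {τ : ℝ}
    (hτ : 0 ≤ τ) :
    τ * volume.real ({y | τ < w y} ∩ ball x ε) ≤ (K / 2 + w x) * volume.real (ball x ε) := by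
  have hω := volume_real_unit_ball_pos (N := N)
  set ω := volume.real (ball (0 : EuclideanSpace ℝ (Fin N)) 1)
  rw [setAverage_eq, setIntegral_ddiff hw hε hB, smul_eq_mul, inv_mul_le_iff₀ hω] at hK
  have hint := integrableOn_unit_ball_comp hw hε hB
  have hcheb := mul_meas_ge_le_integral_of_nonneg
    ((ae_restrict_mem measurableSet_ball).mono fun y hy => h0 _ (add_smul_mem_ball hε hy))
    hint τ
  have hsub : {y | τ < w y} ∩ ball x ε ⊆
      (fun y => x + ε • y) '' ({y | τ ≤ w (x + ε • y)} ∩ ball 0 1) := by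
    rintro z ⟨hz, hzb⟩
    have hzz : x + ε • (ε⁻¹ • (z - x)) = z := by
      rw [smul_smul, mul_inv_cancel₀ hε.ne', one_smul, add_sub_cancel]
    refine ⟨ε⁻¹ • (z - x), ⟨?_, ?_⟩, hzz⟩
    · simp only [Set.mem_ofPred_eq, hzz]
      exact le_of_lt hz
    · rw [mem_ball, dist_eq_norm] at hzb
      rw [mem_ball_zero_iff, norm_smul, norm_inv, Real.norm_of_nonneg hε.le,
        inv_mul_lt_iff₀ hε, mul_one]
      exact hzb
  have himg : volume.real ((fun y => x + ε • y) '' ({y | τ ≤ w (x + ε • y)} ∩ ball 0 1)) =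
      ε ^ N * volume.real ({y | τ ≤ w (x + ε • y)} ∩ ball 0 1) := by
    have : (fun y => x + ε • y) '' ({y | τ ≤ w (x + ε • y)} ∩ ball 0 1) =
        (fun y => x + y) '' (ε • ({y | τ ≤ w (x + ε • y)} ∩ ball 0 1)) := by
      rw [← Set.image_smul, Set.image_image]
    rw [this, measureReal_def, Set.image_add_left, measure_preimage_add, Measure.addHaar_smul,
      ENNReal.toReal_mul, ENNReal.toReal_ofReal (abs_nonneg _), finrank_euclideanSpace_fin,
      abs_of_pos (by positivity), measureReal_def]
  have hle : volume.real ({y | τ < w y} ∩ ball x ε) ≤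
      ε ^ N * volume.real ({y | τ ≤ w (x + ε • y)} ∩ ball 0 1) := by
    rw [← himg]
    refine measureReal_mono hsub ?_
    have hbd : (fun y => x + ε • y) '' ({y | τ ≤ w (x + ε • y)} ∩ ball 0 1) ⊆ ball x ε := by
      rintro _ ⟨y, ⟨_, hy⟩, rfl⟩
      exact add_smul_mem_ball hε hy
    exact (lt_of_le_of_lt (measure_mono hbd) measure_ball_lt_top).ne
  have hmeas : MeasurableSet {y | τ ≤ w (x + ε • y)} :=
    measurableSet_le measurable_const (hw.comp (by fun_prop))
  rw [measureReal_restrict_apply hmeas] at hcheb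
  rw [volume_real_ball_eq x hε]
  have hεN : 0 < ε ^ N := by positivity
  calc τ * volume.real ({y | τ < w y} ∩ ball x ε)
      ≤ τ * (ε ^ N * volume.real ({y | τ ≤ w (x + ε • y)} ∩ ball 0 1)) := by gcongr
    _ = ε ^ N * (τ * volume.real ({y | τ ≤ w (x + ε • y)} ∩ ball 0 1)) := by ring
    _ ≤ ε ^ N * ((K / 2 + w x) * ω) := by
        refine mul_le_mul_of_nonneg_left (hcheb.trans ?_) hεN.le
        linarith
    _ = _ := by ring

lemma add_average_ddiff_le {N : ℕ} {Λ α β ε ρ b : ℝ} (hΛ : 0 < Λ) (hα : 0 ≤ α) (hε : 0 < ε)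
    {u : EuclideanSpace ℝ (Fin N) → ℝ} {x : EuclideanSpace ℝ (Fin N)}
    (hL : Lminus Λ α β ε u x ≤ ρ)
    (hb : ∀ z ∈ ball (0 : EuclideanSpace ℝ (Fin N)) Λ, b ≤ ddiff u x (ε • z)) :
    α * b + β * (⨍ y in ball (0 : EuclideanSpace ℝ (Fin N)) 1, ddiff u x (ε • y)) ≤
      2 * ε ^ 2 * ρ := by
  have h : b ≤ sInf ((fun z => ddiff u x (ε • z)) '' ball (0 : EuclideanSpace ℝ (Fin N)) Λ) := by
    refine le_csInf (Set.Nonempty.image _ ⟨0, mem_ball_self hΛ⟩) ?_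
    rintro _ ⟨z, hz, rfl⟩
    exact hb z hz
  unfold Lminus at hL
  rw [one_div, inv_mul_le_iff₀ (by positivity)] at hL
  linarith [mul_le_mul_of_nonneg_left h hα]

/-- At a point where `Lminus u ≤ ρ`, a nonnegative `u` obeys a weak-type bound at scale `ε`. -/
lemma mul_volume_lt_le_of_Lminus_le {N : ℕ} {Λ α β ε ρ : ℝ} (hΛ : 0 < Λ) (hβ : 0 < β)
    (hα : 0 ≤ α) (hαβ : α + β = 1) (hε : 0 < ε) (hρ : ε ^ 2 * ρ ≤ 1)
    {u : EuclideanSpace ℝ (Fin N) → ℝ} (hu : Measurable u) {B : ℝ} (hB : ∀ x, |u x| ≤ B)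
    (h0 : ∀ x, 0 ≤ u x) {x : EuclideanSpace ℝ (Fin N)} (hL : Lminus Λ α β ε u x ≤ ρ) {τ : ℝ}
    (hτ : 0 ≤ τ) :
    τ * volume.real ({y | τ < u y} ∩ ball x ε) ≤ (u x + 1) / β * volume.real (ball x ε) := by
  have h := add_average_ddiff_le (b := -2 * u x) hΛ hα hε hL fun z _ => by
    unfold ddiff
    linarith [h0 (x + ε • z), h0 (x - ε • z)]
  have hK : ⨍ y in ball (0 : EuclideanSpace ℝ (Fin N)) 1, ddiff u x (ε • y) ≤
      2 * ((u x + 1) / β - u x) := by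
    rw [← mul_le_mul_iff_right₀ hβ]
    have : β * (2 * ((u x + 1) / β - u x)) = 2 * (u x + 1) - 2 * β * u x := by
      field_simp
    rw [this]
    have : α = 1 - β := by linarith
    subst this
    linarith
  refine (mul_volume_lt_le_of_average_ddiff_le hu hε (fun y _ => hB y) (fun y _ => h0 y) hK
    hτ).trans (le_of_eq ?_)
  ring

lemma half_volume_le_volume_le {N : ℕ} {w : EuclideanSpace ℝ (Fin N) → ℝ} (hw : Measurable w)
    {x : EuclideanSpace ℝ (Fin N)} {r τ : ℝ}
    (h : volume.real ({y | τ < w y} ∩ ball x r) ≤ volume.real (ball x r) / 2) :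
    volume.real (ball x r) / 2 ≤ volume.real ({y | w y ≤ τ} ∩ ball x r) := by
  have hm : MeasurableSet {y | τ < w y} := measurableSet_lt measurable_const hw
  have hsplit := measureReal_inter_add_sdiff (μ := volume) (s := ball x r) hm
    (h := measure_ball_lt_top.ne)
  have heq : ball x r \ {y | τ < w y} = {y | w y ≤ τ} ∩ ball x r := by
    ext y
    simp [and_comm]
  rw [heq, Set.inter_comm] at hsplit
  linarith

lemma exists_le_of_Lminus_le {N : ℕ} {Λ α β ε ρ : ℝ} (hΛ : 0 < Λ) (hβ : 0 < β)
    (hα : 0 ≤ α) (hαβ : α + β = 1) (hε : 0 < ε) (hρ : ε ^ 2 * ρ ≤ 1)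
    {u : EuclideanSpace ℝ (Fin N) → ℝ} (hu : Measurable u) {B : ℝ} (hB : ∀ x, |u x| ≤ B)
    (h0 : ∀ x, 0 ≤ u x) {x z : EuclideanSpace ℝ (Fin N)} (hL : Lminus Λ α β ε u x ≤ ρ)
    (hxz : dist x z ≤ ε / 2) {s : ℝ} (hs : 1 ≤ s) (hux : u x ≤ s) :
    ∃ y ∈ ball z (ε / 4), u y ≤ 4 ^ N * 4 / β * s := by
  by_contra! hcon
  have hω := volume_real_unit_ball_pos (N := N)
  have hcheb := mul_volume_lt_le_of_Lminus_le hΛ hβ hα hαβ hε hρ hu hB h0 hL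
    (τ := 4 ^ N * 4 / β * s) (by positivity)
  have hsub : ball z (ε / 4) ⊆ {y | 4 ^ N * 4 / β * s < u y} ∩ ball x ε := by
    refine fun y hy => ⟨hcon y hy, ?_⟩
    rw [mem_ball] at hy ⊢
    linarith [dist_triangle y z x, dist_comm x z]
  have hmono : volume.real (ball z (ε / 4)) ≤
      volume.real ({y | 4 ^ N * 4 / β * s < u y} ∩ ball x ε) :=
    measureReal_mono hsub
      ((measure_mono Set.inter_subset_right).trans_lt measure_ball_lt_top).ne
  rw [volume_real_ball_eq z (by positivity)] at hmono
  rw [volume_real_ball_eq x hε] at hcheb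
  have h1 := (mul_le_mul_of_nonneg_left hmono
    (by positivity : 0 ≤ 4 ^ N * 4 / β * s)).trans hcheb
  have hl : 4 ^ N * 4 / β * s * ((ε / 4) ^ N * volume.real (ball (0 : EuclideanSpace ℝ (Fin N)) 1))
      = (4 * s / β) * (ε ^ N * volume.real (ball (0 : EuclideanSpace ℝ (Fin N)) 1)) := by
    rw [div_pow]; field_simp
  rw [hl, mul_le_mul_iff_left₀ (by positivity), div_le_div_iff_of_pos_right hβ] at h1
  linarith

/-- Iterating the weak-type bound along a segment propagates small values of `u`. -/
lemma exists_le_pow_of_Lminus_le {N : ℕ} {Λ α β ε ρ : ℝ} (hΛ : 0 < Λ) (hβ : 0 < β)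
    (hα : 0 ≤ α) (hαβ : α + β = 1) (hε : 0 < ε) (hρ : ε ^ 2 * ρ ≤ 1)
    {u : EuclideanSpace ℝ (Fin N) → ℝ} (hu : Measurable u) {B : ℝ} (hB : ∀ x, |u x| ≤ B)
    (h0 : ∀ x, 0 ≤ u x) {r R : ℝ} (hrR : r + ε / 4 ≤ R)
    (hL : ∀ x ∈ ball 0 R, Lminus Λ α β ε u x ≤ ρ) {x : EuclideanSpace ℝ (Fin N)} (hx : ‖x‖ ≤ r)
    (hux : u x ≤ 1) (k : ℕ) {z : EuclideanSpace ℝ (Fin N)} (hz : ‖z‖ ≤ r)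
    (hxz : dist x z ≤ k * (ε / 4)) :
    ∃ y ∈ ball z (ε / 4), u y ≤ (4 ^ N * 4 / β) ^ k := by
  have hC : 1 ≤ 4 ^ N * 4 / β := by
    rw [le_div_iff₀ hβ]
    have : (1 : ℝ) ≤ 4 ^ N := one_le_pow₀ (by norm_num)
    linarith
  induction k generalizing z with
  | zero =>
    have : dist x z ≤ 0 := by simpa using hxz
    exact ⟨x, by rw [mem_ball]; linarith, by simpa using hux⟩
  | succ k ih =>
    have hk : (0 : ℝ) < k + 1 := by positivity
    have hc : (0 : ℝ) ≤ k / (k + 1) := by positivity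
    have hc1 : (k : ℝ) / (k + 1) ≤ 1 := by rw [div_le_one hk]; linarith
    push_cast at hxz
    obtain ⟨y, hy, huy⟩ := ih (z := AffineMap.lineMap x z ((k : ℝ) / (k + 1)))
      (by
        have := (convex_closedBall (0 : EuclideanSpace ℝ (Fin N)) r).lineMap_mem
          (mem_closedBall_zero_iff.2 hx) (mem_closedBall_zero_iff.2 hz) ⟨hc, hc1⟩
        exact mem_closedBall_zero_iff.1 this)
      (by
        rw [dist_left_lineMap, Real.norm_of_nonneg hc, div_mul_eq_mul_div, div_le_iff₀ hk]
        nlinarith [mul_le_mul_of_nonneg_left hxz (Nat.cast_nonneg (α := ℝ) k)])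
    have hd : dist y z ≤ ε / 2 := by
      have h1 : dist (AffineMap.lineMap x z ((k : ℝ) / (k + 1))) z ≤ ε / 4 := by
        rw [dist_lineMap_right, Real.norm_of_nonneg (by linarith)]
        have : 1 - (k : ℝ) / (k + 1) = 1 / (k + 1) := by field_simp; ring
        rw [this, div_mul_eq_mul_div, div_le_iff₀ hk]
        linarith
      linarith [dist_triangle y (AffineMap.lineMap x z ((k : ℝ) / (k + 1))) z, mem_ball.1 hy]
    have hyR : y ∈ ball 0 R := by
      have := (convex_closedBall (0 : EuclideanSpace ℝ (Fin N)) r).lineMap_mem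
          (mem_closedBall_zero_iff.2 hx) (mem_closedBall_zero_iff.2 hz) ⟨hc, hc1⟩
      rw [mem_closedBall] at this
      rw [mem_ball] at hy ⊢
      linarith [dist_triangle y (AffineMap.lineMap x z ((k : ℝ) / (k + 1))) 0]
    obtain ⟨y', hy', huy'⟩ := exists_le_of_Lminus_le hΛ hβ hα hαβ hε hρ hu hB h0 (hL y hyR) hd
      (one_le_pow₀ hC) huy
    exact ⟨y', hy', huy'.trans_eq (by ring)⟩

/-- The measure estimate when `ε` is comparable to the size of the domain. -/
lemma measure_estimate_of_le {N : ℕ} (hN : 1 ≤ N) {Λ α β : ℝ} (hΛ : 0 < Λ) (hβ : 0 < β)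
    (hα : 0 ≤ α) (hαβ : α + β = 1) {ε₁ : ℝ} (hε₁ : 0 < ε₁) (hε₁' : ε₁ ≤ 1) :
    ∃ M μ : ℝ, 0 < M ∧ 0 < μ ∧ ∀ ε ρ : ℝ, ε₁ ≤ ε → ε ≤ 4 * √N → ε ^ 2 * ρ ≤ 1 →
      ∀ u : EuclideanSpace ℝ (Fin N) → ℝ, Measurable u → (∃ B, ∀ x, |u x| ≤ B) →
        (∀ x, 0 ≤ u x) → (∀ x ∈ ball 0 (4 * √N), Lminus Λ α β ε u x ≤ ρ) →
        ∀ x, ‖x‖ ≤ 3 / 2 * √N → u x ≤ 1 →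
          μ ≤ volume.real ({y | u y ≤ M} ∩ ball 0 (1 / 2)) := by
  have hω := volume_real_unit_ball_pos (N := N)
  set ω := volume.real (ball (0 : EuclideanSpace ℝ (Fin N)) 1)
  have hN' : (1 : ℝ) ≤ √N := by
    rw [Real.one_le_sqrt]; exact_mod_cast hN
  obtain ⟨k, hk⟩ := exists_nat_ge (6 * √N / ε₁)
  set C : ℝ := 4 ^ N * 4 / β
  have hC : 0 < C := by positivity
  set M : ℝ := 2 * ((C ^ k + 1) / β) * (32 * √N / ε₁) ^ N
  have hM : 0 < M := by positivity
  refine ⟨M, (ε₁ / 8) ^ N * ω / 2, hM, by positivity, ?_⟩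
  rintro ε ρ hε hεN hρ u hu ⟨B, hB⟩ h0 hL x hx hux
  have hε0 : 0 < ε := hε₁.trans_le hε
  obtain ⟨y, hy, huy⟩ := exists_le_pow_of_Lminus_le hΛ hβ hα hαβ hε0 hρ hu hB h0
    (r := 3 / 2 * √N) (R := 4 * √N) (by linarith) hL hx hux k (z := 0)
    (by rw [norm_zero]; positivity)
    (by
      rw [dist_zero_right]
      rw [div_le_iff₀ hε₁] at hk
      nlinarith [mul_le_mul_of_nonneg_left hε (Nat.cast_nonneg (α := ℝ) k)])
  rw [mem_ball, dist_zero_right] at hy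
  have hcheb := mul_volume_lt_le_of_Lminus_le hΛ hβ hα hαβ hε0 hρ hu hB h0
    (hL y (by rw [mem_ball, dist_zero_right]; linarith)) hM.le
  rw [volume_real_ball_eq y hε0] at hcheb
  have hsub : {z | M < u z} ∩ ball 0 (ε₁ / 8) ⊆ {z | M < u z} ∩ ball y ε := by
    refine Set.inter_subset_inter_right _ fun z hz => ?_
    rw [mem_ball, dist_zero_right] at hz
    rw [mem_ball, dist_eq_norm]
    linarith [norm_sub_le z y]
  have hmono : volume.real ({z | M < u z} ∩ ball 0 (ε₁ / 8)) ≤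
      volume.real ({z | M < u z} ∩ ball y ε) :=
    measureReal_mono hsub
      ((measure_mono Set.inter_subset_right).trans_lt measure_ball_lt_top).ne
  have hball := volume_real_ball_eq (0 : EuclideanSpace ℝ (Fin N)) (r := ε₁ / 8) (by positivity)
  have hhalf := half_volume_le_volume_le hu (x := 0) (r := ε₁ / 8) (τ := M) <| by
    rw [hball]
    refine hmono.trans ?_
    have hb : (u y + 1) / β * (ε ^ N * ω) ≤ (C ^ k + 1) / β * ((4 * √N) ^ N * ω) := by
      gcongr
    have he : (C ^ k + 1) / β * ((4 * √N) ^ N * ω) = M * ((ε₁ / 8) ^ N * ω / 2) := by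
      have : (4 * √N) ^ N = (32 * √N / ε₁) ^ N * (ε₁ / 8) ^ N := by
        rw [← mul_pow]; congr 1; field_simp; norm_num
      simp only [M]
      rw [this]; ring
    exact le_of_mul_le_mul_left (hcheb.trans (hb.trans_eq he)) hM
  rw [hball] at hhalf
  refine hhalf.trans (measureReal_mono (Set.inter_subset_inter_right _
    (ball_subset_ball (by linarith)))
    ((measure_mono Set.inter_subset_right).trans_lt measure_ball_lt_top).ne)

/-- The barrier `A (exp (-γ ‖x‖²) - exp (-γ R²))`. -/
noncomputable def gaussianBarrier {N : ℕ} (γ A R : ℝ) (x : EuclideanSpace ℝ (Fin N)) : ℝ :=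
  A * (Real.exp (-(γ * ‖x‖ ^ 2)) - Real.exp (-(γ * R ^ 2)))

lemma measurable_gaussianBarrier {N : ℕ} (γ A R : ℝ) :
    Measurable (gaussianBarrier γ A R : EuclideanSpace ℝ (Fin N) → ℝ) := by
  unfold gaussianBarrier
  fun_prop

lemma abs_gaussianBarrier_le {N : ℕ} {γ A R : ℝ} (hγ : 0 ≤ γ) (hA : 0 ≤ A)
    (x : EuclideanSpace ℝ (Fin N)) : |gaussianBarrier γ A R x| ≤ A := by
  have h1 : Real.exp (-(γ * ‖x‖ ^ 2)) ≤ 1 := Real.exp_le_one_iff.2 (by nlinarith [sq_nonneg ‖x‖])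
  have h2 : Real.exp (-(γ * R ^ 2)) ≤ 1 := Real.exp_le_one_iff.2 (by nlinarith [sq_nonneg R])
  have h3 := Real.exp_pos (-(γ * ‖x‖ ^ 2))
  have h4 := Real.exp_pos (-(γ * R ^ 2))
  unfold gaussianBarrier
  rw [abs_mul, abs_of_nonneg hA]
  have : |Real.exp (-(γ * ‖x‖ ^ 2)) - Real.exp (-(γ * R ^ 2))| ≤ 1 := by
    rw [abs_le]; constructor <;> linarith
  nlinarith

lemma le_ddiff_gaussianBarrier {N : ℕ} {γ A R : ℝ} (hA : 0 ≤ A)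
    (x h : EuclideanSpace ℝ (Fin N)) (hh : γ * ‖h‖ ^ 2 ≤ 1 / 2) :
    2 * A * Real.exp (-(γ * ‖x‖ ^ 2)) * (-(γ * ‖h‖ ^ 2) + γ ^ 2 * inner ℝ x h ^ 2) ≤
      ddiff (gaussianBarrier γ A R) x h := by
  set g := Real.exp (-(γ * ‖x‖ ^ 2))
  set t := inner ℝ x h
  have hg : 0 < g := Real.exp_pos _
  have hadd : Real.exp (-(γ * ‖x + h‖ ^ 2)) =
      g * Real.exp (-(γ * ‖h‖ ^ 2)) * Real.exp (-(2 * γ * t)) := by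
    rw [← Real.exp_add, ← Real.exp_add, norm_add_sq_real]; congr 1; ring
  have hsub : Real.exp (-(γ * ‖x - h‖ ^ 2)) =
      g * Real.exp (-(γ * ‖h‖ ^ 2)) * Real.exp (2 * γ * t) := by
    rw [← Real.exp_add, ← Real.exp_add, norm_sub_sq_real]; congr 1; ring
  have hcosh : 2 + (2 * γ * t) ^ 2 ≤ Real.exp (-(2 * γ * t)) + Real.exp (2 * γ * t) := by
    have := Real.cosh_eq (2 * γ * t)
    have h2 := Real.cosh_sq (γ * t)
    have h3 := Real.cosh_two_mul (γ * t)
    have h4 : (γ * t) ^ 2 ≤ Real.sinh (γ * t) ^ 2 := by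
      rw [← sq_abs (γ * t), ← sq_abs (Real.sinh _), Real.abs_sinh]
      have := (Real.self_le_sinh_iff (x := |γ * t|)).2 (abs_nonneg _)
      gcongr
    rw [← mul_assoc] at h3
    nlinarith
  have he : 1 - γ * ‖h‖ ^ 2 ≤ Real.exp (-(γ * ‖h‖ ^ 2)) := by
    linarith [Real.add_one_le_exp (-(γ * ‖h‖ ^ 2))]
  have hprod : (1 - γ * ‖h‖ ^ 2) * (2 + (2 * γ * t) ^ 2) ≤
      Real.exp (-(γ * ‖h‖ ^ 2)) * (Real.exp (-(2 * γ * t)) + Real.exp (2 * γ * t)) := by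
    gcongr
  have hlow : 2 * (-(γ * ‖h‖ ^ 2) + γ ^ 2 * t ^ 2) ≤
      Real.exp (-(γ * ‖h‖ ^ 2)) * (Real.exp (-(2 * γ * t)) + Real.exp (2 * γ * t)) - 2 := by
    nlinarith [mul_nonneg (sub_nonneg.2 hh) (sq_nonneg (γ * t))]
  have hdd : ddiff (gaussianBarrier γ A R) x h = A * g *
      (Real.exp (-(γ * ‖h‖ ^ 2)) * (Real.exp (-(2 * γ * t)) + Real.exp (2 * γ * t)) - 2) := by
    unfold ddiff gaussianBarrier
    rw [hadd, hsub]; ring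
  rw [hdd]
  calc _ = A * g * (2 * (-(γ * ‖h‖ ^ 2) + γ ^ 2 * t ^ 2)) := by ring
    _ ≤ _ := by gcongr

lemma le_average_ddiff_gaussianBarrier {N : ℕ} {γ A R ε : ℝ} (hγ : 0 ≤ γ) (hA : 0 ≤ A)
    (hε : 0 < ε) (hγε : γ * ε ^ 2 ≤ 1 / 2) (x : EuclideanSpace ℝ (Fin N)) :
    2 * A * Real.exp (-(γ * ‖x‖ ^ 2)) * ε ^ 2 * (-γ + γ ^ 2 * ‖x‖ ^ 2 / (16 * 4 ^ N)) ≤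
      ⨍ y in ball (0 : EuclideanSpace ℝ (Fin N)) 1, ddiff (gaussianBarrier γ A R) x (ε • y) := by
  have hω := volume_real_unit_ball_pos (N := N)
  set ω := volume.real (ball (0 : EuclideanSpace ℝ (Fin N)) 1)
  set g := Real.exp (-(γ * ‖x‖ ^ 2))
  have hg : 0 < g := Real.exp_pos _
  have hpt : ∀ y ∈ ball (0 : EuclideanSpace ℝ (Fin N)) 1,
      2 * A * g * ε ^ 2 * (-γ + γ ^ 2 * inner ℝ x y ^ 2) ≤
        ddiff (gaussianBarrier γ A R) x (ε • y) := by
    intro y hy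
    rw [mem_ball_zero_iff] at hy
    have hy2 : ‖y‖ ^ 2 ≤ 1 := by nlinarith [norm_nonneg y]
    have hnorm : ‖ε • y‖ ^ 2 = ε ^ 2 * ‖y‖ ^ 2 := by
      rw [norm_smul, mul_pow, Real.norm_eq_abs, sq_abs]
    have h1 : γ * (ε ^ 2 * ‖y‖ ^ 2) ≤ γ * ε ^ 2 := by
      nlinarith [mul_nonneg hγ (sq_nonneg ε)]
    refine le_trans ?_ (le_ddiff_gaussianBarrier hA x (ε • y) (by rw [hnorm]; linarith))
    rw [hnorm, inner_smul_right, mul_assoc (2 * A * g)]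
    refine mul_le_mul_of_nonneg_left ?_ (by positivity)
    nlinarith
  set b := 2 * A * g * ε ^ 2 * -γ
  set τ := 2 * A * g * ε ^ 2 * (γ ^ 2 * (‖x‖ ^ 2 / 16))
  set f := fun y => ddiff (gaussianBarrier γ A R) x (ε • y)
  have hint : IntegrableOn f (ball 0 1) := integrableOn_unit_ball_ddiff
    (measurable_gaussianBarrier γ A R) hε (B := A) fun y _ => abs_gaussianBarrier_le hγ hA y
  have hint' : IntegrableOn (fun y => f y - b) (ball 0 1) :=
    hint.sub (integrableOn_const measure_ball_lt_top.ne)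
  have hfm : Measurable f := by
    have := measurable_gaussianBarrier (N := N) γ A R
    unfold f ddiff
    fun_prop
  have hcheb := mul_meas_ge_le_integral_of_nonneg
    ((ae_restrict_mem measurableSet_ball).mono fun y hy => by
      have := hpt y hy
      have h2 : 0 ≤ 2 * A * g * ε ^ 2 * (γ ^ 2 * inner ℝ x y ^ 2) := by positivity
      simp only [Pi.zero_apply, f, b]
      linarith) hint' τ
  rw [measureReal_restrict_apply (measurableSet_le measurable_const (by fun_prop)),
    integral_sub hint (integrableOn_const measure_ball_lt_top.ne), setIntegral_const,
    smul_eq_mul] at hcheb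
  have hset : ω / 4 ^ N ≤ volume.real ({y | τ ≤ f y - b} ∩ ball 0 1) := by
    have hb : volume.real (ball ((1 / (2 * ‖x‖)) • x) (1 / 4)) = ω / 4 ^ N := by
      rw [volume_real_ball_eq _ (by norm_num), div_pow, one_pow]; ring
    rw [← hb]
    refine measureReal_mono ?_
      ((measure_mono Set.inter_subset_right).trans_lt measure_ball_lt_top).ne
    intro y hy
    rw [mem_ball, dist_eq_norm] at hy
    have he : ‖(1 / (2 * ‖x‖)) • x‖ ≤ 1 / 2 := by
      rw [norm_smul, Real.norm_of_nonneg (by positivity)]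
      rcases eq_or_ne ‖x‖ 0 with h | h
      · rw [h]; norm_num
      · rw [div_mul_eq_mul_div, one_mul, div_le_div_iff₀ (by positivity) two_pos]; linarith
    have hy1 : y ∈ ball (0 : EuclideanSpace ℝ (Fin N)) 1 := by
      rw [mem_ball_zero_iff]
      have : y = (y - (1 / (2 * ‖x‖)) • x) + (1 / (2 * ‖x‖)) • x := by abel
      rw [this]
      linarith [norm_add_le (y - (1 / (2 * ‖x‖)) • x) ((1 / (2 * ‖x‖)) • x)]
    refine ⟨?_, hy1⟩
    have hin : ‖x‖ / 4 ≤ inner ℝ x y := by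
      have : y = (1 / (2 * ‖x‖)) • x + (y - (1 / (2 * ‖x‖)) • x) := by abel
      rw [this, inner_add_right, inner_smul_right, real_inner_self_eq_norm_sq]
      have h1 := (abs_le.1 (abs_real_inner_le_norm x (y - (1 / (2 * ‖x‖)) • x))).1
      have h2 : 1 / (2 * ‖x‖) * ‖x‖ ^ 2 = ‖x‖ / 2 := by
        rcases eq_or_ne ‖x‖ 0 with h | h
        · rw [h]; norm_num
        · field_simp
      rw [h2]
      nlinarith [norm_nonneg x]
    have hsq : ‖x‖ ^ 2 / 16 ≤ inner ℝ x y ^ 2 := by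
      have : (‖x‖ / 4) ^ 2 ≤ inner ℝ x y ^ 2 := by gcongr
      linarith [this, (by ring : (‖x‖ / 4) ^ 2 = ‖x‖ ^ 2 / 16)]
    have hmul : τ ≤ 2 * A * g * ε ^ 2 * (γ ^ 2 * inner ℝ x y ^ 2) := by
      unfold τ
      gcongr
    have := hpt y hy1
    simp only [Set.mem_ofPred_eq, f, b]
    linarith
  have hτ : 0 ≤ τ := by positivity
  have hfin : τ * (ω / 4 ^ N) + ω * b ≤ ∫ y in ball (0 : EuclideanSpace ℝ (Fin N)) 1, f y := by
    linarith [mul_le_mul_of_nonneg_left hset hτ]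
  rw [setAverage_eq, smul_eq_mul, le_inv_mul_iff₀ hω]
  refine le_trans (le_of_eq ?_) hfin
  unfold τ b
  field_simp
  ring

lemma exists_affine_contact {N : ℕ} {v : EuclideanSpace ℝ (Fin N) → ℝ} {B : ℝ}
    (hB : ∀ x, |v x| ≤ B) {R : ℝ} (hR : 0 < R) (hv : ∀ x, R ≤ ‖x‖ → 0 ≤ v x)
    {x₀ : EuclideanSpace ℝ (Fin N)} (hx₀ : ‖x₀‖ ≤ R) (hvx₀ : v x₀ ≤ -1) {η : ℝ} (hη : 0 < η)
    (hη' : η ≤ 1 / 4) {p : EuclideanSpace ℝ (Fin N)} (hp : ‖p‖ ≤ 1 / (6 * R)) :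
    ∃ x m, ‖x‖ < R ∧ m ≤ 0 ∧ (∀ y ∈ ball 0 (2 * R), inner ℝ p y + m ≤ v y) ∧
      v x ≤ inner ℝ p x + m + η := by
  have hinner : ∀ y ∈ ball (0 : EuclideanSpace ℝ (Fin N)) (2 * R), |inner ℝ p y| ≤ 1 / 3 := by
    intro y hy
    rw [mem_ball_zero_iff] at hy
    refine (abs_real_inner_le_norm p y).trans ?_
    calc ‖p‖ * ‖y‖ ≤ 1 / (6 * R) * (2 * R) := by gcongr
      _ = 1 / 3 := by field_simp; norm_num
  have hin₀ : |inner ℝ p x₀| ≤ 1 / 6 := by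
    refine (abs_real_inner_le_norm p x₀).trans ?_
    calc ‖p‖ * ‖x₀‖ ≤ 1 / (6 * R) * R := by gcongr
      _ = 1 / 6 := by field_simp
  set T := (fun y => v y - inner ℝ p y) '' ball (0 : EuclideanSpace ℝ (Fin N)) (2 * R)
  have hbdd : BddBelow T := by
    refine ⟨-B - 1 / 3, ?_⟩
    rintro _ ⟨y, hy, rfl⟩
    dsimp only
    linarith [(abs_le.1 (hinner y hy)).2, (abs_le.1 (hB y)).1]
  have hx₀mem : v x₀ - inner ℝ p x₀ ∈ T :=
    ⟨x₀, by rw [mem_ball_zero_iff]; linarith, rfl⟩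
  have hm₀ : sInf T ≤ -1 + 1 / 6 :=
    (csInf_le hbdd hx₀mem).trans (by linarith [(abs_le.1 hin₀).1])
  obtain ⟨_, ⟨x, hx, rfl⟩, hlt⟩ := exists_lt_of_csInf_lt ⟨_, hx₀mem⟩ (lt_add_of_pos_right (sInf T) hη)
  dsimp only at hlt
  refine ⟨x, sInf T, ?_, by linarith, fun y hy => ?_, by linarith⟩
  · by_contra! hcon
    linarith [hv x hcon, (abs_le.1 (hinner x hx)).2]
  · have := csInf_le hbdd ⟨y, hy, rfl⟩
    dsimp only at this
    linarith

lemma ddiff_sub_sub_inner_sub {N : ℕ} (u φ : EuclideanSpace ℝ (Fin N) → ℝ)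
    (p : EuclideanSpace ℝ (Fin N)) (m : ℝ) (x h : EuclideanSpace ℝ (Fin N)) :
    ddiff (fun y => u y - φ y - (inner ℝ p y + m)) x h = ddiff u x h - ddiff φ x h := by
  unfold ddiff
  simp only [inner_add_right, inner_sub_right]
  ring

lemma contact_arith {N : ℕ} {Λ α β ε ρ γ A g e X Iu Iφ Iw : ℝ} (hΛ : 1 ≤ Λ) (hβ : 0 < β)
    (hα : 0 ≤ α) (hαβ : α + β = 1) (hε : 0 < ε) (hρ : 0 < ρ) (hγ : 0 < γ) (hA : 0 < A)
    (hγβ : γ * Λ ^ 2 + 1 ≤ β / (1024 * 4 ^ N) * γ ^ 2) (hρA : ρ ≤ A * e / 4) (hg : 0 < g)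
    (hg1 : g ≤ 1) (hgR : e ≤ g)
    (hsum : α * (-2 * (ρ * ε ^ 2) - 2 * A * g * (γ * (ε * Λ) ^ 2)) + β * Iu ≤ 2 * ε ^ 2 * ρ)
    (hφ : 2 * A * g * ε ^ 2 * (-γ + γ ^ 2 * X ^ 2 / (16 * 4 ^ N)) ≤ Iφ)
    (hlow : -2 * (ρ * ε ^ 2) ≤ Iw) (havg : Iw = Iu - Iφ) :
    X < 1 / 8 ∧ Iw ≤ (4 * ρ + 2 * A * γ * Λ ^ 2) / β * ε ^ 2 := by
  have hβ1 : β ≤ 1 := by linarith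
  have hα' : α = 1 - β := by linarith
  have hΛ2 : 1 ≤ Λ ^ 2 := one_le_pow₀ hΛ
  set q := β * (γ ^ 2 * X ^ 2 / (16 * 4 ^ N)) with hq
  have hq0 : 0 ≤ q := by positivity
  clear_value q
  have hmain : β * Iw ≤ ε ^ 2 * (2 * ρ * (1 + α) + 2 * A * g * (γ * Λ ^ 2 - q)) := by
    have h1 : β * Iw = β * Iu - β * Iφ := by rw [havg]; ring
    have h2 := mul_le_mul_of_nonneg_left hφ hβ.le
    have h3 : β * (2 * A * g * ε ^ 2 * (-γ + γ ^ 2 * X ^ 2 / (16 * 4 ^ N))) =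
        2 * A * g * ε ^ 2 * (-(β * γ) + q) := by rw [hq]; ring
    have h4 : 2 * A * g * ε ^ 2 * (β * γ) ≤ 2 * A * g * ε ^ 2 * (β * (γ * Λ ^ 2)) := by
      gcongr
      nlinarith
    rw [h3] at h2
    subst hα'
    linarith
  have hε2 : 0 < ε ^ 2 := by positivity
  constructor
  · by_contra! hcon
    have hqlow : γ * Λ ^ 2 + 1 ≤ q := by
      refine hγβ.trans ?_
      have : (1 / 8 : ℝ) ^ 2 ≤ X ^ 2 := by gcongr
      have h5 : β / (1024 * 4 ^ N) * γ ^ 2 = β * (γ ^ 2 * (1 / 8) ^ 2 / (16 * 4 ^ N)) := by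
        field_simp; norm_num
      rw [h5, hq]
      gcongr
    have h6 : 2 * A * g * (γ * Λ ^ 2 - q) ≤ -(2 * A * g) := by
      have : 0 < 2 * A * g := by positivity
      nlinarith
    have h7 : β * (-2 * (ρ * ε ^ 2)) ≤ ε ^ 2 * (2 * ρ * (1 + α) - 2 * A * g) := by
      refine (mul_le_mul_of_nonneg_left hlow hβ.le).trans (hmain.trans ?_)
      gcongr
      linarith
    have h8 : ε ^ 2 * (-2 * ρ * β) ≤ ε ^ 2 * (2 * ρ * (1 + α) - 2 * A * g) := by linarith
    have h9 := le_of_mul_le_mul_left h8 hε2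
    have h10 : A * e ≤ A * g := by gcongr
    subst hα'
    linarith
  · rw [div_mul_eq_mul_div, le_div_iff₀ hβ, mul_comm Iw]
    refine hmain.trans ?_
    rw [mul_comm (ε ^ 2)]
    refine mul_le_mul_of_nonneg_right ?_ hε2.le
    have h11 : 2 * A * g * (γ * Λ ^ 2 - q) ≤ 2 * A * γ * Λ ^ 2 := by
      have h12 : A * g * (γ * Λ ^ 2) ≤ A * 1 * (γ * Λ ^ 2) := by gcongr
      have h13 : 0 ≤ A * g * q := by positivity
      linarith
    have h14 : 2 * ρ * (1 + α) ≤ 4 * ρ := by nlinarith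
    linarith

/-- At an approximate contact point of `u - gaussianBarrier` with an affine function from below,
the point lies in a small ball and the averaged second difference is controlled. -/
lemma norm_lt_and_average_ddiff_le_of_contact {N : ℕ} {Λ α β ε ρ γ A R : ℝ} (hΛ : 1 ≤ Λ)
    (hβ : 0 < β) (hα : 0 ≤ α) (hαβ : α + β = 1) (hε : 0 < ε) (hρ : 0 < ρ) (hγ : 0 < γ)
    (hA : 0 < A) (hεR : ε * Λ ≤ R) (hγε : γ * (ε * Λ) ^ 2 ≤ 1 / 2)
    (hγβ : γ * Λ ^ 2 + 1 ≤ β / (1024 * 4 ^ N) * γ ^ 2)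
    (hρA : ρ ≤ A * Real.exp (-(γ * R ^ 2)) / 4)
    {u : EuclideanSpace ℝ (Fin N) → ℝ} (hu : Measurable u) {B : ℝ} (hB : ∀ x, |u x| ≤ B)
    {x p : EuclideanSpace ℝ (Fin N)} {m : ℝ} (hx : ‖x‖ < R) (hL : Lminus Λ α β ε u x ≤ ρ)
    (hw0 : ∀ y ∈ ball 0 (2 * R), 0 ≤ u y - gaussianBarrier γ A R y - (inner ℝ p y + m))
    (hwx : u x - gaussianBarrier γ A R x - (inner ℝ p x + m) ≤ ρ * ε ^ 2) :
    ‖x‖ < 1 / 8 ∧ ⨍ y in ball (0 : EuclideanSpace ℝ (Fin N)) 1,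
      ddiff (fun y => u y - gaussianBarrier γ A R y - (inner ℝ p y + m)) x (ε • y) ≤
        (4 * ρ + 2 * A * γ * Λ ^ 2) / β * ε ^ 2 := by
  have hω := volume_real_unit_ball_pos (N := N)
  set ω := volume.real (ball (0 : EuclideanSpace ℝ (Fin N)) 1)
  set w : EuclideanSpace ℝ (Fin N) → ℝ :=
    fun y => u y - gaussianBarrier γ A R y - (inner ℝ p y + m) with hw
  set g := Real.exp (-(γ * ‖x‖ ^ 2))
  have hg : 0 < g := Real.exp_pos _
  have hg1 : g ≤ 1 := Real.exp_le_one_iff.2 (by nlinarith [sq_nonneg ‖x‖])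
  have hgR : Real.exp (-(γ * R ^ 2)) ≤ g := by
    refine Real.exp_le_exp.2 (neg_le_neg ?_)
    gcongr
  have hdw : ∀ z ∈ ball (0 : EuclideanSpace ℝ (Fin N)) Λ, -2 * (ρ * ε ^ 2) ≤
      ddiff w x (ε • z) := by
    intro z hz
    rw [mem_ball_zero_iff] at hz
    have hnz : ‖ε • z‖ < R := by
      rw [norm_smul, Real.norm_of_nonneg hε.le]
      nlinarith
    have h1 := hw0 (x + ε • z) (by
      rw [mem_ball_zero_iff]; linarith [norm_add_le x (ε • z)])
    have h2 := hw0 (x - ε • z) (by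
      rw [mem_ball_zero_iff]; linarith [norm_sub_le x (ε • z)])
    unfold ddiff
    simp only [hw]
    linarith
  have hdu : ∀ z ∈ ball (0 : EuclideanSpace ℝ (Fin N)) Λ,
      -2 * (ρ * ε ^ 2) - 2 * A * g * (γ * (ε * Λ) ^ 2) ≤ ddiff u x (ε • z) := by
    intro z hz
    have h1 := hdw z hz
    rw [mem_ball_zero_iff] at hz
    rw [hw, ddiff_sub_sub_inner_sub] at h1
    have hnz : ‖ε • z‖ ^ 2 ≤ (ε * Λ) ^ 2 := by
      rw [norm_smul, Real.norm_of_nonneg hε.le]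
      gcongr
    have hnz' : γ * ‖ε • z‖ ^ 2 ≤ γ * (ε * Λ) ^ 2 := by gcongr
    have h2 := le_ddiff_gaussianBarrier (R := R) hA.le x (ε • z) (hnz'.trans hγε)
    have h3 : 2 * A * g * (-(γ * (ε * Λ) ^ 2)) ≤
        2 * A * g * (-(γ * ‖ε • z‖ ^ 2) + γ ^ 2 * inner ℝ x (ε • z) ^ 2) := by
      have : 0 ≤ γ ^ 2 * inner ℝ x (ε • z) ^ 2 := by positivity
      refine mul_le_mul_of_nonneg_left (by linarith) (by positivity)
    linarith
  have hsum := add_average_ddiff_le (by linarith) hα hε hL hdu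
  have hγε' : γ * ε ^ 2 ≤ 1 / 2 := by
    refine le_trans ?_ hγε
    gcongr
    nlinarith
  have hφ : 2 * A * g * ε ^ 2 * (-γ + γ ^ 2 * ‖x‖ ^ 2 / (16 * 4 ^ N)) ≤ _ :=
    le_average_ddiff_gaussianBarrier (R := R) hγ.le hA.le hε hγε' x
  have hintu : IntegrableOn (fun y => ddiff u x (ε • y)) (ball 0 1) :=
    integrableOn_unit_ball_ddiff hu hε fun y _ => hB y
  have hintφ : IntegrableOn (fun y => ddiff (gaussianBarrier γ A R) x (ε • y)) (ball 0 1) :=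
    integrableOn_unit_ball_ddiff (measurable_gaussianBarrier γ A R) hε
      fun y _ => abs_gaussianBarrier_le hγ.le hA.le y
  have hintw : IntegrableOn (fun y => ddiff w x (ε • y)) (ball 0 1) := by
    simp only [hw, ddiff_sub_sub_inner_sub]
    exact hintu.sub hintφ
  have havg : ⨍ y in ball (0 : EuclideanSpace ℝ (Fin N)) 1, ddiff w x (ε • y) =
      (⨍ y in ball (0 : EuclideanSpace ℝ (Fin N)) 1, ddiff u x (ε • y)) -
        ⨍ y in ball (0 : EuclideanSpace ℝ (Fin N)) 1, ddiff (gaussianBarrier γ A R) x (ε • y) := by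
    simp only [hw, ddiff_sub_sub_inner_sub, setAverage_eq, smul_eq_mul]
    rw [integral_sub hintu hintφ, mul_sub]
  have hlow : -2 * (ρ * ε ^ 2) ≤
      ⨍ y in ball (0 : EuclideanSpace ℝ (Fin N)) 1, ddiff w x (ε • y) := by
    rw [setAverage_eq, smul_eq_mul, le_inv_mul_iff₀ hω, ← smul_eq_mul]
    exact setIntegral_ge_of_const_le measurableSet_ball measure_ball_lt_top.ne
      (fun y hy => hdw y (ball_subset_ball hΛ hy)) hintw
  set Iu := ⨍ y in ball (0 : EuclideanSpace ℝ (Fin N)) 1, ddiff u x (ε • y)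
  set Iφ := ⨍ y in ball (0 : EuclideanSpace ℝ (Fin N)) 1,
    ddiff (gaussianBarrier γ A R) x (ε • y)
  set Iw := ⨍ y in ball (0 : EuclideanSpace ℝ (Fin N)) 1, ddiff w x (ε • y)
  exact contact_arith hΛ hβ hα hαβ hε hρ hγ hA hγβ hρA hg hg1 hgR hsum hφ hlow havg

/-- A Vitali covering argument: if nearby points `x p`, `x q` only come from nearby `p`, `q`, and
`G` has a definite portion around every `x p`, then `G` has large measure. -/
lemma mul_volume_le_of_vitali {N : ℕ} {t G U : Set (EuclideanSpace ℝ (Fin N))}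
    {x : EuclideanSpace ℝ (Fin N) → EuclideanSpace ℝ (Fin N)} {δ D θ : ℝ} (hδ : 0 < δ)
    (hD : 0 < D) (hθ : 0 ≤ θ)
    (hlip : ∀ p ∈ t, ∀ q ∈ t, dist (x p) (x q) ≤ 5 * δ → dist p q ≤ D)
    (hGm : MeasurableSet G) (hG : ∀ p ∈ t, θ ≤ volume.real (G ∩ ball (x p) δ))
    (hU : ∀ p ∈ t, ball (x p) δ ⊆ U) (hUfin : volume U ≠ ⊤) :
    θ * volume.real t ≤
      D ^ N * volume.real (ball (0 : EuclideanSpace ℝ (Fin N)) 1) * volume.real (G ∩ U) := by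
  have hω := volume_real_unit_ball_pos (N := N)
  set ω := volume.real (ball (0 : EuclideanSpace ℝ (Fin N)) 1)
  obtain ⟨S, hSt, hdisj, hcov⟩ := Vitali.exists_disjoint_subfamily_covering_enlargement_closedBall
    t x (fun _ => δ) δ (fun _ _ => le_rfl) 5 (by norm_num)
  have hcount : S.Countable := hdisj.countable_of_nonempty_interior fun p _ =>
    ⟨x p, ball_subset_interior_closedBall (mem_ball_self hδ)⟩
  have htsub : t ⊆ ⋃ b ∈ S, closedBall b D := by
    intro p hp
    obtain ⟨b, hb, hsub⟩ := hcov p hp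
    have hd : dist (x p) (x b) ≤ 5 * δ :=
      mem_closedBall.1 (hsub (mem_closedBall_self hδ.le))
    exact Set.mem_biUnion hb (mem_closedBall.2 (hlip p hp b (hSt hb) hd))
  have hvol : ∀ b : EuclideanSpace ℝ (Fin N), volume (closedBall b D) =
      ENNReal.ofReal (D ^ N * ω) := by
    intro b
    have := Measure.addHaar_real_closedBall volume b hD.le
    rw [finrank_euclideanSpace_fin] at this
    rw [← this, measureReal_def, ENNReal.ofReal_toReal measure_closedBall_lt_top.ne]
  have hGp : ∀ p ∈ t, ENNReal.ofReal θ ≤ volume (G ∩ ball (x p) δ) := fun p hp =>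
    (ENNReal.ofReal_le_iff_le_toReal
      ((measure_mono Set.inter_subset_right).trans_lt measure_ball_lt_top).ne).2 (hG p hp)
  have hkey : ENNReal.ofReal θ * volume t ≤
      ENNReal.ofReal (D ^ N * ω) * volume (G ∩ U) := by
    calc ENNReal.ofReal θ * volume t
        ≤ ENNReal.ofReal θ * ∑' b : S, ENNReal.ofReal (D ^ N * ω) := by
          gcongr
          refine (measure_mono htsub).trans ((measure_biUnion_le _ hcount _).trans_eq ?_)
          simp only [hvol]
      _ = ENNReal.ofReal (D ^ N * ω) * ∑' b : S, ENNReal.ofReal θ := by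
          rw [← ENNReal.tsum_mul_left, ← ENNReal.tsum_mul_left]
          simp only [mul_comm]
      _ ≤ ENNReal.ofReal (D ^ N * ω) * ∑' b : S, volume (G ∩ ball (x b) δ) := by
          gcongr with b
          exact hGp b (hSt b.2)
      _ = ENNReal.ofReal (D ^ N * ω) * volume (⋃ b ∈ S, G ∩ ball (x b) δ) := by
          rw [measure_biUnion hcount (fun a ha b hb hab => (hdisj ha hb hab).mono
              (Set.inter_subset_right.trans ball_subset_closedBall)
              (Set.inter_subset_right.trans ball_subset_closedBall))
            (fun b _ => hGm.inter measurableSet_ball)]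
      _ ≤ _ := by
          gcongr
          exact Set.iUnion₂_subset fun b hb => Set.inter_subset_inter_right _ (hU b (hSt hb))
  have hfin : ENNReal.ofReal (D ^ N * ω) * volume (G ∩ U) ≠ ⊤ :=
    ENNReal.mul_ne_top ENNReal.ofReal_ne_top
      ((measure_mono Set.inter_subset_right).trans_lt hUfin.lt_top).ne
  have := ENNReal.toReal_mono hfin hkey
  rwa [ENNReal.toReal_mul, ENNReal.toReal_mul, ENNReal.toReal_ofReal hθ,
    ENNReal.toReal_ofReal (by positivity)] at this

/-- A nonnegative function with small averaged second difference cannot dominate a steep affine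
function that is almost nonnegative nearby. -/
lemma norm_le_of_inner_le {N : ℕ} {w : EuclideanSpace ℝ (Fin N) → ℝ} (hw : Measurable w)
    {x z a : EuclideanSpace ℝ (Fin N)} {ε B F ρ : ℝ} (hε : 0 < ε) (hF : 0 < F) (hρ : 0 < ρ)
    (hB : ∀ y ∈ ball x ε, |w y| ≤ B) (h0 : ∀ y ∈ ball x ε, 0 ≤ w y)
    (hK : ⨍ y in ball (0 : EuclideanSpace ℝ (Fin N)) 1, ddiff w x (ε • y) ≤ F * ε ^ 2)
    (hwx : w x ≤ ρ * ε ^ 2) (hxz : dist x z ≤ ε / 4)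
    (ha : ∀ y ∈ ball x ε, inner ℝ a (y - z) - ρ * ε ^ 2 ≤ w y) :
    ‖a‖ ≤ 8 / 3 * (ρ + 2 * 8 ^ N * (F / 2 + ρ)) * ε := by
  by_contra! hcon
  have hω := volume_real_unit_ball_pos (N := N)
  have hapos : 0 < ‖a‖ := lt_trans (by positivity) hcon
  set τ := 2 * 8 ^ N * (F / 2 + ρ) * ε ^ 2 with hτ
  have hcheb := mul_volume_lt_le_of_average_ddiff_le hw hε hB h0 hK (τ := τ) (by positivity)
  set c := z + (ε / (2 * ‖a‖)) • a with hc
  have hca : ‖(ε / (2 * ‖a‖)) • a‖ = ε / 2 := by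
    rw [norm_smul, Real.norm_of_nonneg (by positivity)]; field_simp
  have hsub : ball c (ε / 8) ⊆ {y | τ < w y} ∩ ball x ε := by
    intro y hy
    rw [mem_ball, dist_eq_norm] at hy
    have hyx : y ∈ ball x ε := by
      rw [mem_ball]
      have h1 : dist c z = ε / 2 := by rw [hc, dist_self_add_left, hca]
      linarith [dist_triangle y c x, dist_triangle c z x, dist_comm x z, dist_eq_norm y c]
    refine ⟨?_, hyx⟩
    refine lt_of_lt_of_le ?_ (ha y hyx)
    have hyz : y - z = (ε / (2 * ‖a‖)) • a + (y - c) := by rw [hc]; abel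
    have h2 := (abs_le.1 (abs_real_inner_le_norm a (y - c))).1
    have h3 : ε / (2 * ‖a‖) * ‖a‖ ^ 2 = ε / 2 * ‖a‖ := by field_simp
    rw [hyz, inner_add_right, inner_smul_right, real_inner_self_eq_norm_sq, h3]
    have h4 : ‖a‖ * ‖y - c‖ ≤ ‖a‖ * (ε / 8) := by gcongr
    have h5 := mul_lt_mul_of_pos_right hcon (by positivity : 0 < 3 / 8 * ε)
    linarith
  have hmono : volume.real (ball c (ε / 8)) ≤ volume.real ({y | τ < w y} ∩ ball x ε) :=
    measureReal_mono hsub ((measure_mono Set.inter_subset_right).trans_lt measure_ball_lt_top).ne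
  rw [volume_real_ball_eq c (by positivity)] at hmono
  rw [volume_real_ball_eq x hε] at hcheb
  have h6 := (mul_le_mul_of_nonneg_left hmono (by positivity : 0 ≤ τ)).trans hcheb
  have h7 : τ * ((ε / 8) ^ N * volume.real (ball (0 : EuclideanSpace ℝ (Fin N)) 1)) =
      2 * (F / 2 + ρ) * ε ^ 2 * (ε ^ N * volume.real (ball (0 : EuclideanSpace ℝ (Fin N)) 1)) := by
    rw [hτ, div_pow]; field_simp
  rw [h7, mul_le_mul_iff_left₀ (by positivity)] at h6
  have : 0 < (F / 2 + ρ) * ε ^ 2 := by positivity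
  linarith

/-- The measure estimate for small `ε`, for functions whose difference with a given barrier is
below `-1` somewhere. -/
lemma measure_estimate_of_barrier {N : ℕ} {Λ α β ε ρ γ A R : ℝ} (hΛ : 1 ≤ Λ)
    (hβ : 0 < β) (hα : 0 ≤ α) (hαβ : α + β = 1) (hε : 0 < ε) (hε1 : ε ≤ 1 / 8) (hρ : 0 < ρ)
    (hρ' : ρ ≤ 1 / 4) (hγ : 0 < γ)
    (hA : 0 < A) (hR : 1 ≤ R) (hεR : ε * Λ ≤ R) (hγε : γ * (ε * Λ) ^ 2 ≤ 1 / 2)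
    (hγβ : γ * Λ ^ 2 + 1 ≤ β / (1024 * 4 ^ N) * γ ^ 2)
    (hρA : ρ ≤ A * Real.exp (-(γ * R ^ 2)) / 4) {F : ℝ}
    (hF : F = (4 * ρ + 2 * A * γ * Λ ^ 2) / β)
    {u : EuclideanSpace ℝ (Fin N) → ℝ} (hu : Measurable u) {B : ℝ} (hB : ∀ x, |u x| ≤ B)
    (h0 : ∀ x, 0 ≤ u x) (hL : ∀ x ∈ ball 0 R, Lminus Λ α β ε u x ≤ ρ)
    {x₀ : EuclideanSpace ℝ (Fin N)} (hx₀ : ‖x₀‖ ≤ R)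
    (hux₀ : u x₀ - gaussianBarrier γ A R x₀ ≤ -1) :
    (1 / 20) ^ N * (1 / (6 * R)) ^ N / 2 *
        volume.real (ball (0 : EuclideanSpace ℝ (Fin N)) 1) ≤
      (8 / 3 * (ρ + 2 * 8 ^ N * (F / 2 + ρ))) ^ N *
      volume.real ({y | u y ≤ 2 * 20 ^ N * (F / 2 + ρ) + A + 1} ∩ ball 0 (1 / 2)) := by
  have hω := volume_real_unit_ball_pos (N := N)
  have hFpos : 0 < F := by rw [hF]; positivity
  have hm := measurable_gaussianBarrier (N := N) γ A R
  have hvR : ∀ x : EuclideanSpace ℝ (Fin N), R ≤ ‖x‖ → 0 ≤ u x - gaussianBarrier γ A R x := by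
    intro x hx
    have h1 : Real.exp (-(γ * ‖x‖ ^ 2)) ≤ Real.exp (-(γ * R ^ 2)) := by
      refine Real.exp_le_exp.2 (neg_le_neg ?_)
      gcongr
    have h2 : gaussianBarrier γ A R x ≤ 0 := mul_nonpos_of_nonneg_of_nonpos hA.le (by linarith)
    linarith [h0 x]
  have hvB : ∀ x, |u x - gaussianBarrier γ A R x| ≤ B + A := fun x =>
    (abs_sub _ _).trans (add_le_add (hB x) (abs_gaussianBarrier_le hγ.le hA.le x))
  have hε2 : ε ^ 2 ≤ 1 := by nlinarith
  have hη : ρ * ε ^ 2 ≤ 1 / 4 := by nlinarith [sq_nonneg ε]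
  have hex : ∀ p ∈ closedBall (0 : EuclideanSpace ℝ (Fin N)) (1 / (6 * R)), ∃ x m, ‖x‖ < R ∧
      m ≤ 0 ∧ (∀ y ∈ ball 0 (2 * R), inner ℝ p y + m ≤ u y - gaussianBarrier γ A R y) ∧
      u x - gaussianBarrier γ A R x ≤ inner ℝ p x + m + ρ * ε ^ 2 := fun p hp =>
    exists_affine_contact hvB (by linarith) hvR hx₀ hux₀ (by positivity) hη
      (mem_closedBall_zero_iff.1 hp)
  choose! x m hxR hm0 hbelow htouch using hex
  set t := closedBall (0 : EuclideanSpace ℝ (Fin N)) (1 / (6 * R))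
  set w : EuclideanSpace ℝ (Fin N) → EuclideanSpace ℝ (Fin N) → ℝ :=
    fun p y => u y - gaussianBarrier γ A R y - (inner ℝ p y + m p) with hw
  have hwm : ∀ p, Measurable (w p) := by
    intro p
    simp only [hw]
    fun_prop
  have hεle : ε ≤ R := by linarith
  have hball : ∀ p ∈ t, ball (x p) ε ⊆ ball 0 (2 * R) := by
    intro p hp y hy
    rw [mem_ball_zero_iff]
    rw [mem_ball, dist_eq_norm] at hy
    have : ‖y‖ ≤ ‖y - x p‖ + ‖x p‖ := by simpa using norm_add_le (y - x p) (x p)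
    linarith [hxR p hp]
  have hw0 : ∀ p ∈ t, ∀ y ∈ ball 0 (2 * R), 0 ≤ w p y := fun p hp y hy => by
    have := hbelow p hp y hy
    simp only [hw]
    linarith
  have hwx : ∀ p ∈ t, w p (x p) ≤ ρ * ε ^ 2 := fun p hp => by
    have := htouch p hp
    simp only [hw]
    linarith
  have hinner : ∀ p ∈ t, ∀ y ∈ ball (0 : EuclideanSpace ℝ (Fin N)) (2 * R),
      |inner ℝ p y| ≤ 1 := by
    intro p hp y hy
    rw [mem_ball_zero_iff] at hy
    refine (abs_real_inner_le_norm p y).trans ?_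
    calc ‖p‖ * ‖y‖ ≤ 1 / (6 * R) * (2 * R) := by
          gcongr
          exact mem_closedBall_zero_iff.1 hp
      _ ≤ 1 := by
          have : 1 / (6 * R) * (2 * R) = 1 / 3 := by field_simp; norm_num
          linarith
  have hwB : ∀ p ∈ t, ∀ y ∈ ball (x p) ε, |w p y| ≤ B + A + (1 + |m p|) := fun p hp y hy =>
    (abs_sub _ _).trans (add_le_add (hvB y) ((abs_add_le _ _).trans
      (add_le_add_left (hinner p hp y (hball p hp hy)) _)))
  have hcontact : ∀ p ∈ t, ‖x p‖ < 1 / 8 ∧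
      ⨍ y in ball (0 : EuclideanSpace ℝ (Fin N)) 1, ddiff (w p) (x p) (ε • y) ≤ F * ε ^ 2 := by
    intro p hp
    rw [hF]
    exact norm_lt_and_average_ddiff_le_of_contact hΛ hβ hα hαβ hε hρ hγ hA hεR hγε hγβ hρA hu hB
      (hxR p hp) (hL _ (mem_ball_zero_iff.2 (hxR p hp))) (hw0 p hp) (hwx p hp)
  set M := 2 * 20 ^ N * (F / 2 + ρ) + A + 1 with hM
  set C := 8 / 3 * (ρ + 2 * 8 ^ N * (F / 2 + ρ))
  have hC : 0 < C := by positivity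
  have hvit := mul_volume_le_of_vitali (t := t) (G := {y | u y ≤ M}) (U := ball 0 (1 / 2))
    (x := x) (δ := ε / 20) (D := C * ε)
    (θ := (ε / 20) ^ N * volume.real (ball (0 : EuclideanSpace ℝ (Fin N)) 1) / 2)
    (by positivity) (by positivity) (by positivity) ?_ (measurableSet_le hu measurable_const) ?_ ?_
    measure_ball_lt_top.ne
  · have hvolt : volume.real t = (1 / (6 * R)) ^ N *
        volume.real (ball (0 : EuclideanSpace ℝ (Fin N)) 1) := by
      have := Measure.addHaar_real_closedBall volume (0 : EuclideanSpace ℝ (Fin N))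
        (r := 1 / (6 * R)) (by positivity)
      rwa [finrank_euclideanSpace_fin] at this
    rw [hvolt] at hvit
    have hpos : 0 < ε ^ N * volume.real (ball (0 : EuclideanSpace ℝ (Fin N)) 1) := by positivity
    refine le_of_mul_le_mul_left (le_trans (le_of_eq ?_) (hvit.trans (le_of_eq ?_))) hpos
    · rw [div_eq_mul_one_div ε 20, mul_pow]; ring
    · rw [mul_pow]; ring
  · intro p hp q hq hd
    have hd' : dist (x p) (x q) ≤ ε / 4 := by linarith
    rw [dist_comm, dist_eq_norm]
    refine norm_le_of_inner_le (hwm p) hε hFpos hρ (hwB p hp)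
      (fun y hy => hw0 p hp y (hball p hp hy)) (hcontact p hp).2 (hwx p hp) hd' fun y hy => ?_
    have h1 := hbelow q hq y (hball p hp hy)
    have h2 := htouch q hq
    have h3 := hbelow p hp (x q) (mem_ball_zero_iff.2 (by linarith [hxR q hq]))
    simp only [hw, inner_sub_left, inner_sub_right]
    linarith
  · intro p hp
    rw [← volume_real_ball_eq (x p) (by positivity)]
    have hsubb : ball (x p) (ε / 20) ⊆ ball (x p) ε := ball_subset_ball (by linarith)
    have hhalf := half_volume_le_volume_le (hwm p) (x := x p) (r := ε / 20)
      (τ := 2 * 20 ^ N * (F / 2 + ρ) * ε ^ 2) <| by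
      have hcheb := mul_volume_lt_le_of_average_ddiff_le (hwm p) hε (hwB p hp)
        (fun y hy => hw0 p hp y (hball p hp hy)) (hcontact p hp).2
        (τ := 2 * 20 ^ N * (F / 2 + ρ) * ε ^ 2) (by positivity)
      have hmono : volume.real ({y | 2 * 20 ^ N * (F / 2 + ρ) * ε ^ 2 < w p y} ∩
          ball (x p) (ε / 20)) ≤
          volume.real ({y | 2 * 20 ^ N * (F / 2 + ρ) * ε ^ 2 < w p y} ∩ ball (x p) ε) :=
        measureReal_mono (Set.inter_subset_inter_right _ hsubb)
          ((measure_mono Set.inter_subset_right).trans_lt measure_ball_lt_top).ne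
      have hτ : 0 < 2 * 20 ^ N * (F / 2 + ρ) * ε ^ 2 := by positivity
      refine le_of_mul_le_mul_left ?_ hτ
      refine ((mul_le_mul_of_nonneg_left hmono hτ.le).trans hcheb).trans ?_
      rw [volume_real_ball_eq (x p) hε, volume_real_ball_eq (x p) (by positivity), div_pow]
      have : 2 * 20 ^ N * (F / 2 + ρ) * ε ^ 2 * (ε ^ N / 20 ^ N *
          volume.real (ball (0 : EuclideanSpace ℝ (Fin N)) 1) / 2) = (F / 2 + ρ) * ε ^ 2 *
          (ε ^ N * volume.real (ball (0 : EuclideanSpace ℝ (Fin N)) 1)) := by field_simp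
      rw [this]
      refine mul_le_mul_of_nonneg_right ?_ (by positivity)
      linarith [hwx p hp]
    refine hhalf.trans (measureReal_mono ?_
      ((measure_mono Set.inter_subset_right).trans_lt measure_ball_lt_top).ne)
    rintro y ⟨hy, hyb⟩
    refine ⟨?_, hyb⟩
    simp only [Set.mem_ofPred_eq, hw] at hy ⊢
    have h1 := (abs_le.1 (hinner p hp y (hball p hp (hsubb hyb)))).2
    have h2 := (abs_le.1 (abs_gaussianBarrier_le (R := R) hγ.le hA.le y)).2
    have h3 : 2 * 20 ^ N * (F / 2 + ρ) * ε ^ 2 ≤ 2 * 20 ^ N * (F / 2 + ρ) * 1 := by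
      gcongr
    linarith [hm0 p hp]
  · intro p hp y hy
    rw [mem_ball, dist_eq_norm] at hy
    rw [mem_ball_zero_iff]
    have : ‖y‖ ≤ ‖y - x p‖ + ‖x p‖ := by simpa using norm_add_le (y - x p) (x p)
    linarith [(hcontact p hp).1]

lemma measure_estimate_of_small {N : ℕ} (hN : 1 ≤ N) {Λ α β : ℝ} (hΛ : 1 ≤ Λ) (hβ : 0 < β)
    (hα : 0 ≤ α) (hαβ : α + β = 1) :
    ∃ ρ₀ : ℝ, 0 < ρ₀ ∧ ∀ ρ, 0 < ρ → ρ ≤ ρ₀ → ρ ≤ 1 / 4 → ∃ ε₁ M μ : ℝ, 0 < ε₁ ∧ ε₁ ≤ 1 ∧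
      0 < M ∧ 0 < μ ∧ ∀ ε : ℝ, 0 < ε → ε ≤ ε₁ →
      ∀ u : EuclideanSpace ℝ (Fin N) → ℝ, Measurable u → (∃ B, ∀ x, |u x| ≤ B) →
        (∀ x, 0 ≤ u x) → (∀ x ∈ ball 0 (4 * √N), Lminus Λ α β ε u x ≤ ρ) →
        ∀ x, ‖x‖ ≤ 3 / 2 * √N → u x ≤ 1 →
          μ ≤ volume.real ({y | u y ≤ M} ∩ ball 0 (1 / 2)) := by
  have hω := volume_real_unit_ball_pos (N := N)
  set ω := volume.real (ball (0 : EuclideanSpace ℝ (Fin N)) 1)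
  have hN' : (1 : ℝ) ≤ √N := by
    rw [Real.one_le_sqrt]; exact_mod_cast hN
  have hβ1 : β ≤ 1 := by linarith
  have hΛ2 : 1 ≤ Λ ^ 2 := one_le_pow₀ hΛ
  set R : ℝ := 2 * √N
  have hR : 1 ≤ R := by unfold R; linarith
  set c : ℝ := β / (1024 * 4 ^ N)
  have hc : 0 < c := by positivity
  have hc1 : c ≤ 1 := by
    unfold c
    rw [div_le_one (by positivity)]
    have : (1 : ℝ) ≤ 4 ^ N := one_le_pow₀ (by norm_num)
    linarith
  set γ : ℝ := (Λ ^ 2 + 1) / c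
  have hγ1 : 1 ≤ γ := by
    unfold γ
    rw [le_div_iff₀ hc]; linarith
  have hγ : 0 < γ := by linarith
  have hγβ : γ * Λ ^ 2 + 1 ≤ c * γ ^ 2 := by
    have : c * γ ^ 2 = (Λ ^ 2 + 1) * γ := by unfold γ; field_simp
    rw [this]; linarith
  have hden : 0 < Real.exp (-(γ * (3 / 2 * √N) ^ 2)) - Real.exp (-(γ * R ^ 2)) := by
    rw [sub_pos, Real.exp_lt_exp, neg_lt_neg_iff]
    unfold R
    gcongr
    norm_num
  set A : ℝ := 2 / (Real.exp (-(γ * (3 / 2 * √N) ^ 2)) - Real.exp (-(γ * R ^ 2))) with hAdef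
  have hA : 0 < A := by positivity
  refine ⟨A * Real.exp (-(γ * R ^ 2)) / 4, by positivity, fun ρ hρ hρA hρ4 => ?_⟩
  set F : ℝ := (4 * ρ + 2 * A * γ * Λ ^ 2) / β with hF
  have hFpos : 0 < F := by positivity
  set C : ℝ := (8 / 3 * (ρ + 2 * 8 ^ N * (F / 2 + ρ))) ^ N
  have hC : 0 < C := by positivity
  refine ⟨1 / (8 * γ * Λ ^ 2), 2 * 20 ^ N * (F / 2 + ρ) + A + 1,
    (1 / 20) ^ N * (1 / (6 * R)) ^ N / 2 * ω / C, by positivity, ?_, by positivity,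
    by positivity, ?_⟩
  · rw [div_le_one (by positivity)]
    nlinarith
  · rintro ε hε hε1 u hu ⟨B, hB⟩ h0 hL x hx hux
    rw [le_div_iff₀ (by positivity)] at hε1
    have hγΛ : 1 ≤ γ * Λ := by nlinarith
    have hεΛ : ε * Λ ≤ 1 / 8 := by
      have : ε * Λ * 1 ≤ ε * Λ * (γ * Λ) := by gcongr
      linarith
    have hε8 : ε ≤ 1 / 8 := by nlinarith
    rw [div_le_iff₀ hC, mul_comm _ C]
    refine measure_estimate_of_barrier hΛ hβ hα hαβ hε hε8 hρ hρ4 hγ hA hR (by linarith) ?_ hγβ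
      hρA hF hu hB h0 (fun y hy => hL y (ball_subset_ball (by unfold R; linarith) hy))
      (x₀ := x) (by unfold R; linarith) ?_
    · have : γ * (ε * Λ) ^ 2 = (ε * (8 * γ * Λ ^ 2)) * ε / 8 := by ring
      rw [this]
      nlinarith
    · have h1 : Real.exp (-(γ * (3 / 2 * √N) ^ 2)) ≤ Real.exp (-(γ * ‖x‖ ^ 2)) := by
        refine Real.exp_le_exp.2 (neg_le_neg ?_)
        gcongr
      have h2 : 2 ≤ gaussianBarrier γ A R x := by
        unfold gaussianBarrier
        calc (2 : ℝ) = A * (Real.exp (-(γ * (3 / 2 * √N) ^ 2)) - Real.exp (-(γ * R ^ 2))) := by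
              rw [hAdef, div_mul_cancel₀ _ hden.ne']
          _ ≤ _ := by gcongr
      linarith

theorem exists_measure_estimate {N : ℕ} (hN : 1 ≤ N) {Λ α β : ℝ} (hΛ : 1 ≤ Λ) (hβ : 0 < β)
    (hα : 0 ≤ α) (hαβ : α + β = 1) :
    ∃ ρ M μ : ℝ, 0 < ρ ∧ ρ ≤ 1 ∧ 1 ≤ M ∧ 0 < μ ∧ μ ≤ 1 / 2 ∧
      ∀ ε, 0 < ε → ε ≤ 4 * √N → ∀ u : EuclideanSpace ℝ (Fin N) → ℝ, Measurable u →
        (∃ B, ∀ x, |u x| ≤ B) → (∀ x, 0 ≤ u x) →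
        (∀ x ∈ ball 0 (4 * √N), Lminus Λ α β ε u x ≤ ρ) →
        ∀ x, ‖x‖ ≤ 3 / 2 * √N → u x ≤ 1 →
          μ ≤ volume.real ({y | u y ≤ M} ∩ ball 0 (1 / 2)) := by
  obtain ⟨ρ₀, hρ₀, H⟩ := measure_estimate_of_small hN hΛ hβ hα hαβ
  have hN0 : (1 : ℝ) ≤ N := by exact_mod_cast hN
  have hρ : 0 < min ρ₀ (1 / (16 * N)) := by positivity
  have hρ16 : min ρ₀ (1 / (16 * (N : ℝ))) * (16 * N) ≤ 1 := by
    calc _ ≤ 1 / (16 * (N : ℝ)) * (16 * N) := by gcongr; exact min_le_right _ _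
      _ = 1 := by field_simp
  have hρ4 : min ρ₀ (1 / (16 * (N : ℝ))) ≤ 1 / 4 := by nlinarith
  obtain ⟨ε₁, M₁, μ₁, hε₁, hε₁', hM₁, hμ₁, H₁⟩ := H _ hρ (min_le_left _ _) hρ4
  obtain ⟨M₂, μ₂, hM₂, hμ₂, H₂⟩ :=
    measure_estimate_of_le hN (Λ := Λ) (by linarith) hβ hα hαβ hε₁ hε₁'
  have key : ∀ (u : EuclideanSpace ℝ (Fin N) → ℝ) (M M' : ℝ), M ≤ M' →
      volume.real ({y | u y ≤ M} ∩ ball 0 (1 / 2)) ≤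
        volume.real ({y | u y ≤ M'} ∩ ball 0 (1 / 2)) := fun u M M' h =>
    measureReal_mono (Set.inter_subset_inter_left _ fun y (hy : u y ≤ M) => hy.trans h)
      (measure_ne_top_of_subset Set.inter_subset_right measure_ball_lt_top.ne)
  refine ⟨_, max (max M₁ M₂) 1, min (min μ₁ μ₂) (1 / 2), hρ, by linarith, le_max_right _ _,
    by positivity, min_le_right _ _, fun ε hε hεN u hu hB h0 hL x hx hux => ?_⟩
  rcases le_total ε ε₁ with h | h
  · exact ((min_le_left _ _).trans (min_le_left _ _)).trans
      ((H₁ ε hε h u hu hB h0 hL x hx hux).trans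
        (key u _ _ ((le_max_left _ _).trans (le_max_left _ _))))
  · refine ((min_le_left _ _).trans (min_le_right _ _)).trans
      ((H₂ ε _ h hεN ?_ u hu hB h0 hL x hx hux).trans
        (key u _ _ ((le_max_right _ _).trans (le_max_left _ _))))
    have : ε ^ 2 ≤ (16 * N : ℝ) := by
      calc ε ^ 2 ≤ (4 * √(N : ℝ)) ^ 2 := by gcongr
        _ = (16 * N : ℝ) := by rw [mul_pow, Real.sq_sqrt (by linarith)]; norm_num
    calc _ ≤ 16 * N * min ρ₀ (1 / (16 * (N : ℝ))) := by gcongr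
      _ ≤ 1 := by linarith

theorem ddiff_rescale {N : ℕ} (u : EuclideanSpace ℝ (Fin N) → ℝ) {ℓ : ℝ} (hℓ : ℓ ≠ 0) (ε t : ℝ)
    (m x z : EuclideanSpace ℝ (Fin N)) :
    ddiff (fun x => t⁻¹ * u (m + ℓ • x)) x ((ε / ℓ) • z) = t⁻¹ * ddiff u (m + ℓ • x) (ε • z) := by
  have h : ℓ • (ε / ℓ) • z = ε • z := by rw [smul_smul, mul_div_cancel₀ _ hℓ]
  simp only [ddiff, smul_add, smul_sub, h, ← add_assoc, ← add_sub_assoc]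
  ring

theorem Lminus_rescale {N : ℕ} (Λ α β ε : ℝ) (u : EuclideanSpace ℝ (Fin N) → ℝ) {ℓ t : ℝ}
    (hℓ : ℓ ≠ 0) (ht : 0 ≤ t) (m x : EuclideanSpace ℝ (Fin N)) :
    Lminus Λ α β (ε / ℓ) (fun x => t⁻¹ * u (m + ℓ • x)) x =
      ℓ ^ 2 * t⁻¹ * Lminus Λ α β ε u (m + ℓ • x) := by
  have h₁ : sInf ((fun z => t⁻¹ * ddiff u (m + ℓ • x) (ε • z)) '' ball 0 Λ) =
      t⁻¹ * sInf ((fun z => ddiff u (m + ℓ • x) (ε • z)) '' ball 0 Λ) := by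
    rw [← smul_eq_mul, ← Real.sInf_smul_of_nonneg (inv_nonneg.2 ht), ← Set.image_smul,
      Set.image_image]
    rfl
  simp only [Lminus, ddiff_rescale u hℓ, h₁, setAverage_eq, integral_const_mul, smul_eq_mul]
  field_simp

theorem volume_real_preimage_add_smul {N : ℕ} {ℓ : ℝ} (hℓ : 0 < ℓ)
    (m : EuclideanSpace ℝ (Fin N)) (s : Set (EuclideanSpace ℝ (Fin N))) :
    volume.real s = ℓ ^ N * volume.real ((fun y => m + ℓ • y) ⁻¹' s) := by
  have : (fun y => m + ℓ • y) ⁻¹' s = (fun y => ℓ • y) ⁻¹' ((fun y => m + y) ⁻¹' s) := rfl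
  rw [this, measureReal_def, measureReal_def, Measure.addHaar_preimage_smul _ hℓ.ne',
    measure_preimage_add, ENNReal.toReal_mul, finrank_euclideanSpace_fin,
    ENNReal.toReal_ofReal (abs_nonneg _), abs_of_nonneg (by positivity), ← mul_assoc,
    mul_inv_cancel₀ (by positivity), one_mul]

theorem exists_measure_estimate_rescaled {N : ℕ} (hN : 1 ≤ N) {Λ α β : ℝ} (hΛ : 1 ≤ Λ)
    (hβ : 0 < β) (hα : 0 ≤ α) (hαβ : α + β = 1) :
    ∃ ρ M μ : ℝ, 0 < ρ ∧ ρ ≤ 1 ∧ 1 ≤ M ∧ 0 < μ ∧ μ ≤ 1 / 2 ∧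
      ∀ ε ℓ t, 0 < ε → 0 < ℓ → ℓ ≤ 1 → 1 ≤ t → ε ≤ 4 * √N * ℓ →
      ∀ u : EuclideanSpace ℝ (Fin N) → ℝ, Measurable u →
        (∃ B, ∀ x, |u x| ≤ B) → (∀ x, 0 ≤ u x) → ∀ m,
        (∀ x ∈ ball m (4 * √N * ℓ), Lminus Λ α β ε u x ≤ ρ) →
        ∀ x, ‖x - m‖ ≤ 3 / 2 * √N * ℓ → u x ≤ t →
          μ * ℓ ^ N ≤ volume.real ({y | u y ≤ M * t} ∩ ball m (ℓ / 2)) := by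
  obtain ⟨ρ, M, μ, hρ, hρ1, hM, hμ, hμ', H⟩ := exists_measure_estimate hN hΛ hβ hα hαβ
  refine ⟨ρ, M, μ, hρ, hρ1, hM, hμ, hμ', ?_⟩
  rintro ε ℓ t hε hℓ hℓ1 ht hεℓ u hu ⟨B, hB⟩ h0 m hL x hx hux
  have ht0 : 0 < t := by linarith
  have hxe : m + ℓ • (ℓ⁻¹ • (x - m)) = x := by
    rw [smul_smul, mul_inv_cancel₀ hℓ.ne', one_smul, add_sub_cancel]
  have key := H (ε / ℓ) (by positivity) ((div_le_iff₀ hℓ).2 hεℓ)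
    (fun x => t⁻¹ * u (m + ℓ • x)) ((hu.comp (by fun_prop)).const_mul _)
    ⟨t⁻¹ * B, fun x => by
      rw [abs_mul, abs_of_pos (inv_pos.2 ht0)]
      exact mul_le_mul_of_nonneg_left (hB _) (inv_pos.2 ht0).le⟩
    (fun x => mul_nonneg (inv_pos.2 ht0).le (h0 _)) ?_ (ℓ⁻¹ • (x - m)) ?_ ?_
  · rw [volume_real_preimage_add_smul hℓ m, mul_comm]
    refine mul_le_mul_of_nonneg_left (key.trans_eq ?_) (by positivity)
    congr 1
    ext y
    simp only [Set.mem_inter_iff, Set.mem_ofPred_eq, Set.mem_preimage, mem_ball, dist_zero_right,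
      dist_self_add_left, norm_smul, Real.norm_of_nonneg hℓ.le]
    rw [inv_mul_le_iff₀ ht0, mul_comm t, mul_comm ℓ, div_eq_mul_one_div ℓ, mul_comm ℓ,
      mul_lt_mul_iff_left₀ hℓ]
  · intro y hy
    rw [Lminus_rescale _ _ _ _ _ hℓ.ne' ht0.le]
    have h1 : Lminus Λ α β ε u (m + ℓ • y) ≤ ρ := by
      refine hL _ ?_
      rw [mem_ball, dist_self_add_left, norm_smul, Real.norm_of_nonneg hℓ.le, mul_comm]
      exact mul_lt_mul_of_pos_right (mem_ball_zero_iff.1 hy) hℓ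
    have h2 : ℓ ^ 2 * t⁻¹ ≤ 1 :=
      mul_le_one₀ (pow_le_one₀ hℓ.le hℓ1) (inv_pos.2 ht0).le (inv_le_one_of_one_le₀ ht)
    have h3 : 0 ≤ ℓ ^ 2 * t⁻¹ := by positivity
    nlinarith
  · rw [norm_smul, norm_inv, Real.norm_of_nonneg hℓ.le, inv_mul_le_iff₀ hℓ]
    linarith
  · simp only [hxe]
    rw [inv_mul_le_iff₀ ht0]
    linarith

/-- The half-open axis-parallel box of side length `ℓ` with lowest corner `c`. -/
def lowerBox {N : ℕ} (c : Fin N → ℝ) (ℓ : ℝ) : Set (EuclideanSpace ℝ (Fin N)) :=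
  {y | ∀ i, y i ∈ Set.Ico (c i) (c i + ℓ)}

/-- The corner of the dyadic child of `lowerBox c (2 * h)` selected by `s`. -/
noncomputable def childCorner {N : ℕ} (c : Fin N → ℝ) (h : ℝ) (s : Fin N → Bool) : Fin N → ℝ :=
  fun i => c i + if s i then h else 0

theorem lowerBox_eq_preimage {N : ℕ} (c : Fin N → ℝ) (ℓ : ℝ) :
    lowerBox c ℓ = (MeasurableEquiv.toLp 2 (Fin N → ℝ)).symm ⁻¹'
      Set.univ.pi fun i => Set.Ico (c i) (c i + ℓ) := by
  ext y
  simp [lowerBox]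

theorem measurableSet_lowerBox {N : ℕ} (c : Fin N → ℝ) (ℓ : ℝ) :
    MeasurableSet (lowerBox c ℓ) := by
  rw [lowerBox_eq_preimage]
  exact (MeasurableEquiv.measurable _) (MeasurableSet.univ_pi fun i => measurableSet_Ico)

theorem volume_lowerBox {N : ℕ} (c : Fin N → ℝ) (ℓ : ℝ) :
    volume (lowerBox c ℓ) = ENNReal.ofReal ℓ ^ N := by
  rw [lowerBox_eq_preimage, (EuclideanSpace.volume_preserving_symm_measurableEquiv_toLp
    (Fin N)).measure_preimage (MeasurableSet.univ_pi fun i => measurableSet_Ico).nullMeasurableSet,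
    volume_pi_pi]
  simp

theorem volume_real_lowerBox {N : ℕ} (c : Fin N → ℝ) {ℓ : ℝ} (hℓ : 0 ≤ ℓ) :
    volume.real (lowerBox c ℓ) = ℓ ^ N := by
  rw [measureReal_def, volume_lowerBox, ENNReal.toReal_pow, ENNReal.toReal_ofReal hℓ]

theorem volume_inter_lowerBox_ne_top {N : ℕ} (S : Set (EuclideanSpace ℝ (Fin N)))
    (c : Fin N → ℝ) (ℓ : ℝ) : volume (S ∩ lowerBox c ℓ) ≠ ⊤ :=
  measure_ne_top_of_subset Set.inter_subset_right (by simp [volume_lowerBox])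

theorem iUnion_lowerBox_childCorner {N : ℕ} (c : Fin N → ℝ) {h : ℝ} (hh : 0 ≤ h) :
    ⋃ s, lowerBox (childCorner c h s) h = lowerBox c (2 * h) := by
  ext y
  simp only [Set.mem_iUnion, lowerBox, childCorner, Set.mem_ofPred_eq, Set.mem_Ico]
  constructor
  · rintro ⟨s, hs⟩ i
    have := hs i
    split_ifs at this <;> constructor <;> linarith
  · intro hy
    refine ⟨fun i => decide (c i + h ≤ y i), fun i => ?_⟩
    have := hy i
    by_cases hi : c i + h ≤ y i <;> simp only [hi, decide_true, decide_false] <;>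
      simp <;> constructor <;> linarith

theorem pairwise_disjoint_lowerBox_childCorner {N : ℕ} (c : Fin N → ℝ) (h : ℝ) :
    Pairwise (Function.onFun Disjoint fun s => lowerBox (childCorner c h s) h) := by
  intro s s' hss
  obtain ⟨i, hi⟩ := Function.ne_iff.1 hss
  refine Set.disjoint_left.2 fun y hy hy' => hi ?_
  have h1 := hy i
  have h2 := hy' i
  simp only [childCorner, Set.mem_Ico] at h1 h2
  cases hs : s i <;> cases hs' : s' i <;> simp [hs, hs'] at h1 h2 ⊢ <;> linarith

theorem volume_real_inter_lowerBox {N : ℕ} {S : Set (EuclideanSpace ℝ (Fin N))}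
    (hS : MeasurableSet S) (c : Fin N → ℝ) {h : ℝ} (hh : 0 ≤ h) :
    volume.real (S ∩ lowerBox c (2 * h)) =
      ∑ s, volume.real (S ∩ lowerBox (childCorner c h s) h) := by
  rw [← iUnion_lowerBox_childCorner c hh, Set.inter_iUnion, measureReal_iUnion_fintype
    (h' := fun s => volume_inter_lowerBox_ne_top _ _ _)]
  · exact fun s s' hs => (pairwise_disjoint_lowerBox_childCorner c h hs).mono
      Set.inter_subset_right Set.inter_subset_right
  · exact fun s => hS.inter (measurableSet_lowerBox _ _)

theorem volume_dichotomy_of_subset {N : ℕ} {A B : Set (EuclideanSpace ℝ (Fin N))} {q κ : ℝ}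
    (hκ : 0 ≤ κ) {c : Fin N → ℝ} {ℓ : ℝ} (hℓ : 0 ≤ ℓ) (h : lowerBox c ℓ ⊆ B) :
    volume.real (A ∩ lowerBox c ℓ) ≤ q * volume.real (B ∩ lowerBox c ℓ) + κ * ℓ ^ N ∨
      q * ℓ ^ N < volume.real (A ∩ lowerBox c ℓ) := by
  rw [Set.inter_eq_right.2 h, volume_real_lowerBox c hℓ]
  have : 0 ≤ κ * ℓ ^ N := by positivity
  rcases le_or_gt (volume.real (A ∩ lowerBox c ℓ)) (q * ℓ ^ N) with h | h
  · left; linarith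
  · exact Or.inr h

/-- A finite dyadic covering argument with an error term at the bottom scale. -/
theorem volume_dichotomy_of_dyadic {N : ℕ} {A B Q₀ : Set (EuclideanSpace ℝ (Fin N))}
    (hA : MeasurableSet A) (hB : MeasurableSet B) {q κ ℓ₀ : ℝ} (hκ : 0 ≤ κ) (hℓ₀ : 0 < ℓ₀)
    (hbot : ∀ c, lowerBox c ℓ₀ ⊆ Q₀ →
      volume.real (A ∩ lowerBox c ℓ₀) ≤ q * volume.real (B ∩ lowerBox c ℓ₀) + κ * ℓ₀ ^ N ∨
        q * ℓ₀ ^ N < volume.real (A ∩ lowerBox c ℓ₀))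
    (hstep : ∀ c h s, ℓ₀ ≤ h → lowerBox c (2 * h) ⊆ Q₀ →
      q * h ^ N < volume.real (A ∩ lowerBox (childCorner c h s) h) → lowerBox c (2 * h) ⊆ B)
    (n : ℕ) (c : Fin N → ℝ) (hc : lowerBox c (2 ^ n * ℓ₀) ⊆ Q₀) :
    volume.real (A ∩ lowerBox c (2 ^ n * ℓ₀)) ≤
        q * volume.real (B ∩ lowerBox c (2 ^ n * ℓ₀)) + κ * (2 ^ n * ℓ₀) ^ N ∨
      q * (2 ^ n * ℓ₀) ^ N < volume.real (A ∩ lowerBox c (2 ^ n * ℓ₀)) := by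
  induction n generalizing c with
  | zero => simpa using hbot c (by simpa using hc)
  | succ n ih =>
    set h := 2 ^ n * ℓ₀ with hh
    have hh0 : 0 < h := by positivity
    have hℓ₀h : ℓ₀ ≤ h := le_mul_of_one_le_left hℓ₀.le (one_le_pow₀ one_le_two)
    have he : (2 : ℝ) ^ (n + 1) * ℓ₀ = 2 * h := by rw [hh]; ring
    rw [he] at hc ⊢
    by_cases hs : ∃ s, q * h ^ N < volume.real (A ∩ lowerBox (childCorner c h s) h)
    · obtain ⟨s, hs⟩ := hs
      exact volume_dichotomy_of_subset hκ (by positivity) (hstep c h s hℓ₀h hc hs)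
    · push Not at hs
      left
      have hsub : ∀ s, lowerBox (childCorner c h s) h ⊆ lowerBox c (2 * h) := fun s => by
        rw [← iUnion_lowerBox_childCorner c hh0.le]
        exact Set.subset_iUnion (fun s => lowerBox (childCorner c h s) h) s
      have hvol : (2 * h) ^ N = ∑ _s : Fin N → Bool, h ^ N := by
        simp [mul_pow]
      rw [volume_real_inter_lowerBox hA c hh0.le, volume_real_inter_lowerBox hB c hh0.le, hvol,
        Finset.mul_sum, Finset.mul_sum, ← Finset.sum_add_distrib]
      refine Finset.sum_le_sum fun s _ => ?_
      exact (ih _ ((hsub s).trans hc)).resolve_right (not_lt.2 (hs s))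

theorem EuclideanSpace.norm_le_sqrt_mul {N : ℕ} {v : EuclideanSpace ℝ (Fin N)} {r : ℝ}
    (hr : 0 ≤ r) (h : ∀ i, |v i| ≤ r) : ‖v‖ ≤ √N * r := by
  rw [EuclideanSpace.norm_eq]
  refine Real.sqrt_le_iff.2 ⟨by positivity, ?_⟩
  calc ∑ i, ‖v i‖ ^ 2 ≤ ∑ _i : Fin N, r ^ 2 := by
        refine Finset.sum_le_sum fun i _ => ?_
        rw [Real.norm_eq_abs]
        exact pow_le_pow_left₀ (abs_nonneg _) (h i) 2
    _ = (√N * r) ^ 2 := by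
        rw [mul_pow, Real.sq_sqrt (Nat.cast_nonneg _)]
        simp

theorem lowerBox_subset_cube {N : ℕ} (hN : 1 ≤ N) :
    lowerBox (fun _ : Fin N => (-1 / 2 : ℝ)) 1 ⊆ cube (fun _ => 0) (10 * √N) := by
  intro y hy i
  have hN' : 1 ≤ √(N : ℝ) := Real.one_le_sqrt.2 (by exact_mod_cast hN)
  obtain ⟨h1, h2⟩ := hy i
  rw [abs_lt]
  constructor <;> linarith

theorem exists_lowerBox_estimate {N : ℕ} (hN : 1 ≤ N) {Λ α β : ℝ} (hΛ : 1 ≤ Λ)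
    (hβ : 0 < β) (hα : 0 ≤ α) (hαβ : α + β = 1) :
    ∃ ρ M q : ℝ, 0 < ρ ∧ ρ ≤ 1 ∧ 1 ≤ M ∧ 1 / 2 ≤ q ∧ q < 1 ∧
      ∀ ε h t, 0 < ε → 0 < h → h ≤ 1 → 1 ≤ t → ε ≤ 4 * √N * h →
      ∀ u : EuclideanSpace ℝ (Fin N) → ℝ, Measurable u →
        (∃ B, ∀ x, |u x| ≤ B) → (∀ x, 0 ≤ u x) →
        (∀ x ∈ cube (fun _ => 0) (10 * √N), Lminus Λ α β ε u x ≤ ρ) →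
        ∀ c, (∀ i, |c i + h / 2| ≤ 1 / 2) → ∀ x : EuclideanSpace ℝ (Fin N),
          (∀ i, |x i - (c i + h / 2)| ≤ 3 / 2 * h) → u x ≤ t → ∀ K, M ≤ K →
          volume.real ({y | K * t < u y} ∩ lowerBox c h) ≤ q * h ^ N := by
  obtain ⟨ρ, M, μ, hρ, hρ1, hM, hμ, hμ', H⟩ := exists_measure_estimate_rescaled hN hΛ hβ hα hαβ
  refine ⟨ρ, M, 1 - μ, hρ, hρ1, hM, by linarith, by linarith, ?_⟩
  intro ε h t hε hh hh1 ht hεh u hu hB h0 hL c hc x hx hux K hK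
  have hN' : 1 ≤ √(N : ℝ) := Real.one_le_sqrt.2 (by exact_mod_cast hN)
  set m : EuclideanSpace ℝ (Fin N) := WithLp.toLp 2 fun i => c i + h / 2 with hm
  have hmi : ∀ i, m i = c i + h / 2 := fun i => rfl
  have coord : ∀ (y : EuclideanSpace ℝ (Fin N)) i, |y i - (c i + h / 2)| ≤ dist y m :=
    fun y i => by
      rw [dist_eq_norm, ← hmi, ← PiLp.sub_apply, ← Real.norm_eq_abs]
      exact PiLp.norm_apply_le _ i
  have key := H ε h t hε hh hh1 ht hεh u hu hB h0 m (fun y hy => hL y fun i => ?_) x ?_ hux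
  · have hsub : ball m (h / 2) ⊆ lowerBox c h := fun y hy i => by
      have h1 := abs_lt.1 ((coord y i).trans_lt (mem_ball.1 hy))
      constructor <;> linarith [h1.1, h1.2]
    have hle : volume.real ({y | u y ≤ M * t} ∩ ball m (h / 2)) ≤
        volume.real (lowerBox c h \ {y | K * t < u y}) := by
      refine measureReal_mono (fun y hy => ⟨hsub hy.2, fun h' : K * t < u y => h'.not_ge (le_trans hy.1 ?_)⟩)
        (measure_ne_top_of_subset Set.sdiff_subset (by simp [volume_lowerBox]))
      exact mul_le_mul_of_nonneg_right hK (by linarith)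
    have hsum := measureReal_inter_add_sdiff (μ := volume) (s := lowerBox c h)
      (measurableSet_lt measurable_const hu : MeasurableSet {y | K * t < u y})
      (by simp [volume_lowerBox])
    rw [volume_real_lowerBox c hh.le, Set.inter_comm] at hsum
    linarith
  · have h1 := (coord y i).trans_lt (mem_ball.1 hy)
    have h2 := abs_add_le (y i - (c i + h / 2)) (c i + h / 2)
    rw [sub_add_cancel] at h2
    rw [sub_zero]
    have h3 := hc i
    have h4 : 4 * √(N : ℝ) * h ≤ 4 * √N * 1 := by gcongr
    linarith
  · have := EuclideanSpace.norm_le_sqrt_mul (v := x - m) (by positivity) hx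
    linarith

theorem volume_lt_inter_lowerBox_le {N : ℕ} {Λ α β ε ρ : ℝ} (hΛ : 0 < Λ) (hβ : 0 < β)
    (hα : 0 ≤ α) (hαβ : α + β = 1) (hε : 0 < ε) (hρ : ε ^ 2 * ρ ≤ 1)
    {u : EuclideanSpace ℝ (Fin N) → ℝ} (hu : Measurable u) {B : ℝ} (hB : ∀ x, |u x| ≤ B)
    (h0 : ∀ x, 0 ≤ u x) {c : Fin N → ℝ} {h : ℝ} (hh : 0 < h) (hhε : √N * h < ε)
    (hεh : ε ≤ 4 * √N * h) {x : EuclideanSpace ℝ (Fin N)} (hx : x ∈ lowerBox c h)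
    (hL : Lminus Λ α β ε u x ≤ ρ) {t K : ℝ} (ht : 1 ≤ t) (hK : 1 ≤ K) (hux : u x ≤ t) :
    volume.real ({y | K * t < u y} ∩ lowerBox c h) ≤
      2 / β * (4 * √N) ^ N * volume.real (ball (0 : EuclideanSpace ℝ (Fin N)) 1) / K * h ^ N := by
  set ω := volume.real (ball (0 : EuclideanSpace ℝ (Fin N)) 1) with hω
  have hω0 : 0 ≤ ω := measureReal_nonneg
  have hsub : lowerBox c h ⊆ ball x ε := fun y hy => by
    rw [mem_ball, dist_eq_norm]
    refine (EuclideanSpace.norm_le_sqrt_mul hh.le fun i => ?_).trans_lt hhε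
    have h1 := hy i
    have h2 := hx i
    rw [PiLp.sub_apply, abs_le]
    constructor <;> linarith [h1.1, h1.2, h2.1, h2.2]
  have key := mul_volume_lt_le_of_Lminus_le hΛ hβ hα hαβ hε hρ hu hB h0 hL (τ := K * t)
    (by positivity)
  have hmono : volume.real ({y | K * t < u y} ∩ lowerBox c h) ≤
      volume.real ({y | K * t < u y} ∩ ball x ε) :=
    measureReal_mono (Set.inter_subset_inter_right _ hsub)
      (measure_ne_top_of_subset Set.inter_subset_right measure_ball_lt_top.ne)
  rw [volume_real_ball_eq x hε, ← hω] at key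
  have h1 : (u x + 1) / β * (ε ^ N * ω) ≤ t * (2 / β * ((4 * √N * h) ^ N * ω)) := by
    have : (u x + 1) / β ≤ t * (2 / β) := by
      rw [← mul_div_assoc]
      gcongr
      linarith
    rw [← mul_assoc t]
    exact mul_le_mul this (by gcongr) (by positivity) (by positivity)
  have h2 : K * volume.real ({y | K * t < u y} ∩ ball x ε) ≤
      2 / β * ((4 * √N * h) ^ N * ω) := by
    refine le_of_mul_le_mul_left ?_ (by linarith : 0 < t)
    linarith
  refine hmono.trans ?_
  rw [← mul_le_mul_iff_right₀ (by linarith : 0 < K)]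
  refine h2.trans_eq ?_
  have : K ≠ 0 := by linarith
  rw [mul_pow (4 * √(N : ℝ)) h]
  field_simp

theorem exists_nat_two_pow_mul_eq_one {r : ℝ} (hr : 0 < r) (hr1 : r < 1) :
    ∃ (n : ℕ) (h : ℝ), 2 ^ n * h = 1 ∧ r / 2 ≤ h ∧ h ≤ r := by
  obtain ⟨n, h1, h2⟩ := exists_nat_pow_near_of_lt_one (y := (1 / 2 : ℝ)) hr hr1.le (by norm_num)
    (by norm_num)
  refine ⟨n + 1, (1 / 2) ^ (n + 1), by rw [← mul_pow]; norm_num, ?_, h1.le⟩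
  rw [pow_succ]
  linarith

theorem exists_volume_decay_step {N : ℕ} (hN : 1 ≤ N) {Λ α β : ℝ} (hΛ : 1 ≤ Λ)
    (hβ : 0 < β) (hα : 0 ≤ α) (hαβ : α + β = 1) :
    ∃ ρ M q C : ℝ, 0 < ρ ∧ 1 ≤ M ∧ 1 / 2 ≤ q ∧ q < 1 ∧ 0 ≤ C ∧
      ∀ ε, 0 < ε → ε ≤ 1 → ∀ u : EuclideanSpace ℝ (Fin N) → ℝ, Measurable u →
        (∃ B, ∀ x, |u x| ≤ B) → (∀ x, 0 ≤ u x) →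
        (∀ x ∈ cube (fun _ => 0) (10 * √N), Lminus Λ α β ε u x ≤ ρ) →
        sInf (u '' cube (fun _ => 0) 3) ≤ 1 → ∀ K t, M ≤ K → 2 ≤ t →
        volume.real ({x | K * t < u x} ∩ lowerBox (fun _ => -1 / 2) 1) ≤
          q * volume.real ({x | t < u x} ∩ lowerBox (fun _ => -1 / 2) 1) + C / K := by
  obtain ⟨ρ, M, q, hρ, hρ1, hM, hq, hq1, H⟩ := exists_lowerBox_estimate hN hΛ hβ hα hαβ
  set C := 2 / β * (4 * √N) ^ N * volume.real (ball (0 : EuclideanSpace ℝ (Fin N)) 1) with hC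
  have hC0 : 0 ≤ C := by positivity
  refine ⟨ρ, M, q, C, hρ, hM, hq, hq1, hC0, ?_⟩
  intro ε hε hε1 u hu hB h0 hL hinf K t hK ht
  have hN' : 1 ≤ √(N : ℝ) := Real.one_le_sqrt.2 (by exact_mod_cast hN)
  have hK1 : 1 ≤ K := hM.trans hK
  have hκ : 0 ≤ C / K := by positivity
  obtain ⟨n, ℓ₀, hn, hl, hr⟩ := exists_nat_two_pow_mul_eq_one (r := ε / (2 * √N))
    (by positivity) ((div_lt_one (by positivity)).2 (by linarith))
  have hℓ₀ : 0 < ℓ₀ := lt_of_lt_of_le (by positivity) hl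
  have hr' : √N * ℓ₀ < ε := by
    rw [le_div_iff₀ (by positivity)] at hr
    linarith
  have hl' : ε ≤ 4 * √N * ℓ₀ := by
    rw [div_div, div_le_iff₀ (by positivity)] at hl
    linarith
  have hρε : ε ^ 2 * ρ ≤ 1 := mul_le_one₀ (pow_le_one₀ hε.le hε1) hρ.le hρ1
  obtain ⟨B, hB'⟩ := hB
  have hdich := volume_dichotomy_of_dyadic (A := {x | K * t < u x}) (B := {x | t < u x})
    (Q₀ := lowerBox (fun _ : Fin N => (-1 / 2 : ℝ)) 1) (q := q)
    (measurableSet_lt measurable_const hu) (measurableSet_lt measurable_const hu) hκ hℓ₀ ?_ ?_ n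
    (fun _ => -1 / 2) (by rw [hn])
  · rw [hn, one_pow, mul_one, mul_one] at hdich
    refine hdich.resolve_right (not_lt.2 ?_)
    have hne : (cube (fun _ : Fin N => (0 : ℝ)) 3).Nonempty := ⟨0, fun i => by simp⟩
    obtain ⟨_, ⟨x, hx, rfl⟩, hx1⟩ :=
      exists_lt_of_csInf_lt (hne.image u) (hinf.trans_lt one_lt_two)
    have := H ε 1 t hε one_pos le_rfl (by linarith) (by linarith) u hu ⟨B, hB'⟩ h0 hL
      (fun _ => -1 / 2) (fun i => by norm_num) x (fun i => by
        have := (hx i).le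
        norm_num at this ⊢
        exact this) (by linarith) K hK
    simpa using this
  · intro c hc
    by_cases hcB : lowerBox c ℓ₀ ⊆ {x | t < u x}
    · exact volume_dichotomy_of_subset hκ hℓ₀.le hcB
    · obtain ⟨x, hx, hxt⟩ := Set.not_subset.1 hcB
      left
      have := volume_lt_inter_lowerBox_le (by linarith) hβ hα hαβ hε hρε hu hB' h0 hℓ₀ hr' hl' hx
        (hL x (lowerBox_subset_cube hN (hc hx))) (by linarith : 1 ≤ t) hK1 (not_lt.1 hxt)
      have h1 : 0 ≤ q * volume.real ({x | t < u x} ∩ lowerBox c ℓ₀) := by positivity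
      linarith
  · intro c h s hh hc hlt x hx
    by_contra hxt
    have hh0 : 0 < h := hℓ₀.trans_le hh
    have h2 : 2 * h ≤ 1 := by
      have h3 := measureReal_mono (μ := volume) hc (by simp [volume_lowerBox])
      rw [volume_real_lowerBox _ (by positivity), volume_real_lowerBox _ zero_le_one, one_pow] at h3
      exact (pow_le_one_iff_of_nonneg (by positivity) (by omega)).1 h3
    have hcs : ∀ i, childCorner c h s i = c i ∨ childCorner c h s i = c i + h := fun i => by
      unfold childCorner
      split_ifs <;> simp
    have hm : ∀ i, |childCorner c h s i + h / 2| ≤ 1 / 2 := fun i => by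
      have := hc (show WithLp.toLp 2 (fun i => childCorner c h s i + h / 2) ∈ lowerBox c (2 * h)
        from fun i => by
          rcases hcs i with h' | h' <;> simp only [h'] <;> constructor <;> linarith) i
      obtain ⟨h4, h5⟩ := this
      rw [abs_le]
      constructor <;> linarith
    have hεh : ε ≤ 4 * √N * h := hl'.trans (by gcongr)
    refine not_lt.2 (H ε h t hε hh0 (by linarith) (by linarith) hεh u hu ⟨B, hB'⟩ h0 hL _ hm x
      (fun i => ?_) (not_lt.1 hxt) K hK) hlt
    obtain ⟨h4, h5⟩ := hx i
    rw [abs_le]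
    rcases hcs i with h' | h' <;> rw [h'] <;> constructor <;> linarith

/-- Iterating `D (K * t) ≤ q * D t + C / K` along `L ^ (j ^ 2)` yields decay of the form
`exp (-√(log t / a))`. -/
theorem exists_exp_neg_sqrt_log_bound {q C M : ℝ} (hq : 1 / 2 ≤ q) (hq1 : q < 1) (hC : 0 ≤ C)
    (hM : 1 ≤ M) :
    ∃ a d : ℝ, 0 < a ∧ 1 ≤ d ∧ ∀ D : ℝ → ℝ, Antitone D → (∀ t, D t ≤ 1) →
      (∀ K t, M ≤ K → 2 ≤ t → D (K * t) ≤ q * D t + C / K) →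
      ∀ t, 1 ≤ t → D t ≤ d * Real.exp (-√(Real.log t / a)) := by
  set s := (1 + q) / 2 with hs
  have hs0 : 0 < s := by linarith
  have hs1 : s < 1 := by linarith
  have hsi : 1 < s⁻¹ := (one_lt_inv₀ hs0).2 hs1
  have hsq : 0 < s - q := by linarith
  set L := max M (max 2 s⁻¹) with hL
  have hLM : M ≤ L := le_max_left _ _
  have hL2 : 2 ≤ L := (le_max_left _ _).trans (le_max_right _ _)
  have hLs : s⁻¹ ≤ L := (le_max_right _ _).trans (le_max_right _ _)
  have hL0 : 0 < L := by linarith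
  set d := s⁻¹ + C / (s - q) with hd
  have hd0 : 0 < d := by positivity
  have hds : 1 ≤ d * s := by
    rw [hd, add_mul, inv_mul_cancel₀ hs0.ne']
    have : 0 ≤ C / (s - q) * s := by positivity
    linarith
  have hdC : C ≤ d * (s - q) := by
    rw [hd, add_mul, div_mul_cancel₀ _ hsq.ne']
    have : 0 ≤ s⁻¹ * (s - q) := by positivity
    linarith
  have hlogL : 0 < Real.log L := Real.log_pos (by linarith)
  have hlogs : 0 < -Real.log s := by linarith [Real.log_neg hs0 hs1]
  have hds' : 1 ≤ d / s := by
    rw [le_div_iff₀ hs0]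
    nlinarith
  refine ⟨Real.log L / (-Real.log s) ^ 2, d / s, by positivity, hds', ?_⟩
  intro D hD hD1 hstep t ht
  have hdecay : ∀ j : ℕ, D (L ^ (j ^ 2)) ≤ d * s ^ j := by
    intro j
    induction j with
    | zero => exact (hD1 _).trans (by rw [pow_zero]; nlinarith)
    | succ j ih =>
      rcases Nat.eq_zero_or_pos j with rfl | hj
      · exact (hD1 _).trans (by simpa using hds)
      · have h1 : L ^ ((j + 1) ^ 2) = L ^ (2 * j + 1) * L ^ (j ^ 2) := by
          rw [← pow_add]
          congr 1
          ring
        have h2 : L ≤ L ^ (2 * j + 1) := le_self_pow₀ (by linarith) (by omega)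
        have h3 : L ≤ L ^ (j ^ 2) := le_self_pow₀ (by linarith) (by positivity)
        have h4 : C / L ^ (2 * j + 1) ≤ C * s ^ j := by
          rw [div_eq_mul_inv, ← inv_pow]
          refine mul_le_mul_of_nonneg_left ?_ hC
          have h5 : L⁻¹ ≤ s := inv_le_of_inv_le₀ hs0 hLs
          calc L⁻¹ ^ (2 * j + 1) ≤ s ^ (2 * j + 1) := by gcongr
            _ ≤ s ^ j := pow_le_pow_of_le_one hs0.le hs1.le (by omega)
        rw [h1]
        calc D (L ^ (2 * j + 1) * L ^ (j ^ 2))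
            ≤ q * D (L ^ (j ^ 2)) + C / L ^ (2 * j + 1) :=
              hstep _ _ (hLM.trans h2) (hL2.trans h3)
          _ ≤ q * (d * s ^ j) + d * (s - q) * s ^ j := by
              refine add_le_add (mul_le_mul_of_nonneg_left ih (by linarith)) (h4.trans ?_)
              exact mul_le_mul_of_nonneg_right hdC (by positivity)
          _ = d * s ^ (j + 1) := by ring
  have hlogt : 0 ≤ Real.log t := Real.log_nonneg ht
  have ht0 : 0 < t := by linarith
  set r := √(Real.log t / Real.log L) with hr
  have hr0 : 0 ≤ r := Real.sqrt_nonneg _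
  have hr2 : r ^ 2 * Real.log L = Real.log t := by
    rw [hr, Real.sq_sqrt (by positivity), div_mul_cancel₀ _ hlogL.ne']
  have hlow : L ^ (⌊r⌋₊ ^ 2) ≤ t := by
    rw [← Real.log_le_log_iff (by positivity) ht0, Real.log_pow, ← hr2]
    push_cast
    gcongr
    exact Nat.floor_le hr0
  have hsqrt : √(Real.log t / (Real.log L / (-Real.log s) ^ 2)) = r * -Real.log s := by
    rw [div_div_eq_mul_div, mul_div_right_comm, Real.sqrt_mul (by positivity),
      Real.sqrt_sq hlogs.le]
  calc D t ≤ d * s ^ ⌊r⌋₊ := (hD hlow).trans (hdecay _)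
    _ = d / s * s ^ (⌊r⌋₊ + 1) := by
        rw [pow_succ]
        field_simp
    _ ≤ d / s * Real.exp (-√(Real.log t / (Real.log L / (-Real.log s) ^ 2))) := by
        refine mul_le_mul_of_nonneg_left ?_ (by positivity)
        rw [hsqrt, ← Real.exp_log (pow_pos hs0 _), Real.log_pow]
        refine Real.exp_le_exp.2 ?_
        have := (Nat.lt_floor_add_one r).le
        push_cast
        nlinarith

/-- **Lemma `measure bound`.** There exist `ε₀ > 0`, `ρ > 0`, `a > 0` and
`d ≥ 1`, depending only on `N, Λ, α, β`, such that: if `u` is bounded Borel measurable with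
`L_ε^- u ≤ ρ` in `Q_{10√N}` and `u ≥ 0` in `ℝ^N`, for some `0 < ε ≤ ε₀`, and `inf_{Q_3} u ≤ 1`,
then `|{u > t} ∩ Q_1| ≤ d·exp(−√((log t)/a))` for every `t ≥ 1`. -/
theorem power_decay_estimate (N : ℕ) (hN : 1 ≤ N) (Λ α β : ℝ) (hΛ : 1 ≤ Λ)
    (hβ : β ∈ Set.Ioc (0 : ℝ) 1) (hα : α = 1 - β) :
    ∃ (ε₀ ρ a d : ℝ), 0 < ε₀ ∧ 0 < ρ ∧ 0 < a ∧ 1 ≤ d ∧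
      ∀ ε : ℝ, 0 < ε → ε ≤ ε₀ →
        ∀ u : EuclideanSpace ℝ (Fin N) → ℝ,
          Measurable u → (∃ K, ∀ x, |u x| ≤ K) →
          (∀ x ∈ cube (fun _ : Fin N => (0 : ℝ)) (10 * Real.sqrt N),
            Lminus Λ α β ε u x ≤ ρ) →
          (∀ x, 0 ≤ u x) →
          sInf (u '' cube (fun _ : Fin N => (0 : ℝ)) 3) ≤ 1 →
          ∀ t : ℝ, 1 ≤ t →
            volume ({x | t < u x} ∩ cube (fun _ : Fin N => (0 : ℝ)) 1) ≤
              ENNReal.ofReal (d * Real.exp (-Real.sqrt (Real.log t / a))) := by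
  obtain ⟨ρ, M, q, C, hρ, hM, hq, hq1, hC, H⟩ := exists_volume_decay_step hN hΛ hβ.1
    (by linarith [hβ.2]) (by linarith : α + β = 1)
  obtain ⟨a, d, ha, hd, Hd⟩ := exists_exp_neg_sqrt_log_bound hq hq1 hC hM
  refine ⟨1, ρ, a, d, one_pos, hρ, ha, hd, ?_⟩
  intro ε hε hε1 u hu hB hL h0 hinf t ht
  have hsub : cube (fun _ : Fin N => (0 : ℝ)) 1 ⊆ lowerBox (fun _ => -1 / 2) 1 := fun y hy i => by
    have := abs_lt.1 (hy i)
    constructor <;> linarith [this.1, this.2]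
  have hfin := volume_inter_lowerBox_ne_top (N := N)
  have key := Hd (fun t => volume.real ({x | t < u x} ∩ lowerBox (fun _ : Fin N => -1 / 2) 1))
    (fun t t' htt' => measureReal_mono
      (Set.inter_subset_inter_left _ fun x (hx : t' < u x) => htt'.trans_lt hx) (hfin _ _ _))
    (fun t => by
      refine (measureReal_mono Set.inter_subset_right (by simp [volume_lowerBox])).trans_eq ?_
      rw [volume_real_lowerBox _ zero_le_one, one_pow])
    (H ε hε hε1 u hu hB h0 hL hinf) t ht
  refine (measure_mono (Set.inter_subset_inter_right _ hsub)).trans ?_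
  rw [← ofReal_measureReal (hfin _ _ _)]
  exact ENNReal.ofReal_le_ofReal key
end

section
/- Given θ ∈ (0,1), there exist ε₀ > 0, ρ > 0 and η = η(θ) ∈ (0,1) (with ε₀, ρ depending only on N, Λ, α, β, and η additionally on θ) such that the following holds: if u is a bounded Borel measurable function on ℝ^N satisfying L_ε^- u ≤ ηρ in Q_{10√N} and u ≥ 0 in ℝ^N, for some 0 < ε < ε₀, and |Q_1 ∩ {u > 1}| ≥ θ, then inf_{Q_3} u ≥ η. -/
open MeasureTheory Metric

namespace DeGiorgi

variable {N : ℕ}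

/-- The Lebesgue measure of the Euclidean unit ball. -/
noncomputable def unitVol (N : ℕ) : ℝ :=
  volume.real (ball (0 : EuclideanSpace ℝ (Fin N)) 1)

lemma unitVol_pos (N : ℕ) : 0 < unitVol N := by
  unfold unitVol Measure.real
  exact ENNReal.toReal_pos (measure_ball_pos _ _ one_pos).ne' measure_ball_lt_top.ne

lemma volume_real_ball (x : EuclideanSpace ℝ (Fin N)) {r : ℝ} (hr : 0 < r) :
    volume.real (ball x r) = r ^ N * unitVol N := by
  unfold unitVol Measure.real
  rw [Measure.addHaar_ball_of_pos _ _ hr, finrank_euclideanSpace_fin, ENNReal.toReal_mul,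
    ENNReal.toReal_ofReal (by positivity)]

lemma volume_real_preimage_affine (A : Set (EuclideanSpace ℝ (Fin N)))
    (x : EuclideanSpace ℝ (Fin N)) {ε : ℝ} (hε : 0 < ε) :
    volume.real ((fun w => x + ε • w) ⁻¹' A) = (ε ^ N)⁻¹ * volume.real A := by
  have h : (fun w => x + ε • w) ⁻¹' A = (fun w => ε • w) ⁻¹' ((fun w => x + w) ⁻¹' A) := rfl
  unfold Measure.real
  rw [h, Measure.addHaar_preimage_smul _ hε.ne', finrank_euclideanSpace_fin, ENNReal.toReal_mul,
    ENNReal.toReal_ofReal (by positivity), measure_preimage_add, abs_of_pos (by positivity)]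

lemma setAverage_unitBall (h : EuclideanSpace ℝ (Fin N) → ℝ) :
    ⨍ w in ball (0 : EuclideanSpace ℝ (Fin N)) 1, h w
      = (unitVol N)⁻¹ * ∫ w in ball (0 : EuclideanSpace ℝ (Fin N)) 1, h w := by
  rw [setAverage_eq, smul_eq_mul, unitVol]

lemma mul_volume_le_of_le_setAverage {h : EuclideanSpace ℝ (Fin N) → ℝ}
    (hI : IntegrableOn h (ball 0 1)) {A : Set (EuclideanSpace ℝ (Fin N))}
    (hA : MeasurableSet A) (hAB : A ⊆ ball 0 1) {b l : ℝ}
    (hb : ∀ w ∈ ball (0 : EuclideanSpace ℝ (Fin N)) 1, -b ≤ h w)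
    (hl : ∀ w ∈ A, -b + l ≤ h w) :
    l * volume.real A ≤
      unitVol N * ((⨍ w in ball (0 : EuclideanSpace ℝ (Fin N)) 1, h w) + b) := by
  have hω := unitVol_pos N
  have hfin : volume (ball (0 : EuclideanSpace ℝ (Fin N)) 1) ≠ ⊤ := measure_ball_lt_top.ne
  have hc : IntegrableOn (fun _ : EuclideanSpace ℝ (Fin N) => b) (ball 0 1) :=
    integrableOn_const hfin
  have hI' : IntegrableOn (fun w => h w + b) (ball 0 1) := hI.add hc
  have h1 : ∫ w in ball (0 : EuclideanSpace ℝ (Fin N)) 1, (h w + b)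
      = unitVol N * ((⨍ w in ball (0 : EuclideanSpace ℝ (Fin N)) 1, h w) + b) := by
    rw [integral_add hI hc, setAverage_unitBall, setIntegral_const, smul_eq_mul, ← unitVol]
    field_simp
  rw [← h1]
  have h2 : ∫ w in A, (h w + b) ≤ ∫ w in ball (0 : EuclideanSpace ℝ (Fin N)) 1, (h w + b) := by
    apply setIntegral_mono_set hI' _ hAB.eventuallyLE
    filter_upwards [ae_restrict_mem measurableSet_ball] with w hw
    have := hb w hw
    simp only [Pi.zero_apply]; linarith
  have h3 : ∫ w in A, l ≤ ∫ w in A, (h w + b) := by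
    apply setIntegral_mono_on _ (hI'.mono_set hAB) hA
    · intro w hw; linarith [hl w hw]
    · exact integrableOn_const ((measure_mono hAB).trans_lt measure_ball_lt_top).ne
  rw [setIntegral_const, smul_eq_mul] at h3
  linarith

lemma mul_volume_le_setAverage_comp_affine {g : EuclideanSpace ℝ (Fin N) → ℝ}
    {x : EuclideanSpace ℝ (Fin N)} {ε : ℝ} (hε : 0 < ε)
    (hI : IntegrableOn (fun w => g (x + ε • w)) (ball 0 1)) (hg : ∀ y, 0 ≤ g y)
    {A : Set (EuclideanSpace ℝ (Fin N))} (hA : MeasurableSet A) (hAB : A ⊆ ball x ε) {l : ℝ}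
    (hl : ∀ y ∈ A, l ≤ g y) :
    l * volume.real A ≤ ε ^ N * unitVol N *
      ⨍ w in ball (0 : EuclideanSpace ℝ (Fin N)) 1, g (x + ε • w) := by
  have := mul_volume_le_of_le_setAverage hI (A := (fun w => x + ε • w) ⁻¹' A) (b := 0) (l := l)
    (hA.preimage (by fun_prop)) ?_ (by intro w _; simpa using hg _)
    (by intro w hw; simpa using hl _ hw)
  · rw [volume_real_preimage_affine _ _ hε, add_zero] at this
    have h2 : 0 < ε ^ N := by positivity
    calc l * volume.real A = ε ^ N * (l * ((ε ^ N)⁻¹ * volume.real A)) := by field_simp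
      _ ≤ _ := by rw [mul_assoc]; gcongr
  · intro w hw
    have := hAB hw
    rw [mem_ball, dist_eq_norm, add_sub_cancel_left, norm_smul, Real.norm_of_nonneg hε.le] at this
    rw [mem_ball_zero_iff]
    by_contra hcon
    push Not at hcon
    nlinarith

lemma integrableOn_comp_affine {g : EuclideanSpace ℝ (Fin N) → ℝ} (hg : Measurable g)
    {K : ℝ} (hK : ∀ x, |g x| ≤ K) (x : EuclideanSpace ℝ (Fin N)) (ε : ℝ) :
    IntegrableOn (fun w => g (x + ε • w)) (ball 0 1) := by
  apply Measure.integrableOn_of_bounded (M := K) measure_ball_lt_top.ne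
  · exact (hg.comp (by fun_prop)).aestronglyMeasurable
  · exact Filter.Eventually.of_forall fun w => hK _

lemma integrableOn_comp_affine_neg {g : EuclideanSpace ℝ (Fin N) → ℝ}
    {x : EuclideanSpace ℝ (Fin N)} {ε : ℝ}
    (hI : IntegrableOn (fun w => g (x + ε • w)) (ball 0 1)) :
    IntegrableOn (fun w => g (x - ε • w)) (ball 0 1) ∧
    ∫ w in ball (0 : EuclideanSpace ℝ (Fin N)) 1, g (x - ε • w)
      = ∫ w in ball (0 : EuclideanSpace ℝ (Fin N)) 1, g (x + ε • w) := by
  have hm := Measure.measurePreserving_neg (volume : Measure (EuclideanSpace ℝ (Fin N)))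
  have he : MeasurableEmbedding (Neg.neg : EuclideanSpace ℝ (Fin N) → _) :=
    (MeasurableEquiv.neg _).measurableEmbedding
  have hpre : (Neg.neg : EuclideanSpace ℝ (Fin N) → _) ⁻¹' (ball 0 1) = ball 0 1 := by
    ext w; simp
  have hf : (fun w => g (x - ε • w)) = (fun w => g (x + ε • w)) ∘ Neg.neg := by
    ext w; simp [sub_eq_add_neg]
  constructor
  · rw [hf, ← hpre, hm.integrableOn_comp_preimage he]
    exact hI
  · have := hm.setIntegral_preimage_emb he (fun w => g (x + ε • w)) (ball 0 1)
    rw [hpre] at this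
    rw [← this]
    simp [sub_eq_add_neg]

lemma integrableOn_ddiff {g : EuclideanSpace ℝ (Fin N) → ℝ}
    {x : EuclideanSpace ℝ (Fin N)} {ε : ℝ}
    (hI : IntegrableOn (fun w => g (x + ε • w)) (ball 0 1)) :
    IntegrableOn (fun w => ddiff g x (ε • w)) (ball 0 1) :=
  (hI.add (integrableOn_comp_affine_neg hI).1).sub (integrableOn_const measure_ball_lt_top.ne)

lemma setAverage_ddiff {g : EuclideanSpace ℝ (Fin N) → ℝ}
    {x : EuclideanSpace ℝ (Fin N)} {ε : ℝ}
    (hI : IntegrableOn (fun w => g (x + ε • w)) (ball 0 1)) :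
    ⨍ w in ball (0 : EuclideanSpace ℝ (Fin N)) 1, ddiff g x (ε • w)
      = 2 * (⨍ w in ball (0 : EuclideanSpace ℝ (Fin N)) 1, g (x + ε • w)) - 2 * g x := by
  have hω := unitVol_pos N
  obtain ⟨h1, h2⟩ := integrableOn_comp_affine_neg hI
  rw [setAverage_unitBall, setAverage_unitBall]
  have hs : IntegrableOn (fun w => g (x + ε • w) + g (x - ε • w)) (ball 0 1) := hI.add h1
  unfold ddiff
  rw [integral_sub hs (integrableOn_const measure_ball_lt_top.ne), integral_add hI h1, h2,
    setIntegral_const, smul_eq_mul, ← unitVol]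
  field_simp
  ring

/-- A lower bound on the second differences turns an upper bound on `Lminus` into an upper bound
on the averaged second difference. -/
lemma mul_setAverage_ddiff_le {Λ α β ε f b : ℝ} (hΛ : 0 < Λ) (hα : 0 ≤ α) (hε : 0 < ε)
    {u : EuclideanSpace ℝ (Fin N) → ℝ} {x : EuclideanSpace ℝ (Fin N)}
    (hL : Lminus Λ α β ε u x ≤ f)
    (hb : ∀ z ∈ ball (0 : EuclideanSpace ℝ (Fin N)) Λ, -b ≤ ddiff u x (ε • z)) :
    β * ⨍ w in ball (0 : EuclideanSpace ℝ (Fin N)) 1, ddiff u x (ε • w)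
      ≤ 2 * ε ^ 2 * f + α * b := by
  unfold Lminus at hL
  have h1 : -b ≤ sInf ((fun z => ddiff u x (ε • z)) ''
      ball (0 : EuclideanSpace ℝ (Fin N)) Λ) := by
    apply le_csInf ((nonempty_ball.2 hΛ).image _)
    rintro _ ⟨z, hz, rfl⟩
    exact hb z hz
  rw [one_div, inv_mul_le_iff₀ (by positivity)] at hL
  nlinarith [mul_le_mul_of_nonneg_left h1 hα]

lemma mul_setAverage_le {Λ α β ε f : ℝ} (hΛ : 0 < Λ) (hα : 0 ≤ α) (hαβ : α = 1 - β) (hε : 0 < ε)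
    {u : EuclideanSpace ℝ (Fin N) → ℝ} {x : EuclideanSpace ℝ (Fin N)}
    (hI : IntegrableOn (fun w => u (x + ε • w)) (ball 0 1)) (hu : ∀ y, 0 ≤ u y)
    (hL : Lminus Λ α β ε u x ≤ f) :
    β * ⨍ w in ball (0 : EuclideanSpace ℝ (Fin N)) 1, u (x + ε • w) ≤ u x + ε ^ 2 * f := by
  have := mul_setAverage_ddiff_le hΛ hα hε hL (b := 2 * u x) (by
    intro z _; unfold ddiff; linarith [hu (x + ε • z), hu (x - ε • z)])
  rw [setAverage_ddiff hI] at this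
  subst hαβ
  nlinarith

lemma le_of_density {Λ α β ε f : ℝ} (hΛ : 0 < Λ) (hα : 0 ≤ α) (hαβ : α = 1 - β) (hβ : 0 < β)
    (hε : 0 < ε) {u : EuclideanSpace ℝ (Fin N) → ℝ} (hm : Measurable u) {K : ℝ}
    (hK : ∀ x, |u x| ≤ K) (hu : ∀ y, 0 ≤ u y)
    {x : EuclideanSpace ℝ (Fin N)} (hL : Lminus Λ α β ε u x ≤ f)
    {A : Set (EuclideanSpace ℝ (Fin N))} (hA : MeasurableSet A) (hAB : A ⊆ ball x ε) {t : ℝ}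
    (ht : ∀ y ∈ A, t ≤ u y) :
    β * t * volume.real A / (ε ^ N * unitVol N) - ε ^ 2 * f ≤ u x := by
  have hω := unitVol_pos N
  have hI := integrableOn_comp_affine hm hK x ε
  have h1 := mul_volume_le_setAverage_comp_affine hε hI hu hA hAB ht
  have h2 := mul_setAverage_le hΛ hα hαβ hε hI hu hL
  have h3 : β * t * volume.real A / (ε ^ N * unitVol N)
      ≤ β * ⨍ w in ball (0 : EuclideanSpace ℝ (Fin N)) 1, u (x + ε • w) := by
    rw [div_le_iff₀ (by positivity)]
    nlinarith [mul_le_mul_of_nonneg_left h1 hβ.le]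
  linarith

lemma one_add_sq_div_two_le_cosh (s : ℝ) : 1 + s ^ 2 / 2 ≤ Real.cosh s := by
  have h1 : Real.cosh s = 1 + 2 * Real.sinh (s / 2) ^ 2 := by
    have := Real.cosh_two_mul (s / 2)
    rw [mul_div_cancel₀ s two_ne_zero] at this
    rw [this, Real.cosh_sq]; ring
  have h2 : (s / 2) ^ 2 ≤ Real.sinh (s / 2) ^ 2 := by
    rw [sq_le_sq, Real.abs_sinh]
    exact Real.self_le_sinh_iff.2 (abs_nonneg _)
  rw [h1]; linarith

lemma ddiff_gaussian (γ : ℝ) (x v : EuclideanSpace ℝ (Fin N)) :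
    ddiff (fun y => Real.exp (-γ * ‖y‖ ^ 2)) x v = 2 * Real.exp (-γ * ‖x‖ ^ 2) *
      (Real.exp (-γ * ‖v‖ ^ 2) * Real.cosh (2 * γ * inner ℝ x v) - 1) := by
  unfold ddiff
  simp only
  rw [norm_add_sq_real, norm_sub_sq_real, Real.cosh_eq]
  have h1 : Real.exp (-γ * (‖x‖ ^ 2 + 2 * inner ℝ x v + ‖v‖ ^ 2)) = Real.exp (-γ * ‖x‖ ^ 2) *
      Real.exp (-γ * ‖v‖ ^ 2) * Real.exp (-(2 * γ * inner ℝ x v)) := by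
    rw [← Real.exp_add, ← Real.exp_add]; ring_nf
  have h2 : Real.exp (-γ * (‖x‖ ^ 2 - 2 * inner ℝ x v + ‖v‖ ^ 2)) = Real.exp (-γ * ‖x‖ ^ 2) *
      Real.exp (-γ * ‖v‖ ^ 2) * Real.exp (2 * γ * inner ℝ x v) := by
    rw [← Real.exp_add, ← Real.exp_add]; ring_nf
  rw [h1, h2]; ring

lemma neg_le_ddiff_gaussian {γ : ℝ} (x v : EuclideanSpace ℝ (Fin N)) :
    -(2 * Real.exp (-γ * ‖x‖ ^ 2) * (γ * ‖v‖ ^ 2)) ≤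
      ddiff (fun y => Real.exp (-γ * ‖y‖ ^ 2)) x v := by
  rw [ddiff_gaussian]
  have h1 := Real.one_le_cosh (2 * γ * inner ℝ x v)
  have h2 := Real.add_one_le_exp (-γ * ‖v‖ ^ 2)
  have h3 : Real.exp (-γ * ‖v‖ ^ 2) * 1 ≤
      Real.exp (-γ * ‖v‖ ^ 2) * Real.cosh (2 * γ * inner ℝ x v) := by gcongr
  have h4 : -(γ * ‖v‖ ^ 2) ≤
      Real.exp (-γ * ‖v‖ ^ 2) * Real.cosh (2 * γ * inner ℝ x v) - 1 := by linarith
  have := mul_le_mul_of_nonneg_left h4 (show 0 ≤ 2 * Real.exp (-γ * ‖x‖ ^ 2) by positivity)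
  linarith

lemma le_ddiff_gaussian {γ : ℝ} {x v : EuclideanSpace ℝ (Fin N)} (hv : γ * ‖v‖ ^ 2 ≤ 1 / 2) :
    2 * Real.exp (-γ * ‖x‖ ^ 2) * (-(γ * ‖v‖ ^ 2) + γ ^ 2 * inner ℝ x v ^ 2) ≤
      ddiff (fun y => Real.exp (-γ * ‖y‖ ^ 2)) x v := by
  rw [ddiff_gaussian]
  have h1 := one_add_sq_div_two_le_cosh (2 * γ * inner ℝ x v)
  have h2 := Real.add_one_le_exp (-γ * ‖v‖ ^ 2)
  have h3 : (1 - γ * ‖v‖ ^ 2) * (1 + (2 * γ * inner ℝ x v) ^ 2 / 2) ≤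
      Real.exp (-γ * ‖v‖ ^ 2) * Real.cosh (2 * γ * inner ℝ x v) := by
    apply mul_le_mul _ h1 (by positivity) (by positivity)
    linarith
  have h4 := mul_nonneg (sub_nonneg.2 hv) (sq_nonneg (γ * inner ℝ x v))
  gcongr
  nlinarith

lemma inner_ge_of_mem_ball {x w : EuclideanSpace ℝ (Fin N)} (hx : x ≠ 0)
    (hw : w ∈ ball ((2 * ‖x‖)⁻¹ • x) (1 / 4)) : ‖x‖ / 4 ≤ inner ℝ x w := by
  have hx' := norm_pos_iff.2 hx
  rw [mem_ball, dist_eq_norm] at hw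
  have h1 : inner ℝ x w = ‖x‖ / 2 + inner ℝ x (w - (2 * ‖x‖)⁻¹ • x) := by
    rw [inner_sub_right, real_inner_smul_right, real_inner_self_eq_norm_sq]
    field_simp; ring
  have h2 := abs_le.1 (abs_real_inner_le_norm x (w - (2 * ‖x‖)⁻¹ • x))
  have h3 : ‖x‖ * ‖w - (2 * ‖x‖)⁻¹ • x‖ ≤ ‖x‖ * (1 / 4) := by gcongr
  rw [h1]; linarith [h2.1]

lemma ball_half_direction_subset {x : EuclideanSpace ℝ (Fin N)} (hx : x ≠ 0) :
    ball ((2 * ‖x‖)⁻¹ • x) (1 / 4) ⊆ ball 0 1 := by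
  apply ball_subset_ball'
  have hx' := norm_pos_iff.2 hx
  rw [dist_zero_right, norm_smul, norm_inv, norm_mul, norm_norm, Real.norm_ofNat]
  have : (2 * ‖x‖)⁻¹ * ‖x‖ = 1 / 2 := by field_simp
  rw [this]; norm_num

/-- A function touched from below, up to an error `τ`, by a steep Gaussian away from the origin
has a definite operator value there. -/
lemma gaussian_touching_le {Λ α β γ ε f τ : ℝ} (hΛ : 1 ≤ Λ) (hβ : 0 < β) (hα : 0 ≤ α)
    (hαβ : α = 1 - β) (hγ : γ = 256 * 4 ^ N * (Λ ^ 2 + 1) / β) (hε : 0 < ε)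
    (hγε : γ * ε ^ 2 ≤ 1 / 2) {u : EuclideanSpace ℝ (Fin N) → ℝ} (hm : Measurable u) {K : ℝ}
    (hK : ∀ x, |u x| ≤ K) {x₁ : EuclideanSpace ℝ (Fin N)} (hL : Lminus Λ α β ε u x₁ ≤ f)
    (hnorm2 : 1 / 4 ≤ ‖x₁‖)
    (hdd : ∀ v, ddiff (fun y => Real.exp (-γ * ‖y‖ ^ 2)) x₁ v - 2 * τ ≤ ddiff u x₁ v) :
    2 * ε ^ 2 * (Real.exp (-γ * ‖x₁‖ ^ 2) * γ) ≤ 2 * ε ^ 2 * f + 2 * τ := by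
  have hβ1 : β ≤ 1 := by linarith
  have hγ0 : 0 < γ := by rw [hγ]; positivity
  have hx₁0 : x₁ ≠ 0 := by
    rintro rfl; simp at hnorm2; linarith
  set E : ℝ := Real.exp (-γ * ‖x₁‖ ^ 2) with hE
  have hE0 : 0 < E := Real.exp_pos _
  have hnε : ∀ z : EuclideanSpace ℝ (Fin N), ‖ε • z‖ ^ 2 = ε ^ 2 * ‖z‖ ^ 2 := by
    intro z; rw [norm_smul, mul_pow, Real.norm_of_nonneg hε.le]
  have h1 := mul_setAverage_ddiff_le (by linarith) hα hε (hL)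
    (b := 2 * E * (γ * (ε ^ 2 * Λ ^ 2)) + 2 * τ) (by
      intro z hz
      have h2 := neg_le_ddiff_gaussian (γ := γ) x₁ (ε • z)
      rw [hnε] at h2
      have hz' : ‖z‖ ^ 2 ≤ Λ ^ 2 := by
        rw [mem_ball_zero_iff] at hz
        gcongr
      have h3 : 2 * E * (γ * (ε ^ 2 * ‖z‖ ^ 2)) ≤ 2 * E * (γ * (ε ^ 2 * Λ ^ 2)) := by
        gcongr
      have := hdd (ε • z)
      linarith)
  have hlow : ∀ w ∈ ball (0 : EuclideanSpace ℝ (Fin N)) 1,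
      2 * E * (-(γ * ε ^ 2) + γ ^ 2 * (ε ^ 2 * inner ℝ x₁ w ^ 2)) - 2 * τ
        ≤ ddiff u x₁ (ε • w) := by
    intro w hw
    rw [mem_ball_zero_iff] at hw
    have hw2 : ‖w‖ ^ 2 ≤ 1 := by nlinarith [norm_nonneg w]
    have hw3 : γ * ‖ε • w‖ ^ 2 ≤ γ * ε ^ 2 := by
      rw [hnε]
      have : ε ^ 2 * ‖w‖ ^ 2 ≤ ε ^ 2 * 1 := by gcongr
      nlinarith
    have h2 := le_ddiff_gaussian (x := x₁) (hw3.trans hγε)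
    rw [real_inner_smul_right, mul_pow] at h2
    have h3 : 2 * E * (-(γ * ε ^ 2) + γ ^ 2 * (ε ^ 2 * inner ℝ x₁ w ^ 2)) ≤
      2 * E * (-(γ * ‖ε • w‖ ^ 2) + γ ^ 2 * (ε ^ 2 * inner ℝ x₁ w ^ 2)) := by gcongr
    have := hdd (ε • w)
    linarith
  have h2 := mul_volume_le_of_le_setAverage (integrableOn_ddiff (integrableOn_comp_affine hm hK x₁ ε))
    (A := ball ((2 * ‖x₁‖)⁻¹ • x₁) (1 / 4)) measurableSet_ball (ball_half_direction_subset hx₁0)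
    (b := 2 * E * (γ * ε ^ 2) + 2 * τ) (l := 2 * E * γ ^ 2 * ε ^ 2 / 256)
    (by
      intro w hw
      have h3 := hlow w hw
      have : 0 ≤ 2 * E * (γ ^ 2 * (ε ^ 2 * inner ℝ x₁ w ^ 2)) := by positivity
      linarith)
    (by
      intro w hw
      have h3 := hlow w (ball_half_direction_subset hx₁0 hw)
      have h4 := inner_ge_of_mem_ball hx₁0 hw
      have h5 : (1 / 16 : ℝ) ^ 2 ≤ inner ℝ x₁ w ^ 2 := by
        apply pow_le_pow_left₀ (by norm_num); linarith
      have : 2 * E * (γ ^ 2 * (ε ^ 2 * (1 / 16) ^ 2)) ≤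
        2 * E * (γ ^ 2 * (ε ^ 2 * inner ℝ x₁ w ^ 2)) := by gcongr
      linarith)
  rw [volume_real_ball _ (by norm_num)] at h2
  have hω := unitVol_pos N
  set D := ⨍ w in ball (0 : EuclideanSpace ℝ (Fin N)) 1, ddiff u x₁ (ε • w) with hD
  have h3 : 2 * E * γ ^ 2 * ε ^ 2 / 256 * (1 / 4) ^ N ≤ D + (2 * E * (γ * ε ^ 2) + 2 * τ) := by
    have : 2 * E * γ ^ 2 * ε ^ 2 / 256 * (1 / 4) ^ N * unitVol N
        ≤ (D + (2 * E * (γ * ε ^ 2) + 2 * τ)) * unitVol N := by linarith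
    exact le_of_mul_le_mul_right this hω
  have h4 : β * (2 * E * γ ^ 2 * ε ^ 2 / 256 * (1 / 4) ^ N)
      = 2 * E * γ * ε ^ 2 * (Λ ^ 2 + 1) := by
    have : β * γ = 256 * 4 ^ N * (Λ ^ 2 + 1) := by rw [hγ]; field_simp
    calc _ = 2 * E * γ * ε ^ 2 / 256 * (1 / 4) ^ N * (β * γ) := by ring
      _ = 2 * E * γ * ε ^ 2 * (Λ ^ 2 + 1) * ((1 / 4) ^ N * 4 ^ N) := by rw [this]; ring
      _ = _ := by rw [← mul_pow]; norm_num
  have h5 := mul_le_mul_of_nonneg_left h3 hβ.le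
  rw [h4] at h5
  have h7 : α * Λ ^ 2 + β ≤ Λ ^ 2 := by
    subst hαβ
    linarith [mul_nonneg hβ.le (sub_nonneg.2 (one_le_pow₀ hΛ : 1 ≤ Λ ^ 2))]
  have h8 : 2 * E * γ * ε ^ 2 * (α * Λ ^ 2 + β) ≤ 2 * E * γ * ε ^ 2 * Λ ^ 2 := by gcongr
  subst hαβ
  linear_combination h5 + h1 + h8

/-- Positivity in a small ball propagates to a larger region, by comparison with a Gaussian. -/
lemma exists_lower_bound_of_one_le_ball (N : ℕ) {Λ α β : ℝ} (hΛ : 1 ≤ Λ) (hβ : 0 < β)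
    (hα : 0 ≤ α) (hαβ : α = 1 - β) (hN : 1 ≤ N) :
    ∃ ε₁ c ρ : ℝ, 0 < ε₁ ∧ 0 < c ∧ 0 < ρ ∧ ∀ ε, 0 < ε → ε < ε₁ →
      ∀ u : EuclideanSpace ℝ (Fin N) → ℝ, Measurable u → (∃ K, ∀ x, |u x| ≤ K) →
      (∀ x ∈ ball (0 : EuclideanSpace ℝ (Fin N)) (5 * Real.sqrt N), Lminus Λ α β ε u x ≤ ρ) →
      (∀ x, 0 ≤ u x) → (∀ x ∈ ball (0 : EuclideanSpace ℝ (Fin N)) (1 / 4), 1 ≤ u x) →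
      ∀ x, (∀ i, |x i| ≤ 3 / 2) → c ≤ u x := by
  set γ : ℝ := 256 * 4 ^ N * (Λ ^ 2 + 1) / β with hγ
  have hβ1 : β ≤ 1 := by linarith
  have hγ1 : 1 ≤ γ := by
    rw [hγ, le_div_iff₀ hβ]
    have h4 : (1 : ℝ) ≤ 4 ^ N := one_le_pow₀ (by norm_num)
    nlinarith [mul_nonneg (sub_nonneg.2 h4) (sq_nonneg Λ), sq_nonneg Λ]
  have hγ0 : 0 < γ := by linarith
  have hN' : (1 : ℝ) ≤ N := by exact_mod_cast hN
  set e : ℝ := Real.exp (-γ * (25 * N)) with he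
  have he0 : 0 < e := Real.exp_pos _
  refine ⟨1 / (2 * γ), Real.exp (-γ * (9 / 4 * N)) - e, e * γ / 2, by positivity, ?_, by positivity,
    ?_⟩
  · rw [sub_pos, he, Real.exp_lt_exp]
    nlinarith
  intro ε hε hε1 u hm ⟨K, hK⟩ hL hu hu1 x hx
  by_contra! hcon
  have hγε : γ * ε ^ 2 ≤ 1 / 2 := by
    rw [lt_div_iff₀ (by positivity)] at hε1
    nlinarith
  set φ : EuclideanSpace ℝ (Fin N) → ℝ := fun y => Real.exp (-γ * ‖y‖ ^ 2) with hφ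
  have hφ1 : ∀ y, φ y ≤ 1 := fun y => Real.exp_le_one_iff.2 (by nlinarith [sq_nonneg ‖y‖])
  have hbdd : BddBelow (Set.range fun y => u y - φ y) := by
    refine ⟨-1, ?_⟩
    rintro _ ⟨y, rfl⟩
    linarith [hu y, hφ1 y]
  set I : ℝ := ⨅ y, (u y - φ y) with hI
  have hIle : ∀ y, I ≤ u y - φ y := fun y => ciInf_le hbdd y
  have hxφ : Real.exp (-γ * (9 / 4 * N)) ≤ φ x := by
    rw [hφ, Real.exp_le_exp, EuclideanSpace.real_norm_sq_eq]
    have : ∑ i, x i ^ 2 ≤ ∑ _i : Fin N, (9 / 4 : ℝ) := by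
      apply Finset.sum_le_sum
      intro i _
      have := sq_le_sq' (by linarith [(abs_le.1 (hx i)).1] : -(3 / 2) ≤ x i) (abs_le.1 (hx i)).2
      linarith
    rw [Finset.sum_const, Finset.card_univ, Fintype.card_fin, nsmul_eq_mul] at this
    nlinarith
  have hIneg : I < -e := by
    linarith [hIle x]
  set τ : ℝ := ε ^ 2 * (e * γ / 2) with hτ
  have hτ0 : 0 < τ := by positivity
  obtain ⟨x₁, hx₁⟩ := exists_lt_of_ciInf_lt (show (⨅ y, (u y - φ y)) < min (-e) (I + τ) from
    lt_min hIneg (by linarith))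
  obtain ⟨hx₁a, hx₁b⟩ := lt_min_iff.1 hx₁
  set E : ℝ := φ x₁ with hE
  have hEe : e < E := by linarith [hu x₁]
  have hnorm : ‖x₁‖ ^ 2 < 25 * N := by
    rw [hE, hφ, he, Real.exp_lt_exp] at hEe
    nlinarith
  have hnorm2 : 1 / 4 ≤ ‖x₁‖ := by
    by_contra! h
    have := hu1 x₁ (by simpa using h)
    linarith [hφ1 x₁]
  have hmem : x₁ ∈ ball (0 : EuclideanSpace ℝ (Fin N)) (5 * Real.sqrt N) := by
    rw [mem_ball_zero_iff]
    apply lt_of_pow_lt_pow_left₀ 2 (by positivity)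
    rw [mul_pow, Real.sq_sqrt (by positivity)]; linarith
  have hdd : ∀ v, ddiff φ x₁ v - 2 * τ ≤ ddiff u x₁ v := by
    intro v
    unfold ddiff
    linarith [hIle (x₁ + v), hIle (x₁ - v)]
  have h1 := gaussian_touching_le hΛ hβ hα hαβ hγ hε hγε hm hK (hL x₁ hmem) hnorm2 hdd
  have h2 : 2 * ε ^ 2 * (e * γ) < 2 * ε ^ 2 * (E * γ) := by gcongr
  linarith

/-- The point `x₁` nearly minimizes `u + ‖· - y‖² / 2`, up to an error `ε²`, and `I` is a lower
bound of this function. -/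
def IsContact (u : EuclideanSpace ℝ (Fin N) → ℝ) (ε : ℝ) (y : EuclideanSpace ℝ (Fin N)) (I : ℝ)
    (x₁ : EuclideanSpace ℝ (Fin N)) : Prop :=
  (∀ x, I ≤ u x + ‖x - y‖ ^ 2 / 2) ∧ u x₁ + ‖x₁ - y‖ ^ 2 / 2 ≤ I + ε ^ 2

lemma exists_isContact {u : EuclideanSpace ℝ (Fin N) → ℝ} (hu : ∀ x, 0 ≤ u x) {ε : ℝ}
    (hε : 0 < ε) (y : EuclideanSpace ℝ (Fin N)) : ∃ I x₁, IsContact u ε y I x₁ := by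
  have hbdd : BddBelow (Set.range fun x => u x + ‖x - y‖ ^ 2 / 2) := by
    refine ⟨0, ?_⟩
    rintro _ ⟨x, rfl⟩
    have := hu x
    positivity
  obtain ⟨x₁, hx₁⟩ := exists_lt_of_ciInf_lt (show (⨅ x, (u x + ‖x - y‖ ^ 2 / 2)) <
    (⨅ x, (u x + ‖x - y‖ ^ 2 / 2)) + ε ^ 2 from lt_add_of_pos_right _ (by positivity))
  exact ⟨_, x₁, fun x => ciInf_le hbdd x, hx₁.le⟩

lemma norm_add_sq_add_norm_sub_sq (a v : EuclideanSpace ℝ (Fin N)) :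
    ‖a + v‖ ^ 2 + ‖a - v‖ ^ 2 = 2 * ‖a‖ ^ 2 + 2 * ‖v‖ ^ 2 := by
  rw [norm_add_sq_real, norm_sub_sq_real]; ring

/-- Chebyshev estimate for the height of `u` above a touching paraboloid. -/
lemma IsContact.mul_volume_le {Λ α β ε : ℝ} (hΛ : 1 ≤ Λ) (hβ : 0 < β) (hα : 0 ≤ α)
    (hαβ : α = 1 - β) (hε : 0 < ε) {u : EuclideanSpace ℝ (Fin N) → ℝ} (hm : Measurable u) {K : ℝ}
    (hK : ∀ x, |u x| ≤ K) {y x₁ : EuclideanSpace ℝ (Fin N)} {I : ℝ}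
    (hc : IsContact u ε y I x₁) (hL : Lminus Λ α β ε u x₁ ≤ 1)
    {A : Set (EuclideanSpace ℝ (Fin N))} (hA : MeasurableSet A) (hAB : A ⊆ ball x₁ ε) {l : ℝ}
    (hl : ∀ x ∈ A, l ≤ u x + ‖x - y‖ ^ 2 / 2 - I) :
    l * volume.real A ≤ ε ^ N * unitVol N * ((Λ ^ 2 + 7) / (2 * β) * ε ^ 2) := by
  obtain ⟨hI, hx₁⟩ := hc
  have hω := unitVol_pos N
  have hnε : ∀ z : EuclideanSpace ℝ (Fin N), ‖ε • z‖ ^ 2 = ε ^ 2 * ‖z‖ ^ 2 := by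
    intro z; rw [norm_smul, mul_pow, Real.norm_of_nonneg hε.le]
  have hpar : ∀ v, ‖x₁ + v - y‖ ^ 2 + ‖x₁ - v - y‖ ^ 2 = 2 * ‖x₁ - y‖ ^ 2 + 2 * ‖v‖ ^ 2 := by
    intro v
    rw [← norm_add_sq_add_norm_sub_sq]
    congr 3 <;> abel
  have hdd : ∀ v, -(‖v‖ ^ 2 + 2 * ε ^ 2) ≤ ddiff u x₁ v := by
    intro v
    unfold ddiff
    linarith [hI (x₁ + v), hI (x₁ - v), hpar v]
  have h1 := mul_setAverage_ddiff_le (by linarith) hα hε hL (b := ε ^ 2 * Λ ^ 2 + 2 * ε ^ 2) (by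
    intro z hz
    have hz' : ‖z‖ ^ 2 ≤ Λ ^ 2 := by
      rw [mem_ball_zero_iff] at hz
      gcongr
    have h2 := hdd (ε • z)
    rw [hnε] at h2
    have : ε ^ 2 * ‖z‖ ^ 2 ≤ ε ^ 2 * Λ ^ 2 := by gcongr
    linarith)
  set G : EuclideanSpace ℝ (Fin N) → ℝ := fun x => u x + ‖x - y‖ ^ 2 / 2 - I with hG
  have hIu := integrableOn_comp_affine hm hK x₁ ε
  have hIG : IntegrableOn (fun w => G (x₁ + ε • w)) (ball 0 1) := by
    have hcont : Continuous fun w : EuclideanSpace ℝ (Fin N) =>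
        ‖x₁ + ε • w - y‖ ^ 2 / 2 - I := by fun_prop
    have h2 : IntegrableOn (fun w : EuclideanSpace ℝ (Fin N) =>
        ‖x₁ + ε • w - y‖ ^ 2 / 2 - I) (ball 0 1) :=
      (hcont.continuousOn.integrableOn_compact (isCompact_closedBall 0 1)).mono_set
        ball_subset_closedBall
    have h3 := hIu.add h2
    refine h3.congr_fun (fun w _ => ?_) measurableSet_ball
    simp only [Pi.add_apply, hG]; ring
  have h2 := mul_volume_le_setAverage_comp_affine hε hIG (fun x => sub_nonneg.2 (hI x)) hA hAB hl
  refine h2.trans (mul_le_mul_of_nonneg_left ?_ (by positivity))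
  have h3 := setAverage_ddiff hIG
  have h4 : ⨍ w in ball (0 : EuclideanSpace ℝ (Fin N)) 1, ddiff G x₁ (ε • w)
      ≤ (⨍ w in ball (0 : EuclideanSpace ℝ (Fin N)) 1, ddiff u x₁ (ε • w)) + ε ^ 2 := by
    have hc : IntegrableOn (fun _ : EuclideanSpace ℝ (Fin N) => ε ^ 2) (ball 0 1) :=
      integrableOn_const measure_ball_lt_top.ne
    have h5 : ∫ w in ball (0 : EuclideanSpace ℝ (Fin N)) 1, ddiff G x₁ (ε • w)
        ≤ ∫ w in ball (0 : EuclideanSpace ℝ (Fin N)) 1, (ddiff u x₁ (ε • w) + ε ^ 2) := by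
      apply setIntegral_mono_on (integrableOn_ddiff hIG) ((integrableOn_ddiff hIu).add hc)
        measurableSet_ball
      intro w hw
      rw [mem_ball_zero_iff] at hw
      have hw2 : ‖w‖ ^ 2 ≤ 1 := by nlinarith [norm_nonneg w]
      have h6 := hpar (ε • w)
      rw [hnε] at h6
      have : ε ^ 2 * ‖w‖ ^ 2 ≤ ε ^ 2 * 1 := by gcongr
      simp only [hG, ddiff, Pi.add_apply]
      linarith
    rw [integral_add (integrableOn_ddiff hIu) hc, setIntegral_const, smul_eq_mul, ← unitVol] at h5
    rw [setAverage_unitBall, setAverage_unitBall]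
    calc _ ≤ (unitVol N)⁻¹ * (_ + unitVol N * ε ^ 2) := by gcongr
      _ = _ := by field_simp
  rw [h3] at h4
  set D := ⨍ w in ball (0 : EuclideanSpace ℝ (Fin N)) 1, ddiff u x₁ (ε • w)
  have h5 : G x₁ ≤ ε ^ 2 := by simp only [hG]; linarith
  rw [div_mul_eq_mul_div, le_div_iff₀ (by positivity)]
  set M := ⨍ w in ball (0 : EuclideanSpace ℝ (Fin N)) 1, G (x₁ + ε • w)
  have h6 : 2 * M ≤ D + 3 * ε ^ 2 := by linarith
  have h7 := mul_le_mul_of_nonneg_left h6 hβ.le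
  have h8 : α * (ε ^ 2 * Λ ^ 2 + 2 * ε ^ 2) ≤ 1 * (ε ^ 2 * Λ ^ 2 + 2 * ε ^ 2) := by
    gcongr; linarith
  have h9 : β * (3 * ε ^ 2) ≤ 1 * (3 * ε ^ 2) := by
    gcongr; linarith
  linarith

lemma IsContact.norm_sub_le {Λ α β ε : ℝ} (hΛ : 1 ≤ Λ) (hβ : 0 < β) (hα : 0 ≤ α)
    (hαβ : α = 1 - β) (hε : 0 < ε) {u : EuclideanSpace ℝ (Fin N) → ℝ} (hm : Measurable u) {K : ℝ}
    (hK : ∀ x, |u x| ≤ K) {y x₁ y' p : EuclideanSpace ℝ (Fin N)} {I I' : ℝ}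
    (hc : IsContact u ε y I x₁) (hL : Lminus Λ α β ε u x₁ ≤ 1)
    (hI' : ∀ x, I' ≤ u x + ‖x - y'‖ ^ 2 / 2) (hp : dist p x₁ < ε / 2)
    (h : ‖p - y'‖ ^ 2 / 2 - I' ≤ ‖p - y‖ ^ 2 / 2 - I) :
    ‖y - y'‖ ≤ 8 ^ (N + 1) * ((Λ ^ 2 + 7) / (2 * β)) * ε := by
  rcases eq_or_ne y y' with rfl | hne
  · rw [sub_self, norm_zero]; positivity
  have hω := unitVol_pos N
  set v := y' - y with hv
  have hv0 : 0 < ‖v‖ := norm_pos_iff.2 (sub_ne_zero.2 hne.symm)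
  have h1 := hc.mul_volume_le hΛ hβ hα hαβ hε hm hK hL
    (A := ball (p + (ε / 4 * ‖v‖⁻¹) • v) (ε / 8)) measurableSet_ball ?_ (l := ‖v‖ * (ε / 8)) ?_
  · rw [volume_real_ball _ (by positivity), div_pow] at h1
    rw [norm_sub_rev]
    have h2 : ‖v‖ * (ε / 8) * (ε ^ N / 8 ^ N * unitVol N)
        = (ε ^ N * unitVol N * ε / 8 ^ (N + 1)) * ‖v‖ := by
      field_simp
      ring
    have h3 : ε ^ N * unitVol N * ((Λ ^ 2 + 7) / (2 * β) * ε ^ 2)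
        = (ε ^ N * unitVol N * ε / 8 ^ (N + 1)) *
          (8 ^ (N + 1) * ((Λ ^ 2 + 7) / (2 * β)) * ε) := by
      field_simp
    rw [h2, h3] at h1
    exact le_of_mul_le_mul_left h1 (by positivity)
  · apply ball_subset_ball'
    have h2 : dist (p + (ε / 4 * ‖v‖⁻¹) • v) p = ε / 4 := by
      rw [dist_eq_norm, add_sub_cancel_left, norm_smul, norm_mul, norm_inv, norm_norm,
        Real.norm_of_nonneg (by positivity)]
      field_simp
    linarith [dist_triangle (p + (ε / 4 * ‖v‖⁻¹) • v) p x₁]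
  · intro x hx
    rw [mem_ball, dist_eq_norm] at hx
    set q := x - (p + (ε / 4 * ‖v‖⁻¹) • v) with hq
    have hxq : x = p + (q + (ε / 4 * ‖v‖⁻¹) • v) := by rw [hq]; abel
    have h2 : ‖x - y‖ ^ 2 - ‖x - y'‖ ^ 2
        = ‖p - y‖ ^ 2 - ‖p - y'‖ ^ 2 + 2 * inner ℝ (q + (ε / 4 * ‖v‖⁻¹) • v) v := by
      have ha : x - y = (p - y) + (q + (ε / 4 * ‖v‖⁻¹) • v) := by
        nth_rewrite 1 [hxq]; abel
      have hb : x - y' = (p - y') + (q + (ε / 4 * ‖v‖⁻¹) • v) := by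
        nth_rewrite 1 [hxq]; abel
      have hd : inner ℝ (q + (ε / 4 * ‖v‖⁻¹) • v) v
          = inner ℝ (p - y) (q + (ε / 4 * ‖v‖⁻¹) • v)
            - inner ℝ (p - y') (q + (ε / 4 * ‖v‖⁻¹) • v) := by
        rw [← inner_sub_left, real_inner_comm]
        congr 1
        rw [hv]; abel
      rw [ha, hb, norm_add_sq_real (p - y), norm_add_sq_real (p - y'), hd]; ring
    have h3 : inner ℝ (q + (ε / 4 * ‖v‖⁻¹) • v) v = inner ℝ q v + ε / 4 * ‖v‖ := by
      rw [inner_add_left, real_inner_smul_left, real_inner_self_eq_norm_sq]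
      field_simp
    have h4 := (abs_le.1 (abs_real_inner_le_norm q v)).1
    have h5 : ‖q‖ * ‖v‖ ≤ ε / 8 * ‖v‖ := by gcongr
    have h6 := hI' x
    rw [h3] at h2
    linarith

lemma norm_grid_le {n : ℕ} {σ r : ℝ} (hσ : 0 < σ) (hr : 0 ≤ r) (hN : 1 ≤ N)
    (hn : n = ⌈r / (σ * Real.sqrt N)⌉₊) (k : Fin N → Fin n) :
    ‖σ • WithLp.toLp 2 (fun i => ((k i : ℕ) : ℝ))‖ ≤ r := by
  have hN' : (0 : ℝ) < N := by exact_mod_cast hN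
  have hs : 0 < Real.sqrt N := Real.sqrt_pos.2 hN'
  apply le_of_sq_le_sq _ hr
  rw [EuclideanSpace.real_norm_sq_eq]
  have h1 : ∀ i : Fin N, (σ • WithLp.toLp 2 (fun i => ((k i : ℕ) : ℝ))) i ^ 2 ≤ r ^ 2 / N := by
    intro i
    have h2 : ((k i : ℕ) : ℝ) < r / (σ * Real.sqrt N) := Nat.lt_ceil.1 ((k i).2.trans_eq hn)
    rw [lt_div_iff₀ (by positivity)] at h2
    rw [le_div_iff₀ hN', PiLp.smul_apply, smul_eq_mul]
    calc (σ * ((k i : ℕ) : ℝ)) ^ 2 * N = (((k i : ℕ) : ℝ) * (σ * Real.sqrt N)) ^ 2 := by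
          rw [mul_pow, mul_pow, mul_pow, Real.sq_sqrt hN'.le]; ring
      _ ≤ r ^ 2 := by gcongr
  calc _ ≤ ∑ _i : Fin N, r ^ 2 / N := Finset.sum_le_sum fun i _ => h1 i
    _ = r ^ 2 := by
      rw [Finset.sum_const, Finset.card_univ, Fintype.card_fin, nsmul_eq_mul]; field_simp

lemma le_norm_grid_sub {n : ℕ} {σ : ℝ} (hσ : 0 < σ) {k k' : Fin N → Fin n} (hk : k ≠ k') :
    σ ≤ ‖σ • WithLp.toLp 2 (fun i => ((k i : ℕ) : ℝ)) -
      σ • WithLp.toLp 2 (fun i => ((k' i : ℕ) : ℝ))‖ := by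
  obtain ⟨i, hi⟩ := Function.ne_iff.1 hk
  refine le_trans ?_ (PiLp.norm_apply_le _ i)
  have h1 : (1 : ℝ) ≤ |((k i : ℕ) : ℝ) - ((k' i : ℕ) : ℝ)| := by
    have h2 : ((k i : ℕ) : ℤ) - ((k' i : ℕ) : ℤ) ≠ 0 := by
      intro h
      apply hi
      ext
      omega
    exact_mod_cast Int.one_le_abs h2
  rw [PiLp.sub_apply, PiLp.smul_apply, PiLp.smul_apply, smul_eq_mul, smul_eq_mul, ← mul_sub,
    norm_mul, Real.norm_of_nonneg hσ.le, Real.norm_eq_abs]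
  nlinarith

/-- If `u` is small at some point near the origin, then `{u < 1}` has measure bounded below. -/
lemma exists_measure_lower_bound (N : ℕ) {Λ α β : ℝ} (hΛ : 1 ≤ Λ) (hβ : 0 < β)
    (hα : 0 ≤ α) (hαβ : α = 1 - β) (hN : 1 ≤ N) :
    ∃ ε₁ m μ : ℝ, 0 < ε₁ ∧ 0 < m ∧ 0 < μ ∧ ∀ ε, 0 < ε → ε < ε₁ →
      ∀ u : EuclideanSpace ℝ (Fin N) → ℝ, Measurable u → (∃ K, ∀ x, |u x| ≤ K) →
      (∀ x ∈ ball (0 : EuclideanSpace ℝ (Fin N)) (1 / 2), Lminus Λ α β ε u x ≤ 1) →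
      (∀ x, 0 ≤ u x) → ∀ x₀ ∈ ball (0 : EuclideanSpace ℝ (Fin N)) (1 / 4), u x₀ < m →
      μ ≤ volume.real (ball (0 : EuclideanSpace ℝ (Fin N)) (1 / 2) ∩ {x | u x < 1}) := by
  have hω := unitVol_pos N
  have hN' : (0 : ℝ) < N := by exact_mod_cast hN
  have hs : 0 < Real.sqrt N := Real.sqrt_pos.2 hN'
  set C : ℝ := (Λ ^ 2 + 7) / (2 * β) with hC
  have hC0 : 0 < C := by positivity
  set C₂ : ℝ := 8 ^ (N + 1) * C with hC₂
  have hC₂0 : 0 < C₂ := by positivity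
  refine ⟨min (1 / 64) (1 / (4 ^ (N + 1) * C)), 1 / 4096,
    unitVol N / 2 * (1 / 32 / (8 * C₂ * Real.sqrt N)) ^ N, by positivity, by norm_num,
    by positivity, ?_⟩
  intro ε hε hε1 u hm ⟨K, hK⟩ hL hu x₀ hx₀ hux₀
  obtain ⟨hε64, hεC⟩ := lt_min_iff.1 hε1
  have hεsq : ε ^ 2 ≤ 1 / 4096 := by nlinarith
  have hεC2 : 4 ^ (N + 1) * C * ε ^ 2 ≤ 1 := by
    rw [lt_div_iff₀ (by positivity)] at hεC
    have h1 : ε * (4 ^ (N + 1) * C) * ε ≤ 1 * 1 := by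
      gcongr; linarith
    linarith
  set σ : ℝ := 2 * C₂ * ε with hσ
  have hσ0 : 0 < σ := by positivity
  obtain ⟨n, hn⟩ : ∃ n, n = ⌈(1 / 32 : ℝ) / (σ * Real.sqrt N)⌉₊ := ⟨_, rfl⟩
  set y : (Fin N → Fin n) → EuclideanSpace ℝ (Fin N) := fun k =>
    x₀ + σ • WithLp.toLp 2 (fun i => ((k i : ℕ) : ℝ)) with hy
  choose I X hX using fun k => exists_isContact hu hε (y k)
  have hyx : ∀ k, ‖x₀ - y k‖ ≤ 1 / 32 := by
    intro k
    rw [norm_sub_rev, hy]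
    simp only [add_sub_cancel_left]
    exact norm_grid_le hσ0 (by norm_num) hN hn k
  have hIk : ∀ k, I k ≤ 3 / 4096 := by
    intro k
    have h1 := (hX k).1 x₀
    have h2 : ‖x₀ - y k‖ ^ 2 ≤ (1 / 32) ^ 2 := by
      have := hyx k
      gcongr
    linarith
  have hXy : ∀ k, ‖X k - y k‖ ≤ 1 / 16 := by
    intro k
    have h1 := (hX k).2
    have h2 := hu (X k)
    have h3 := hIk k
    apply le_of_sq_le_sq _ (by norm_num)
    linarith
  have hX0 : ∀ k, ‖X k‖ < 11 / 32 := by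
    intro k
    rw [mem_ball_zero_iff] at hx₀
    have h1 := hXy k
    have h2 := hyx k
    have h3 : X k = (X k - y k) + x₀ - (x₀ - y k) := by abel
    calc ‖X k‖ = ‖(X k - y k) + x₀ - (x₀ - y k)‖ := by rw [← h3]
      _ ≤ ‖X k - y k‖ + ‖x₀‖ + ‖x₀ - y k‖ :=
        (norm_sub_le _ _).trans (add_le_add_left (norm_add_le _ _) _)
      _ < _ := by linarith
  have hLX : ∀ k, Lminus Λ α β ε u (X k) ≤ 1 := fun k => hL _ (by
    rw [mem_ball_zero_iff]; linarith [hX0 k])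
  have hsep : ∀ k k', k ≠ k' → ε / 2 ≤ dist (X k) (X k') := by
    intro k k' hkk
    by_contra! hd
    have h1 : σ ≤ ‖y k - y k'‖ := by
      rw [hy]; simp only [add_sub_add_left_eq_sub]
      exact le_norm_grid_sub hσ0 hkk
    have h2 : ‖y k - y k'‖ ≤ C₂ * ε := by
      rcases le_total (‖X k - y k'‖ ^ 2 / 2 - I k') (‖X k - y k‖ ^ 2 / 2 - I k) with h | h
      · exact (hX k).norm_sub_le hΛ hβ hα hαβ hε hm hK (hLX k) (hX k').1
          (by rw [dist_self]; positivity) h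
      · rw [norm_sub_rev]
        exact (hX k').norm_sub_le hΛ hβ hα hαβ hε hm hK (hLX k') (hX k).1 hd h
    have : 0 < C₂ * ε := by positivity
    linarith
  have hmeas : MeasurableSet {x | u x < 1} := measurableSet_lt hm measurable_const
  have hdisj : Pairwise (Function.onFun Disjoint fun k => ball (X k) (ε / 4) ∩ {x | u x < 1}) := by
    intro k k' hkk
    refine (ball_disjoint_ball ?_).mono Set.inter_subset_left Set.inter_subset_left
    linarith [hsep k k' hkk]
  have hsub : (⋃ k, ball (X k) (ε / 4) ∩ {x | u x < 1}) ⊆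
      ball (0 : EuclideanSpace ℝ (Fin N)) (1 / 2) ∩ {x | u x < 1} := by
    apply Set.iUnion_subset
    intro k
    apply Set.inter_subset_inter_left
    apply ball_subset_ball'
    rw [dist_zero_right]
    linarith [hX0 k]
  have hball : ∀ k, unitVol N / 2 * (ε / 4) ^ N ≤
      volume.real (ball (X k) (ε / 4) ∩ {x | u x < 1}) := by
    intro k
    have h1 := (hX k).mul_volume_le hΛ hβ hα hαβ hε hm hK (hLX k)
      (A := ball (X k) (ε / 4) \ {x | u x < 1}) (measurableSet_ball.diff hmeas)
      (Set.sdiff_subset.trans (ball_subset_ball (by linarith))) (l := 1 / 2) (by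
        intro x hx
        have h2 : 1 ≤ u x := not_lt.1 hx.2
        have h3 := hIk k
        have : 0 ≤ ‖x - y k‖ ^ 2 / 2 := by positivity
        linarith)
    have h2 := measureReal_inter_add_sdiff (μ := volume) (s := ball (X k) (ε / 4)) hmeas
      measure_ball_lt_top.ne
    rw [volume_real_ball _ (by positivity)] at h2
    have h3 : ε ^ N * unitVol N * (C * ε ^ 2)
        = (ε / 4) ^ N * unitVol N / 4 * (4 ^ (N + 1) * C * ε ^ 2) := by
      rw [div_pow]; field_simp; ring
    have h4 : (ε / 4) ^ N * unitVol N / 4 * (4 ^ (N + 1) * C * ε ^ 2)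
        ≤ (ε / 4) ^ N * unitVol N / 4 * 1 := by gcongr
    linarith
  calc unitVol N / 2 * (1 / 32 / (8 * C₂ * Real.sqrt N)) ^ N
      = (1 / 32 / (σ * Real.sqrt N)) ^ N * (unitVol N / 2 * (ε / 4) ^ N) := by
        have h : 1 / 32 / (8 * C₂ * Real.sqrt N) = 1 / 32 / (σ * Real.sqrt N) * (ε / 4) := by
          rw [hσ]
          generalize C₂ = c at *
          field_simp
          ring
        rw [h, mul_pow]
        ring
    _ ≤ (n : ℝ) ^ N * (unitVol N / 2 * (ε / 4) ^ N) := by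
        have : (1 / 32 / (σ * Real.sqrt N)) ≤ n := by rw [hn]; exact Nat.le_ceil _
        gcongr
    _ = ∑ _k : Fin N → Fin n, (unitVol N / 2 * (ε / 4) ^ N) := by
        simp
    _ ≤ ∑ k, volume.real (ball (X k) (ε / 4) ∩ {x | u x < 1}) :=
        Finset.sum_le_sum fun k _ => hball k
    _ = volume.real (⋃ k, ball (X k) (ε / 4) ∩ {x | u x < 1}) :=
        (measureReal_iUnion_fintype hdisj (fun k => measurableSet_ball.inter hmeas)
          (fun k => (measure_mono Set.inter_subset_left).trans_lt measure_ball_lt_top |>.ne)).symm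
    _ ≤ _ := measureReal_mono hsub
        ((measure_mono Set.inter_subset_left).trans_lt measure_ball_lt_top).ne

open scoped Pointwise in
lemma Lminus_comp_affine (Λ α β ε : ℝ) (u : EuclideanSpace ℝ (Fin N) → ℝ)
    (z x : EuclideanSpace ℝ (Fin N)) {d t : ℝ} (hd : 0 < d) (ht : 0 < t) :
    Lminus Λ α β (ε / d) (fun y => t⁻¹ * u (z + d • y)) x
      = d ^ 2 / t * Lminus Λ α β ε u (z + d • x) := by
  have h : ∀ w, ddiff (fun y => t⁻¹ * u (z + d • y)) x ((ε / d) • w)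
      = t⁻¹ * ddiff u (z + d • x) (ε • w) := by
    intro w
    have h1 : d • (ε / d) • w = ε • w := by rw [smul_smul]; congr 1; field_simp
    simp only [ddiff, smul_add, smul_sub, h1, add_assoc, add_sub_assoc]
    ring
  have h2 : (fun w => t⁻¹ * ddiff u (z + d • x) (ε • w)) ''
      ball (0 : EuclideanSpace ℝ (Fin N)) Λ
      = t⁻¹ • ((fun w => ddiff u (z + d • x) (ε • w)) '' ball 0 Λ) := by
    rw [← Set.image_smul, Set.image_image]; rfl
  simp only [Lminus, h, h2]
  rw [Real.sInf_smul_of_nonneg (by positivity), smul_eq_mul, setAverage_unitBall,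
    setAverage_unitBall, integral_const_mul]
  field_simp

/-- A nonnegative supersolution that is at least one on most of the unit cube is bounded below on
the concentric cube of side length three. -/
lemma exists_lower_bound_of_measure_lt (N : ℕ) {Λ α β : ℝ} (hΛ : 1 ≤ Λ) (hβ : 0 < β)
    (hα : 0 ≤ α) (hαβ : α = 1 - β) (hN : 1 ≤ N) :
    ∃ ε₁ c ρ μ : ℝ, 0 < ε₁ ∧ 0 < c ∧ 0 < ρ ∧ 0 < μ ∧ ∀ ε, 0 < ε → ε < ε₁ →
      ∀ u : EuclideanSpace ℝ (Fin N) → ℝ, Measurable u → (∃ K, ∀ x, |u x| ≤ K) →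
      (∀ x ∈ ball (0 : EuclideanSpace ℝ (Fin N)) (5 * Real.sqrt N), Lminus Λ α β ε u x ≤ ρ) →
      (∀ x, 0 ≤ u x) →
      volume.real (cube (fun _ : Fin N => (0 : ℝ)) 1 ∩ {x | u x < 1}) < μ →
      ∀ x : EuclideanSpace ℝ (Fin N), (∀ i, |x i| ≤ 3 / 2) → c ≤ u x := by
  obtain ⟨ε₁, c, ρ, hε₁, hc, hρ, hB⟩ := exists_lower_bound_of_one_le_ball N hΛ hβ hα hαβ hN
  obtain ⟨ε₂, m, μ, hε₂, hm, hμ, hM⟩ := exists_measure_lower_bound N hΛ hβ hα hαβ hN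
  refine ⟨min ε₁ ε₂, m * c, min 1 (m * ρ), μ, by positivity, by positivity, by positivity, hμ, ?_⟩
  intro ε hε hε1 u hmu ⟨K, hK⟩ hL hu hvol x hx
  have hsN : 1 ≤ Real.sqrt N := Real.one_le_sqrt.2 (by exact_mod_cast hN)
  obtain ⟨h1, h2⟩ := lt_min_iff.1 hε1
  have hsub : ball (0 : EuclideanSpace ℝ (Fin N)) (1 / 2) ⊆ cube (fun _ : Fin N => (0 : ℝ)) 1 := by
    intro y hy i
    rw [mem_ball_zero_iff] at hy
    have := PiLp.norm_apply_le y i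
    rw [Real.norm_eq_abs] at this
    simp only [sub_zero]
    linarith
  have hfin : volume (cube (fun _ : Fin N => (0 : ℝ)) 1) ≠ ⊤ := by
    refine ((measure_mono ?_).trans_lt
      (measure_ball_lt_top (x := (0 : EuclideanSpace ℝ (Fin N))) (r := Real.sqrt N))).ne
    intro y hy
    rw [mem_ball_zero_iff, EuclideanSpace.norm_eq]
    apply Real.sqrt_lt_sqrt (by positivity)
    calc ∑ i, ‖y i‖ ^ 2 < ∑ _i : Fin N, (1 : ℝ) := by
          apply Finset.sum_lt_sum_of_nonempty (Finset.univ_nonempty_iff.2 ⟨⟨0, hN⟩⟩)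
          intro i _
          have := hy i
          simp only [sub_zero] at this
          rw [Real.norm_eq_abs]
          nlinarith [abs_nonneg (y i)]
      _ = N := by simp
  have hlow : ∀ x₀ ∈ ball (0 : EuclideanSpace ℝ (Fin N)) (1 / 4), m ≤ u x₀ := by
    intro x₀ hx₀
    by_contra! hcon
    have h3 := hM ε hε h2 u hmu ⟨K, hK⟩ (fun y hy => (hL y (ball_subset_ball (by linarith) hy)).trans
      (min_le_left _ _)) hu x₀ hx₀ hcon
    have h4 := measureReal_mono (μ := volume)
      (Set.inter_subset_inter_left {x | u x < 1} hsub)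
      ((measure_mono Set.inter_subset_left).trans_lt hfin.lt_top).ne
    linarith
  have hsc : ∀ y, Lminus Λ α β ε (fun y => m⁻¹ * u y) y = 1 / m * Lminus Λ α β ε u y := by
    intro y
    simpa using Lminus_comp_affine Λ α β ε u 0 y one_pos hm
  have h5 := hB ε hε h1 (fun y => m⁻¹ * u y) (hmu.const_mul _)
    ⟨m⁻¹ * K, fun y => by
      rw [abs_mul, abs_of_pos (inv_pos.2 hm)]
      exact mul_le_mul_of_nonneg_left (hK y) (inv_pos.2 hm).le⟩
    (fun y hy => by
      rw [hsc, one_div, inv_mul_le_iff₀ hm]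
      exact (hL y hy).trans (min_le_right _ _))
    (fun y => mul_nonneg (inv_pos.2 hm).le (hu y))
    (fun y hy => by
      rw [le_inv_mul_iff₀ hm, mul_one]
      exact hlow y hy) x hx
  rwa [le_inv_mul_iff₀ hm] at h5

/-- The half-open cube with lower corner `c` and side length `d`. -/
def hcube (c : Fin N → ℝ) (d : ℝ) : Set (EuclideanSpace ℝ (Fin N)) :=
  {x | ∀ i, c i ≤ x i ∧ x i < c i + d}

lemma hcube_eq_preimage (c : Fin N → ℝ) (d : ℝ) :
    hcube c d = WithLp.ofLp ⁻¹' (Set.univ.pi fun i => Set.Ico (c i) (c i + d)) := by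
  ext x; simp [hcube]

lemma measurableSet_hcube (c : Fin N → ℝ) (d : ℝ) : MeasurableSet (hcube c d) := by
  rw [hcube_eq_preimage]
  exact (PiLp.volume_preserving_ofLp (Fin N)).measurable
    (MeasurableSet.univ_pi fun _ => measurableSet_Ico)

lemma volume_hcube (c : Fin N → ℝ) (d : ℝ) : volume (hcube c d) = ENNReal.ofReal d ^ N := by
  rw [hcube_eq_preimage, (PiLp.volume_preserving_ofLp (Fin N)).measure_preimage
    (MeasurableSet.univ_pi fun _ => measurableSet_Ico).nullMeasurableSet, volume_pi_pi]
  simp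

lemma volume_hcube_ne_top (c : Fin N → ℝ) (d : ℝ) : volume (hcube c d) ≠ ⊤ := by
  rw [volume_hcube]; exact ENNReal.pow_ne_top ENNReal.ofReal_ne_top

lemma volume_real_hcube (c : Fin N → ℝ) {d : ℝ} (hd : 0 ≤ d) :
    volume.real (hcube c d) = d ^ N := by
  rw [Measure.real, volume_hcube, ENNReal.toReal_pow, ENNReal.toReal_ofReal hd]

lemma volume_inter_hcube_ne_top (F : Set (EuclideanSpace ℝ (Fin N))) (c : Fin N → ℝ) (d : ℝ) :
    volume (F ∩ hcube c d) ≠ ⊤ :=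
  ((measure_mono Set.inter_subset_right).trans_lt (volume_hcube_ne_top c d).lt_top).ne

/-- The scale-invariant version of `exists_lower_bound_of_measure_lt`. -/
lemma exists_lower_bound_of_density_gt (N : ℕ) {Λ α β : ℝ} (hΛ : 1 ≤ Λ) (hβ : 0 < β)
    (hα : 0 ≤ α) (hαβ : α = 1 - β) (hN : 1 ≤ N) :
    ∃ ε₁ c ρ δ : ℝ, 0 < ε₁ ∧ 0 < c ∧ 0 < ρ ∧ 0 < δ ∧ δ < 1 ∧ ∀ ε, 0 < ε →
      ∀ u : EuclideanSpace ℝ (Fin N) → ℝ, Measurable u → (∃ K, ∀ x, |u x| ≤ K) →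
      (∀ x, 0 ≤ u x) → ∀ t, 0 < t →
      (∀ x ∈ cube (fun _ : Fin N => (0 : ℝ)) (10 * Real.sqrt N), Lminus Λ α β ε u x ≤ ρ * t) →
      ∀ (a : Fin N → ℝ) (d : ℝ), 0 < d → ε / d < ε₁ → (∀ i, -(1 / 2) ≤ a i ∧ a i + d ≤ 1 / 2) →
      δ * d ^ N < volume.real ({x | t ≤ u x} ∩ hcube a d) →
      ∀ x : EuclideanSpace ℝ (Fin N), (∀ i, |x i - (a i + d / 2)| ≤ 3 / 2 * d) → c * t ≤ u x := by
  obtain ⟨ε₁, c, ρ, μ, hε₁, hc, hρ, hμ, hU⟩ :=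
    exists_lower_bound_of_measure_lt N hΛ hβ hα hαβ hN
  refine ⟨ε₁, c, ρ, 1 - min μ (1 / 2), hε₁, hc, hρ, by linarith [min_le_right μ (1 / 2)],
    by linarith [lt_min hμ one_half_pos], ?_⟩
  intro ε hε u hm ⟨K, hK⟩ hu t ht hL a d hd hεd ha hdens x hx
  have hsN : 1 ≤ Real.sqrt N := Real.one_le_sqrt.2 (by exact_mod_cast hN)
  have hd1 : d ≤ 1 := by linarith [(ha ⟨0, hN⟩).1, (ha ⟨0, hN⟩).2]
  set z : EuclideanSpace ℝ (Fin N) := WithLp.toLp 2 fun i => a i + d / 2 with hz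
  have key := hU (ε / d) (by positivity) hεd (fun y => t⁻¹ * u (z + d • y))
    ((hm.comp (by fun_prop)).const_mul _)
    ⟨t⁻¹ * K, fun y => by
      rw [abs_mul, abs_of_pos (inv_pos.2 ht)]
      exact mul_le_mul_of_nonneg_left (hK _) (inv_pos.2 ht).le⟩
    (fun y hy => by
      rw [Lminus_comp_affine Λ α β ε u z y hd ht]
      have hmem : z + d • y ∈ cube (fun _ : Fin N => (0 : ℝ)) (10 * Real.sqrt N) := by
        intro i
        rw [mem_ball_zero_iff] at hy
        have h1 := PiLp.norm_apply_le y i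
        rw [Real.norm_eq_abs] at h1
        have h2 := abs_lt.1 (h1.trans_lt hy)
        have h3 := ha i
        simp only [hz, PiLp.add_apply, PiLp.smul_apply, smul_eq_mul, sub_zero]
        rw [abs_lt]
        constructor <;> nlinarith
      have h1 := hL _ hmem
      calc d ^ 2 / t * Lminus Λ α β ε u (z + d • y) ≤ d ^ 2 / t * (ρ * t) := by gcongr
        _ = d ^ 2 * ρ := by field_simp
        _ ≤ 1 * ρ := by gcongr; exact pow_le_one₀ hd.le hd1
        _ = ρ := one_mul ρ)
    (fun y => mul_nonneg (inv_pos.2 ht).le (hu _)) ?_ (d⁻¹ • (x - z)) ?_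
  · rw [smul_smul, mul_inv_cancel₀ hd.ne', one_smul, add_sub_cancel, le_inv_mul_iff₀ ht] at key
    linarith
  · have hsub : cube (fun _ : Fin N => (0 : ℝ)) 1 ∩ {y | t⁻¹ * u (z + d • y) < 1}
        ⊆ (fun y => z + d • y) ⁻¹' (hcube a d \ {x | t ≤ u x}) := by
      rintro y ⟨hy1, hy2⟩
      rw [Set.mem_ofPred_eq, inv_mul_lt_iff₀ ht, mul_one] at hy2
      refine ⟨fun i => ?_, by simpa using hy2⟩
      have := hy1 i
      simp only [sub_zero, abs_lt] at this
      simp only [hz, PiLp.add_apply, PiLp.smul_apply, smul_eq_mul]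
      constructor <;> nlinarith
    have hF : MeasurableSet {x | t ≤ u x} := measurableSet_le measurable_const hm
    have h1 := measureReal_inter_add_sdiff (μ := volume) (s := hcube a d) hF
      (volume_hcube_ne_top a d)
    rw [volume_real_hcube a hd.le, Set.inter_comm] at h1
    have hdN : 0 < d ^ N := by positivity
    have h2 : volume ((fun y => z + d • y) ⁻¹' (hcube a d \ {x | t ≤ u x})) ≠ ⊤ := by
      have h3 : (fun y => z + d • y) ⁻¹' (hcube a d \ {x | t ≤ u x})
        = (fun w => d • w) ⁻¹' ((fun w => z + w) ⁻¹' (hcube a d \ {x | t ≤ u x})) := rfl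
      rw [h3, Measure.addHaar_preimage_smul _ hd.ne', measure_preimage_add]
      exact ENNReal.mul_ne_top ENNReal.ofReal_ne_top
        ((measure_mono Set.sdiff_subset).trans_lt (volume_hcube_ne_top a d).lt_top).ne
    refine (measureReal_mono hsub h2).trans_lt ?_
    rw [volume_real_preimage_affine _ _ hd, inv_mul_lt_iff₀ hdN]
    have : min μ (1 / 2) ≤ μ := min_le_left _ _
    nlinarith
  · intro i
    have := hx i
    simp only [hz, PiLp.smul_apply, PiLp.sub_apply, smul_eq_mul]
    rw [abs_mul, abs_of_pos (inv_pos.2 hd), inv_mul_le_iff₀ hd]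
    linarith

/-- The lower corners of the `n ^ N` half-open subcubes of `hcube a d` of side length `d / n`. -/
noncomputable def subcorner (a : Fin N → ℝ) (d : ℝ) (n : ℕ) (k : Fin N → Fin n) : Fin N → ℝ :=
  fun i => a i + d / n * (k i : ℕ)

lemma le_subcorner (a : Fin N → ℝ) {d : ℝ} (hd : 0 < d) {n : ℕ} (k : Fin N → Fin n) (i : Fin N) :
    a i ≤ subcorner a d n k i ∧ subcorner a d n k i + d / n ≤ a i + d := by
  have hn : (0 : ℝ) < n := by exact_mod_cast (Nat.zero_le _).trans_lt (k i).2
  have h1 : ((k i : ℕ) : ℝ) + 1 ≤ n := by exact_mod_cast (k i).2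
  have h2 : d / n * ((k i : ℕ) + 1) ≤ d / n * n := by gcongr
  rw [div_mul_cancel₀ _ hn.ne'] at h2
  unfold subcorner
  constructor
  · have : 0 ≤ d / n * ((k i : ℕ) : ℝ) := by positivity
    linarith
  · linarith

lemma hcube_eq_iUnion (a : Fin N → ℝ) {d : ℝ} (hd : 0 < d) {n : ℕ} (hn : 0 < n) :
    hcube a d = ⋃ k : Fin N → Fin n, hcube (subcorner a d n k) (d / n) := by
  have hn' : (0 : ℝ) < n := by exact_mod_cast hn
  have hs : 0 < d / n := by positivity
  apply Set.Subset.antisymm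
  · intro x hx
    have h0 : ∀ i, 0 ≤ (x i - a i) / (d / n) := fun i =>
      div_nonneg (by linarith [(hx i).1]) hs.le
    refine Set.mem_iUnion.2 ⟨fun i => ⟨⌊(x i - a i) / (d / n)⌋₊, ?_⟩, fun i => ?_⟩
    · rw [Nat.floor_lt (h0 i), div_lt_iff₀ hs, mul_div_cancel₀ _ hn'.ne']
      linarith [(hx i).2]
    · have h1 := Nat.floor_le (h0 i)
      have h2 := Nat.lt_floor_add_one ((x i - a i) / (d / n))
      rw [le_div_iff₀ hs] at h1
      rw [div_lt_iff₀ hs] at h2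
      simp only [subcorner]
      constructor <;> linarith
  · apply Set.iUnion_subset
    intro k x hx i
    have h1 := le_subcorner a hd k i
    have h2 := hx i
    constructor <;> linarith

lemma disjoint_hcube_subcorner (a : Fin N → ℝ) {d : ℝ} (hd : 0 < d) {n : ℕ} :
    Pairwise (Function.onFun Disjoint fun k : Fin N → Fin n =>
      hcube (subcorner a d n k) (d / n)) := by
  intro k k' hkk
  refine Set.disjoint_left.2 fun x hx hx' => hkk ?_
  funext i
  have hn : (0 : ℝ) < n := by exact_mod_cast (Nat.zero_le _).trans_lt (k i).2
  have hs : 0 < d / n := by positivity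
  have h1 := hx i
  have h2 := hx' i
  simp only [subcorner] at h1 h2
  apply Fin.ext
  have h3 : ((k i : ℕ) : ℝ) < (k' i : ℕ) + 1 := by
    apply lt_of_mul_lt_mul_left _ hs.le
    linarith
  have h4 : ((k' i : ℕ) : ℝ) < (k i : ℕ) + 1 := by
    apply lt_of_mul_lt_mul_left _ hs.le
    linarith
  have h5 : (k i : ℕ) < (k' i : ℕ) + 1 := by exact_mod_cast h3
  have h6 : (k' i : ℕ) < (k i : ℕ) + 1 := by exact_mod_cast h4
  omega

lemma volume_real_inter_hcube {F : Set (EuclideanSpace ℝ (Fin N))} (hF : MeasurableSet F)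
    (a : Fin N → ℝ) {d : ℝ} (hd : 0 < d) {n : ℕ} (hn : 0 < n) :
    volume.real (F ∩ hcube a d)
      = ∑ k : Fin N → Fin n, volume.real (F ∩ hcube (subcorner a d n k) (d / n)) := by
  rw [hcube_eq_iUnion a hd hn, Set.inter_iUnion]
  refine measureReal_iUnion_fintype ?_ (fun k => hF.inter (measurableSet_hcube _ _))
    (fun k => volume_inter_hcube_ne_top _ _ _)
  intro k k' hkk
  exact (disjoint_hcube_subcorner a hd hkk).mono Set.inter_subset_right Set.inter_subset_right

lemma exists_subcorner_density {F : Set (EuclideanSpace ℝ (Fin N))} (hF : MeasurableSet F)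
    (a : Fin N → ℝ) {d κ : ℝ} (hd : 0 < d) {n : ℕ} (hn : 0 < n)
    (h : κ * d ^ N ≤ volume.real (F ∩ hcube a d)) :
    ∃ k : Fin N → Fin n,
      κ * (d / n) ^ N ≤ volume.real (F ∩ hcube (subcorner a d n k) (d / n)) := by
  have hn' : (0 : ℝ) < n := by exact_mod_cast hn
  have : Nonempty (Fin n) := ⟨⟨0, hn⟩⟩
  by_contra! hcon
  rw [volume_real_inter_hcube hF a hd hn] at h
  have h1 := Finset.sum_lt_sum_of_nonempty (Finset.univ_nonempty (α := Fin N → Fin n))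
    fun k _ => hcon k
  have h2 : ∑ _k : Fin N → Fin n, κ * (d / n) ^ N = κ * d ^ N := by
    simp only [Finset.sum_const, Finset.card_univ, Fintype.card_fun, Fintype.card_fin,
      nsmul_eq_mul, Nat.cast_pow, div_pow]
    field_simp
  linarith

/-- A finite-scale Calderón–Zygmund decomposition. -/
lemma volume_le_of_dyadic {F G : Set (EuclideanSpace ℝ (Fin N))} (hF : MeasurableSet F)
    (hG : MeasurableSet G) {κ δ s l r : ℝ} (hκ : 0 ≤ κ) (hδ : 0 ≤ δ) (hs : 0 < s)
    (hbase : ∀ a : Fin N → ℝ, (∀ i, l ≤ a i ∧ a i + s ≤ r) →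
      κ * s ^ N ≤ volume.real (F ∩ hcube a s) → hcube a s ⊆ G)
    (hstep : ∀ (a : Fin N → ℝ) (d : ℝ), s ≤ d → (∀ i, l ≤ a i ∧ a i + d ≤ r) →
      δ * d ^ N < volume.real (F ∩ hcube a d) →
      ∀ x : EuclideanSpace ℝ (Fin N), (∀ i, |x i - (a i + d / 2)| ≤ 3 / 2 * d) → x ∈ G)
    (j : ℕ) (a : Fin N → ℝ) (ha : ∀ i, l ≤ a i ∧ a i + 2 ^ j * s ≤ r)
    (hdens : volume.real (F ∩ hcube a (2 ^ j * s)) ≤ δ * (2 ^ j * s) ^ N) :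
    volume.real (F ∩ hcube a (2 ^ j * s))
      ≤ δ * volume.real (G ∩ hcube a (2 ^ j * s)) + κ * (2 ^ j * s) ^ N := by
  have hfull : ∀ (a : Fin N → ℝ) (d : ℝ), 0 < d → hcube a d ⊆ G →
      volume.real (F ∩ hcube a d) ≤ δ * d ^ N →
      volume.real (F ∩ hcube a d) ≤ δ * volume.real (G ∩ hcube a d) + κ * d ^ N := by
    intro a d hd hsub hle
    rw [Set.inter_eq_self_of_subset_right hsub, volume_real_hcube a hd.le]
    have : 0 ≤ κ * d ^ N := by positivity
    linarith
  induction j generalizing a with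
  | zero =>
    simp only [pow_zero, one_mul] at *
    rcases le_total (κ * s ^ N) (volume.real (F ∩ hcube a s)) with h | h
    · exact hfull a s hs (hbase a ha h) hdens
    · have : 0 ≤ δ * volume.real (G ∩ hcube a s) := by positivity
      linarith
  | succ j ih =>
    have hd : 0 < 2 ^ j * s := by positivity
    obtain ⟨d, hdd⟩ : ∃ d, d = 2 ^ j * s := ⟨_, rfl⟩
    have hdd' : 2 ^ (j + 1) * s = 2 * d := by rw [hdd]; ring
    have hhalf : 2 * d / ((2 : ℕ) : ℝ) = d := by push_cast; ring
    rw [← hdd] at ih hd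
    rw [hdd'] at ha hdens ⊢
    have hsd : s ≤ d := by
      rw [hdd]
      have : (1 : ℝ) ≤ 2 ^ j := one_le_pow₀ (by norm_num)
      nlinarith
    have hcorner : ∀ (k : Fin N → Fin 2) i, a i ≤ subcorner a (2 * d) 2 k i ∧
        subcorner a (2 * d) 2 k i + d ≤ a i + 2 * d := by
      intro k i
      have := le_subcorner a (by positivity : 0 < 2 * d) k i
      rwa [hhalf] at this
    have hchild : ∀ (k : Fin N → Fin 2) i, l ≤ subcorner a (2 * d) 2 k i ∧
        subcorner a (2 * d) 2 k i + d ≤ r := by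
      intro k i
      have h1 := hcorner k i
      have h2 := ha i
      constructor <;> linarith
    by_cases hex : ∃ k : Fin N → Fin 2,
        δ * d ^ N < volume.real (F ∩ hcube (subcorner a (2 * d) 2 k) d)
    · obtain ⟨k, hk⟩ := hex
      refine hfull a (2 * d) (by positivity) (fun x hx => ?_) hdens
      refine hstep _ d hsd (hchild k) hk x fun i => ?_
      have h1 := hcorner k i
      have h2 := hx i
      rw [abs_le]
      constructor <;> linarith
    · push Not at hex
      rw [volume_real_inter_hcube hF a (by positivity) two_pos,
        volume_real_inter_hcube hG a (by positivity) two_pos, hhalf, Finset.mul_sum]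
      calc ∑ k : Fin N → Fin 2, volume.real (F ∩ hcube (subcorner a (2 * d) 2 k) d)
          ≤ ∑ k : Fin N → Fin 2, (δ * volume.real (G ∩ hcube (subcorner a (2 * d) 2 k) d)
              + κ * d ^ N) := Finset.sum_le_sum fun k _ => ih _ (hchild k) (hex k)
        _ = _ := by
          rw [Finset.sum_add_distrib]
          simp [mul_pow]
          ring

lemma norm_le_sqrt_mul {x : EuclideanSpace ℝ (Fin N)} {D : ℝ} (hD : 0 ≤ D)
    (h : ∀ i, |x i| ≤ D) : ‖x‖ ≤ Real.sqrt N * D := by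
  rw [EuclideanSpace.norm_eq, Real.sqrt_le_left (by positivity), mul_pow,
    Real.sq_sqrt (Nat.cast_nonneg N)]
  calc ∑ i, ‖x i‖ ^ 2 ≤ ∑ _i : Fin N, D ^ 2 := by
        gcongr with i
        exact h i
    _ = N * D ^ 2 := by simp

lemma norm_sub_corner_le {a : Fin N → ℝ} {d : ℝ} (hd : 0 ≤ d) {x : EuclideanSpace ℝ (Fin N)}
    (hx : x ∈ hcube a d) : ‖x - WithLp.toLp 2 a‖ ≤ Real.sqrt N * d := by
  refine norm_le_sqrt_mul hd fun i => ?_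
  have := hx i
  simp only [PiLp.sub_apply]
  rw [abs_le]
  constructor <;> linarith

lemma exists_ball_subset_ball_inter_ball {x y : EuclideanSpace ℝ (Fin N)} {R ε : ℝ} (hε : 0 < ε)
    (hR : ε / 2 ≤ R) (h : ‖x - y‖ < R + ε / 2) :
    ∃ q, ball q (ε / 4) ⊆ ball y R ∩ ball x ε := by
  have hpos : 0 < R + ε / 2 := by linarith
  set s : ℝ := (R - ε / 4) / (R + ε / 2) with hs
  have hs0 : 0 ≤ s := div_nonneg (by linarith) hpos.le
  have hs1 : s * (R + ε / 2) = R - ε / 4 := div_mul_cancel₀ _ hpos.ne'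
  have hs2 : s ≤ 1 := by rw [hs, div_le_one hpos]; linarith
  refine ⟨y + s • (x - y), Set.subset_inter (ball_subset_ball' ?_) (ball_subset_ball' ?_)⟩
  · rw [dist_eq_norm, add_sub_cancel_left, norm_smul, Real.norm_of_nonneg hs0]
    have := mul_le_mul_of_nonneg_left h.le hs0
    linarith
  · have h1 : y + s • (x - y) - x = (1 - s) • (y - x) := by module
    rw [dist_eq_norm, h1, norm_smul, norm_sub_rev y x, Real.norm_of_nonneg (by linarith)]
    have := mul_le_mul_of_nonneg_left h.le (by linarith : 0 ≤ 1 - s)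
    linarith

/-- One step of the propagation of lower bounds. -/
lemma le_of_ball_le {Λ α β ε f : ℝ} (hΛ : 0 < Λ) (hα : 0 ≤ α) (hαβ : α = 1 - β) (hβ : 0 < β)
    (hε : 0 < ε) {u : EuclideanSpace ℝ (Fin N) → ℝ} (hm : Measurable u) {K : ℝ}
    (hK : ∀ x, |u x| ≤ K) (hu : ∀ y, 0 ≤ u y) {x y : EuclideanSpace ℝ (Fin N)}
    (hL : Lminus Λ α β ε u x ≤ f) {R t : ℝ} (hR : ε / 2 ≤ R) (h : ‖x - y‖ < R + ε / 2)
    (ht : ∀ w ∈ ball y R, t ≤ u w) : β / 4 ^ N * t - ε ^ 2 * f ≤ u x := by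
  obtain ⟨q, hq⟩ := exists_ball_subset_ball_inter_ball hε hR h
  have hω := unitVol_pos N
  have := le_of_density hΛ hα hαβ hβ hε hm hK hu hL measurableSet_ball
    (hq.trans Set.inter_subset_right) (fun w hw => ht w (hq hw).1)
  rw [volume_real_ball _ (by positivity)] at this
  calc β / 4 ^ N * t - ε ^ 2 * f
      = β * t * ((ε / 4) ^ N * unitVol N) / (ε ^ N * unitVol N) - ε ^ 2 * f := by
        rw [div_pow]; field_simp
    _ ≤ _ := this

lemma le_of_iterate_ball {Λ α β ε f : ℝ} (hΛ : 0 < Λ) (hα : 0 ≤ α) (hαβ : α = 1 - β) (hβ : 0 < β)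
    (hε : 0 < ε) {u : EuclideanSpace ℝ (Fin N) → ℝ} (hm : Measurable u) {K : ℝ}
    (hK : ∀ x, |u x| ≤ K) (hu : ∀ y, 0 ≤ u y) {y : EuclideanSpace ℝ (Fin N)} {J : ℕ}
    (hL : ∀ x, ‖x - y‖ < (J + 1) * (ε / 2) → Lminus Λ α β ε u x ≤ f) {t : ℝ} (ht0 : 0 ≤ t)
    (hf : ε ^ 2 * f ≤ (β / 4 ^ N / 2) ^ J * t)
    (ht : ∀ w ∈ ball y (ε / 2), t ≤ u w) :
    ∀ k ≤ J, ∀ x ∈ ball y ((k + 1) * (ε / 2)), (β / 4 ^ N / 2) ^ k * t ≤ u x := by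
  have hb0 : 0 ≤ β / 4 ^ N / 2 := by positivity
  have hb1 : β / 4 ^ N / 2 ≤ 1 := by
    have h1 : β / 4 ^ N ≤ 1 := by
      rw [div_le_one (by positivity)]
      have : (1 : ℝ) ≤ 4 ^ N := one_le_pow₀ (by norm_num)
      linarith
    linarith
  intro k
  induction k with
  | zero => intro _ x hx; simpa using ht x (by simpa using hx)
  | succ k ih =>
    intro hk x hx
    rw [mem_ball, dist_eq_norm] at hx
    push_cast at hx
    have hkJ : (k : ℝ) + 1 ≤ J := by exact_mod_cast hk
    have hk0 : (0 : ℝ) ≤ k := Nat.cast_nonneg k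
    have h1 := le_of_ball_le hΛ hα hαβ hβ hε hm hK hu (hL x (by nlinarith))
      (R := (k + 1) * (ε / 2)) (by nlinarith) (by linarith) (ih (by omega))
    have h2 : (β / 4 ^ N / 2) ^ J * t ≤ (β / 4 ^ N / 2) ^ (k + 1) * t := by
      gcongr ?_ * t
      exact pow_le_pow_of_le_one hb0 hb1 hk
    have h3 : β / 4 ^ N * ((β / 4 ^ N / 2) ^ k * t) = 2 * ((β / 4 ^ N / 2) ^ (k + 1) * t) := by
      rw [pow_succ]; ring
    linarith

/-- On cubes of side length comparable to `ε`, positive density propagates to a pointwise lower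
bound. -/
lemma exists_lower_bound_of_density_ge (N : ℕ) {Λ α β : ℝ} (hΛ : 1 ≤ Λ) (hβ : 0 < β)
    (hα : 0 ≤ α) (hαβ : α = 1 - β) (hN : 1 ≤ N) {K : ℝ} (hK0 : 0 < K) :
    ∃ ε₂ : ℝ, 0 < ε₂ ∧ ∀ κ : ℝ, 0 < κ → ∃ c : ℝ, 0 < c ∧ ∀ ε, 0 < ε → ε < ε₂ →
      ∀ u : EuclideanSpace ℝ (Fin N) → ℝ, Measurable u → (∃ K, ∀ x, |u x| ≤ K) →
      (∀ x, 0 ≤ u x) → ∀ t, 0 < t →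
      (∀ x ∈ cube (fun _ : Fin N => (0 : ℝ)) (10 * Real.sqrt N), Lminus Λ α β ε u x ≤ c * t) →
      ∀ (a : Fin N → ℝ) (d : ℝ), K * ε ≤ d → d ≤ 2 * (K * ε) →
      (∀ i, -(1 / 2) ≤ a i ∧ a i + d ≤ 1 / 2) →
      κ * d ^ N ≤ volume.real ({x | t ≤ u x} ∩ hcube a d) →
      ∀ x ∈ hcube a d, c * t ≤ u x := by
  have hω := unitVol_pos N
  have hsN : 1 ≤ Real.sqrt N := Real.one_le_sqrt.2 (by exact_mod_cast hN)
  obtain ⟨J, hJ⟩ : ∃ J, J = ⌈4 * K * Real.sqrt N⌉₊ := ⟨_, rfl⟩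
  have hJ0 : 0 < J := by rw [hJ]; exact Nat.ceil_pos.2 (by positivity)
  have hJ1 : 4 * K * Real.sqrt N ≤ J := by rw [hJ]; exact Nat.le_ceil _
  have hJ2 : (0 : ℝ) < J := by exact_mod_cast hJ0
  refine ⟨1 / (J + 1), by positivity, fun κ hκ => ?_⟩
  have hb0 : 0 < β / 4 ^ N / 2 := by positivity
  have hb1 : β / 4 ^ N / 2 ≤ 1 := by
    have h1 : β / 4 ^ N ≤ 1 := by
      rw [div_le_one (by positivity)]
      have : (1 : ℝ) ≤ 4 ^ N := one_le_pow₀ (by norm_num)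
      linarith
    linarith
  obtain ⟨γ, hγ⟩ : ∃ γ, γ = β * κ * (K / J) ^ N / (2 * unitVol N) := ⟨_, rfl⟩
  have hγ0 : 0 < γ := by rw [hγ]; positivity
  refine ⟨(β / 4 ^ N / 2) ^ J * γ, by positivity, ?_⟩
  intro ε hε hε2 u hm ⟨M, hM⟩ hu t ht hL a d hd1 hd2 ha hdens
  have hd : 0 < d := lt_of_lt_of_le (by positivity) hd1
  rw [lt_div_iff₀ (by positivity)] at hε2
  have hε1 : ε ≤ 1 := by nlinarith
  have hF : MeasurableSet {x | t ≤ u x} := measurableSet_le measurable_const hm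
  obtain ⟨k, hk⟩ := exists_subcorner_density hF a hd hJ0 hdens
  have hsub := le_subcorner a hd k
  set y : EuclideanSpace ℝ (Fin N) := WithLp.toLp 2 (subcorner a d J k) with hy
  have hdJ : Real.sqrt N * (d / J) ≤ ε / 2 := by
    rw [mul_div_assoc', div_le_iff₀ hJ2]
    calc Real.sqrt N * d ≤ Real.sqrt N * (2 * (K * ε)) := by gcongr
      _ = ε / 2 * (4 * K * Real.sqrt N) := by ring
      _ ≤ ε / 2 * J := by gcongr
  have hdJ0 : 0 < d / J := by positivity
  have hLy : ∀ x, ‖x - y‖ < (J + 1) * (ε / 2) →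
      Lminus Λ α β ε u x ≤ (β / 4 ^ N / 2) ^ J * γ * t := by
    intro x hx
    refine hL x fun i => ?_
    have h1 := PiLp.norm_apply_le (x - y) i
    rw [Real.norm_eq_abs, PiLp.sub_apply, hy] at h1
    have h2 := abs_lt.1 (h1.trans_lt hx)
    have h3 := hsub i
    have h4 := ha i
    simp only [sub_zero]
    rw [abs_lt]
    constructor <;> linarith
  have hf0 : ε ^ 2 * ((β / 4 ^ N / 2) ^ J * γ * t) ≤ (β / 4 ^ N / 2) ^ J * (γ * t) := by
    rw [mul_assoc ((β / 4 ^ N / 2) ^ J)]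
    exact mul_le_of_le_one_left (by positivity) (pow_le_one₀ hε.le hε1)
  have hf1 : (β / 4 ^ N / 2) ^ J * (γ * t) ≤ γ * t :=
    mul_le_of_le_one_left (by positivity) (pow_le_one₀ hb0.le hb1)
  have hstart : ∀ w ∈ ball y (ε / 2), γ * t ≤ u w := by
    intro w hw
    rw [mem_ball, dist_eq_norm] at hw
    have h1 := le_of_density (by linarith) hα hαβ hβ hε hm hM hu
      (hLy w (by nlinarith)) (hF.inter (measurableSet_hcube (subcorner a d J k) (d / J)))
      (fun v hv => by
        have h2 := norm_sub_corner_le hdJ0.le hv.2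
        rw [mem_ball, dist_eq_norm]
        calc ‖v - w‖ ≤ ‖v - y‖ + ‖y - w‖ := norm_sub_le_norm_sub_add_norm_sub _ _ _
          _ < ε := by rw [norm_sub_rev y w]; linarith)
      (fun v hv => hv.1)
    have h3 : 2 * (γ * t) ≤ β * t * volume.real ({x | t ≤ u x} ∩
        hcube (subcorner a d J k) (d / J)) / (ε ^ N * unitVol N) := by
      rw [le_div_iff₀ (by positivity)]
      calc 2 * (γ * t) * (ε ^ N * unitVol N) = β * t * (κ * (K * ε / J) ^ N) := by
            rw [hγ, show K * ε / J = K / J * ε by ring, mul_pow]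
            generalize (K / J) ^ N = p
            field_simp
        _ ≤ β * t * (κ * (d / J) ^ N) := by gcongr
        _ ≤ _ := by gcongr
    linarith
  intro x hx
  have h1 := le_of_iterate_ball (by linarith) hα hαβ hβ hε hm hM hu hLy (by positivity : 0 ≤ γ * t)
    hf0 hstart J le_rfl x ?_
  · linarith
  · rw [mem_ball, dist_eq_norm]
    have h2 : ‖x - y‖ ≤ Real.sqrt N * d := by
      refine norm_le_sqrt_mul hd.le fun i => ?_
      have h3 := hx i
      have h4 := hsub i
      rw [PiLp.sub_apply, hy, abs_le]
      constructor <;> simp only <;> linarith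
    have h5 : Real.sqrt N * d ≤ ε / 2 * J := by
      calc Real.sqrt N * d ≤ Real.sqrt N * (2 * (K * ε)) := by gcongr
        _ = ε / 2 * (4 * K * Real.sqrt N) := by ring
        _ ≤ ε / 2 * J := by gcongr
    linarith

end DeGiorgi

/-- **De Giorgi oscillation lemma.** Given `θ ∈ (0,1)`, there exist `ε₀ > 0`,
`ρ > 0` (depending only on `N, Λ, α, β`) and `η = η(θ) ∈ (0,1)` such that: if `u` is bounded
Borel measurable with `L_ε^- u ≤ ηρ` in `Q_{10√N}` and `u ≥ 0` in `ℝ^N`, for some `0 < ε < ε₀`,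
and `|Q_1 ∩ {u > 1}| ≥ θ`, then `inf_{Q_3} u ≥ η`. -/
theorem deGiorgi_oscillation (N : ℕ) (hN : 1 ≤ N) (Λ α β : ℝ) (hΛ : 1 ≤ Λ)
    (hβ : β ∈ Set.Ioc (0 : ℝ) 1) (hα : α = 1 - β) :
    ∃ (ε₀ ρ : ℝ), 0 < ε₀ ∧ 0 < ρ ∧
      ∀ θ ∈ Set.Ioo (0 : ℝ) 1, ∃ η ∈ Set.Ioo (0 : ℝ) 1,
        ∀ ε : ℝ, 0 < ε → ε < ε₀ →
          ∀ u : EuclideanSpace ℝ (Fin N) → ℝ,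
            Measurable u → (∃ K, ∀ x, |u x| ≤ K) →
            (∀ x ∈ cube (fun _ : Fin N => (0 : ℝ)) (10 * Real.sqrt N),
              Lminus Λ α β ε u x ≤ η * ρ) →
            (∀ x, 0 ≤ u x) →
            ENNReal.ofReal θ ≤
              volume (cube (fun _ : Fin N => (0 : ℝ)) 1 ∩ {x | 1 < u x}) →
            ∀ x ∈ cube (fun _ : Fin N => (0 : ℝ)) 3, η ≤ u x := by
  obtain ⟨hβ0, hβ1⟩ := hβ
  have hα0 : 0 ≤ α := by linarith
  obtain ⟨ε₁, c₁, ρ₁, δ, hε₁, hc₁, hρ₁, hδ0, hδ1, h₁⟩ :=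
    DeGiorgi.exists_lower_bound_of_density_gt N hΛ hβ0 hα0 hα hN
  obtain ⟨ε₂, hε₂, h₂⟩ := DeGiorgi.exists_lower_bound_of_density_ge N hΛ hβ0 hα0 hα hN
    (by positivity : 0 < 2 / ε₁)
  refine ⟨min ε₂ (ε₁ / 2), 1, by positivity, one_pos, fun θ ⟨hθ0, hθ1⟩ => ?_⟩
  obtain ⟨κ, hκ⟩ : ∃ κ, κ = θ * (1 - δ) / 2 := ⟨_, rfl⟩
  have hκ0 : 0 < κ := by
    rw [hκ]
    have : 0 < 1 - δ := by linarith
    positivity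
  obtain ⟨c₂, hc₂, h₂⟩ := h₂ κ hκ0
  obtain ⟨c, hc0, hcc₁, hcc₂, hcρ₁, hc1⟩ :
      ∃ c, 0 < c ∧ c ≤ c₁ ∧ c ≤ c₂ ∧ c ≤ ρ₁ ∧ c < 1 :=
    ⟨min (min c₁ c₂) (min ρ₁ (1 / 2)), by positivity,
      (min_le_left _ _).trans (min_le_left _ _), (min_le_left _ _).trans (min_le_right _ _),
      (min_le_right _ _).trans (min_le_left _ _),
      ((min_le_right _ _).trans (min_le_right _ _)).trans_lt (by norm_num)⟩
  have hq : 1 < (1 + δ) / (2 * δ) := by rw [one_lt_div (by positivity)]; linarith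
  obtain ⟨M, hM⟩ := pow_unbounded_of_one_lt (1 / θ) hq
  rw [div_lt_iff₀ hθ0] at hM
  refine ⟨c ^ (M + 1), ⟨by positivity, pow_lt_one₀ hc0.le hc1 (by omega)⟩, ?_⟩
  intro ε hε hε0 u hm hK hL hu hvol
  obtain ⟨hεε₂, hεε₁⟩ := lt_min_iff.1 hε0
  have hcM : ∀ k ≤ M, c ^ (M + 1) ≤ c * c ^ k := fun k hk => by
    rw [← pow_succ']
    exact pow_le_pow_of_le_one hc0.le hc1.le (by omega)
  by_contra hcon
  have hnot : ∀ k ≤ M, ¬ ∀ x ∈ cube (fun _ : Fin N => (0 : ℝ)) 3, c * c ^ k ≤ u x :=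
    fun k hk h => hcon fun x hx => (hcM k hk).trans (h x hx)
  have hstep : ∀ k ≤ M, volume.real ({x | c ^ k ≤ u x} ∩ DeGiorgi.hcube (fun _ => -(1 / 2)) 1)
      ≤ δ * volume.real ({x | c ^ (k + 1) ≤ u x} ∩ DeGiorgi.hcube (fun _ => -(1 / 2)) 1)
        + κ := by
    intro k hk
    have hck : 0 < c ^ k := by positivity
    have hL₁ : ∀ x ∈ cube (fun _ : Fin N => (0 : ℝ)) (10 * Real.sqrt N),
        Lminus Λ α β ε u x ≤ ρ₁ * c ^ k := fun x hx => by
      refine (hL x hx).trans ?_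
      rw [mul_one]
      exact (hcM k hk).trans (by gcongr)
    have hL₂ : ∀ x ∈ cube (fun _ : Fin N => (0 : ℝ)) (10 * Real.sqrt N),
        Lminus Λ α β ε u x ≤ c₂ * c ^ k := fun x hx => by
      refine (hL x hx).trans ?_
      rw [mul_one]
      exact (hcM k hk).trans (by gcongr)
    obtain ⟨j, hj1, hj2⟩ := exists_nat_pow_near_of_lt_one (x := 2 / ε₁ * ε) (y := 1 / 2)
      (by positivity) (by rw [div_mul_eq_mul_div, div_le_one hε₁]; linarith) (by norm_num)
      (by norm_num)
    have hj : (2 : ℝ) ^ j * (1 / 2) ^ j = 1 := by rw [← mul_pow]; norm_num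
    have hsmall : ∀ d : ℝ, (1 / 2) ^ j ≤ d → ε / d < ε₁ := fun d hd => by
      have hd0 : 0 < d := lt_of_lt_of_le (by positivity) hd
      have : 2 / ε₁ * ε ≤ d := hj2.trans hd
      rw [div_mul_eq_mul_div, div_le_iff₀ hε₁] at this
      rw [div_lt_iff₀ hd0]
      linarith
    have hgt : ∀ (a : Fin N → ℝ) (d : ℝ), (1 / 2) ^ j ≤ d →
        (∀ i, -(1 / 2) ≤ a i ∧ a i + d ≤ 1 / 2) →
        δ * d ^ N < volume.real ({x | c ^ k ≤ u x} ∩ DeGiorgi.hcube a d) →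
        ∀ x : EuclideanSpace ℝ (Fin N), (∀ i, |x i - (a i + d / 2)| ≤ 3 / 2 * d) →
          c * c ^ k ≤ u x := fun a d hd ha hdens x hx =>
      (by gcongr : c * c ^ k ≤ c₁ * c ^ k).trans
        (h₁ ε hε u hm hK hu _ hck hL₁ a d (lt_of_lt_of_le (by positivity) hd) (hsmall d hd) ha
          hdens x hx)
    have hcz := DeGiorgi.volume_le_of_dyadic (F := {x | c ^ k ≤ u x})
      (G := {x | c ^ (k + 1) ≤ u x}) (measurableSet_le measurable_const hm)
      (measurableSet_le measurable_const hm) hκ0.le hδ0.le (s := (1 / 2) ^ j) (by positivity)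
      (l := -(1 / 2)) (r := 1 / 2)
      (fun a ha hdens x hx => by
        rw [Set.mem_ofPred_eq, pow_succ']
        exact (by gcongr : c * c ^ k ≤ c₂ * c ^ k).trans
          (h₂ ε hε hεε₂ u hm hK hu _ hck hL₂ a _ hj2 (by rw [pow_succ] at hj1; linarith) ha
            hdens x hx))
      (fun a d hd ha hdens x hx => by
        rw [Set.mem_ofPred_eq, pow_succ']
        exact hgt a d hd ha hdens x hx)
      j (fun _ => -(1 / 2)) (fun _ => by rw [hj]; norm_num)
    rw [hj] at hcz
    simp only [one_pow, mul_one] at hcz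
    refine hcz ?_
    by_contra! hdens
    refine hnot k hk fun x hx => hgt (fun _ => -(1 / 2)) 1 (pow_le_one₀ (by norm_num) (by norm_num))
      (fun _ => by norm_num) (by simpa using hdens) x fun i => ?_
    have := hx i
    norm_num at this ⊢
    exact this.le
  have hgrow : ∀ k ≤ M, θ * ((1 + δ) / (2 * δ)) ^ k ≤
      volume.real ({x | c ^ k ≤ u x} ∩ DeGiorgi.hcube (fun _ => -(1 / 2)) 1) := by
    intro k
    induction k with
    | zero =>
      intro _
      rw [pow_zero, pow_zero, mul_one, Measure.real,
        ← ENNReal.ofReal_le_iff_le_toReal (DeGiorgi.volume_inter_hcube_ne_top _ _ _)]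
      refine hvol.trans (measure_mono ?_)
      rintro x ⟨hx1, hx2⟩
      refine ⟨show 1 ≤ u x from le_of_lt hx2, fun i => ?_⟩
      have := hx1 i
      rw [sub_zero, abs_lt] at this
      constructor <;> linarith
    | succ k ih =>
      intro hk
      have h3 := ih (by omega)
      have h4 := hstep k (by omega)
      have h5 : θ * 1 ≤ θ * ((1 + δ) / (2 * δ)) ^ k := by
        gcongr
        exact one_le_pow₀ hq.le
      have h6 : θ * ((1 + δ) / (2 * δ)) ^ (k + 1) * δ
          = θ * ((1 + δ) / (2 * δ)) ^ k * (1 + δ) / 2 := by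
        rw [pow_succ]
        generalize ((1 + δ) / (2 * δ)) ^ k = p
        field_simp
      refine le_of_mul_le_mul_right ?_ hδ0
      rw [h6]
      nlinarith
  have h7 := hgrow M le_rfl
  have h8 : volume.real ({x | c ^ M ≤ u x} ∩ DeGiorgi.hcube (fun _ => -(1 / 2)) 1) ≤ 1 := by
    refine (measureReal_mono Set.inter_subset_right (DeGiorgi.volume_hcube_ne_top _ _)).trans ?_
    rw [DeGiorgi.volume_real_hcube _ zero_le_one, one_pow]
  linarith
end
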